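/- Long-time existence under supercritical phase (Theorem 1.2, reduced Calabi-symmetry form): Let n ≥ 3 be an integer, a > 1, and let σ : [1,a] → ℝ be smooth with σ > 0 on (1,a) and σ(1) = σ(a) = 0. Let f₀ : [1,a] → ℝ be smooth with supercritical phase, i.e. (n−1)·arctan(f₀(x)/x) + arctan(f₀'(x)) > (n−2)·π/2 for all x ∈ [1,a]. Then there exists a smooth function f : [0,∞) × [1,a] → ℝ with f(0,·) = f₀ solving ∂_t f = σ(x)·( (∂_xx f)/(1 + (∂_x f)²) + (n−1)·(x·∂_x f − f)/(x² + f²) ) for all t ≥ 0; i.e., the reduced line bundle mean curvature flow starting at f₀ exists for all time. -/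

import Mathlib

open Real Set

/-- The right-hand side of the reduced line bundle mean curvature flow under Calabi symmetry. -/
noncomputable def flowRHS (n : ℕ) (a : ℝ) (σ : ℝ → ℝ) (f : ℝ → ℝ → ℝ) (t x : ℝ) : ℝ :=
  σ x * (derivWithin (derivWithin (f t) (Icc 1 a)) (Icc 1 a) x /
      (1 + (derivWithin (f t) (Icc 1 a) x) ^ 2) +
    ((n : ℝ) - 1) * (x * derivWithin (f t) (Icc 1 a) x - f t x) / (x ^ 2 + (f t x) ^ 2))

/-! ### Differential polynomials in the jet of the solution -/

/-- Variables of the differential polynomials: the coordinate `x`, the derivatives `sg i` of `σ`,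
`p = 1 / (1 + u₁²)`, `q = 1 / (x² + u₀²)` and the jet coordinates `u i`. -/
inductive JVar
  | x
  | sg (i : ℕ)
  | p
  | q
  | u (i : ℕ)

namespace JVar

/-- The highest jet coordinate involved in a variable. -/
def ord : JVar → ℕ
  | x => 0
  | sg _ => 0
  | p => 1
  | q => 0
  | u i => i

end JVar

/-- The ring of differential polynomials. -/
def JP : Type := MvPolynomial JVar ℝ

noncomputable instance : CommRing JP := inferInstanceAs (CommRing (MvPolynomial JVar ℝ))

noncomputable instance : Algebra ℝ JP := inferInstanceAs (Algebra ℝ (MvPolynomial JVar ℝ))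

/-- A variable as a differential polynomial. -/
noncomputable def jX (v : JVar) : JP := (MvPolynomial.X v : MvPolynomial JVar ℝ)

/-- A constant as a differential polynomial. -/
noncomputable def jC : ℝ →+* JP := algebraMap ℝ JP

/-- The `x`-derivatives of the variables. -/
noncomputable def jDX : JVar → JP
  | .x => 1
  | .sg i => jX (.sg (i + 1))
  | .p => -2 * jX (.u 1) * jX (.u 2) * jX .p ^ 2
  | .q => -2 * (jX .x + jX (.u 0) * jX (.u 1)) * jX .q ^ 2
  | .u i => jX (.u (i + 1))

/-- The total `x`-derivative on differential polynomials. -/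
noncomputable def jD : Derivation ℝ JP JP :=
  (MvPolynomial.mkDerivation (A := MvPolynomial JVar ℝ) ℝ jDX : Derivation ℝ (MvPolynomial JVar ℝ) (MvPolynomial JVar ℝ))

lemma jD_X (v : JVar) : jD (jX v) = jDX v :=
  MvPolynomial.mkDerivation_X (A := MvPolynomial JVar ℝ) ℝ jDX v

/-- Differential polynomials of order at most `m`. -/
noncomputable def jS (m : ℕ) : Subalgebra ℝ JP :=
  Algebra.adjoin ℝ (jX '' {v | v.ord ≤ m})

/-- The right-hand side of the flow as a differential polynomial. -/
noncomputable def jF (ν : ℝ) : JP :=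
  jX (.sg 0) * (jX .p * jX (.u 2) + jC ν * (jX .x * jX (.u 1) - jX (.u 0)) * jX .q)

section

@[simp] lemma jD_x : jD (jX .x) = 1 := jD_X _
@[simp] lemma jD_sg (i : ℕ) : jD (jX (.sg i)) = jX (.sg (i + 1)) := jD_X _
@[simp] lemma jD_u (i : ℕ) : jD (jX (.u i)) = jX (.u (i + 1)) := jD_X _
@[simp] lemma jD_p : jD (jX .p) = -2 * jX (.u 1) * jX (.u 2) * jX .p ^ 2 := jD_X _
@[simp] lemma jD_q : jD (jX .q) = -2 * (jX .x + jX (.u 0) * jX (.u 1)) * jX .q ^ 2 := jD_X _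
@[simp] lemma jD_C (c : ℝ) : jD (jC c) = 0 := jD.map_algebraMap c

lemma jD_mul (r r' : JP) : jD (r * r') = r * jD r' + r' * jD r := by
  rw [Derivation.leibniz]; simp [smul_eq_mul]

lemma jS_mono {m m' : ℕ} (h : m ≤ m') : jS m ≤ jS m' :=
  Algebra.adjoin_mono (image_mono fun v (hv : v.ord ≤ m) => hv.trans h)

lemma mem_jS_of_ord {m : ℕ} {v : JVar} (h : v.ord ≤ m) : (jX v : JP) ∈ jS m :=
  Algebra.subset_adjoin ⟨v, h, rfl⟩

lemma C_mem_jS (m : ℕ) (c : ℝ) : (jC c : JP) ∈ jS m :=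
  (jS m).algebraMap_mem c

lemma jS_induction {m : ℕ} {P : JP → Prop}
    (hX : ∀ v : JVar, v.ord ≤ m → P (jX v)) (hC : ∀ c, P (jC c))
    (hadd : ∀ r r', r ∈ jS m → r' ∈ jS m → P r → P r' → P (r + r'))
    (hmul : ∀ r r', r ∈ jS m → r' ∈ jS m → P r → P r' → P (r * r'))
    {r : JP} (hr : r ∈ jS m) : P r := by
  induction hr using Algebra.adjoin_induction with
  | mem y hy => obtain ⟨v, hv, rfl⟩ := hy; exact hX v hv
  | algebraMap c => exact hC c
  | add r₁ r₂ h₁ h₂ ih₁ ih₂ => exact hadd r₁ r₂ h₁ h₂ ih₁ ih₂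
  | mul r₁ r₂ h₁ h₂ ih₁ ih₂ => exact hmul r₁ r₂ h₁ h₂ ih₁ ih₂

/-- Membership of `jS` is proved by the subalgebra closure properties. -/
lemma u_mem_jS {m i : ℕ} (h : i ≤ m) : (jX (.u i) : JP) ∈ jS m := mem_jS_of_ord h
lemma sg_mem_jS (m i : ℕ) : (jX (.sg i) : JP) ∈ jS m :=
  mem_jS_of_ord (Nat.zero_le _)
lemma x_mem_jS (m : ℕ) : (jX .x : JP) ∈ jS m := mem_jS_of_ord (Nat.zero_le _)
lemma q_mem_jS (m : ℕ) : (jX .q : JP) ∈ jS m := mem_jS_of_ord (Nat.zero_le _)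
lemma p_mem_jS {m : ℕ} (h : 1 ≤ m) : (jX .p : JP) ∈ jS m := mem_jS_of_ord h
lemma ofNat_mem_jS (m k : ℕ) [k.AtLeastTwo] :
    (OfNat.ofNat k : JP) ∈ jS m := natCast_mem (jS m) k

/-- The derivative of an order `m` differential polynomial is affine in the top coordinate. -/
lemma jD_affine {m : ℕ} {r : JP} (hr : r ∈ jS m) :
    ∃ A ∈ jS m, ∃ B ∈ jS m, jD r = A * jX (.u (m + 1)) + B := by
  refine jS_induction (P := fun r => ∃ A ∈ jS m, ∃ B ∈ jS m, jD r = A * jX (.u (m + 1)) + B)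
    ?_ ?_ ?_ ?_ hr
  · intro v hv
    match v, hv with
    | .x, _ => exact ⟨0, zero_mem _, 1, one_mem _, by simp⟩
    | .sg i, _ => exact ⟨0, zero_mem _, _, sg_mem_jS m (i + 1), by simp⟩
    | .p, hv =>
      have h1 : 1 ≤ m := hv
      have h2 : (-2 * jX (.u 1) * jX .p ^ 2 : JP) ∈ jS m :=
        mul_mem (mul_mem (neg_mem (ofNat_mem_jS m 2)) (u_mem_jS h1)) (pow_mem (p_mem_jS h1) 2)
      rcases h1.eq_or_lt with rfl | h1
      · exact ⟨_, h2, 0, zero_mem _, by rw [jD_p]; ring⟩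
      · exact ⟨0, zero_mem _, _, mul_mem h2 (u_mem_jS h1), by rw [jD_p]; ring⟩
    | .q, _ =>
      have h2 : (-2 * jX (.u 0) * jX .q ^ 2 : JP) ∈ jS m :=
        mul_mem (mul_mem (neg_mem (ofNat_mem_jS m 2)) (u_mem_jS (Nat.zero_le _)))
          (pow_mem (q_mem_jS m) 2)
      have h3 : (-2 * jX .x * jX .q ^ 2 : JP) ∈ jS m :=
        mul_mem (mul_mem (neg_mem (ofNat_mem_jS m 2)) (x_mem_jS m)) (pow_mem (q_mem_jS m) 2)
      rcases m.eq_zero_or_pos with rfl | h1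
      · exact ⟨_, h2, _, h3, by rw [jD_q]; ring⟩
      · exact ⟨0, zero_mem _, _, add_mem (mul_mem h2 (u_mem_jS h1)) h3, by rw [jD_q]; ring⟩
    | .u i, hv =>
      have hi : i ≤ m := hv
      rcases hi.eq_or_lt with rfl | h1
      · exact ⟨1, one_mem _, 0, zero_mem _, by simp⟩
      · exact ⟨0, zero_mem _, _, u_mem_jS h1, by rw [jD_u]; ring⟩
  · intro c; exact ⟨0, zero_mem _, 0, zero_mem _, by simp⟩
  · rintro r r' - - ⟨A, hA, B, hB, h⟩ ⟨A', hA', B', hB', h'⟩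
    exact ⟨_, add_mem hA hA', _, add_mem hB hB', by rw [map_add, h, h']; ring⟩
  · rintro r r' hr hr' ⟨A, hA, B, hB, h⟩ ⟨A', hA', B', hB', h'⟩
    exact ⟨_, add_mem (mul_mem hr hA') (mul_mem hr' hA), _,
      add_mem (mul_mem hr hB') (mul_mem hr' hB), by rw [jD_mul, h, h']; ring⟩

lemma jD_mem {m : ℕ} {r : JP} (hr : r ∈ jS m) : jD r ∈ jS (m + 1) := by
  obtain ⟨A, hA, B, hB, h⟩ := jD_affine hr
  rw [h]
  exact add_mem (mul_mem (jS_mono (Nat.le_succ m) hA) (u_mem_jS le_rfl)) (jS_mono (Nat.le_succ m) hB)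

/-- The lower order part of the first order coefficient of `jD^[k] (jF ν)`. -/
noncomputable def jB (ν : ℝ) (k : ℕ) : JP :=
  jC ν * jX .x * jX .q - jC (2 * k + 2 : ℝ) * jX (.u 1) * jX (.u 2) * jX .p ^ 2

/-- The part of `jD^[k] (jF ν)` of order at most `k`. -/
noncomputable def jR (ν : ℝ) (k : ℕ) : JP :=
  jD^[k] (jF ν) - jX (.sg 0) * jX .p * jX (.u (k + 2)) -
    (jC (k : ℝ) * jX (.sg 1) * jX .p + jX (.sg 0) * jB ν k) * jX (.u (k + 1))

lemma jDF_eq (ν : ℝ) (k : ℕ) : jD^[k] (jF ν) = jX (.sg 0) * jX .p * jX (.u (k + 2)) +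
    (jC (k : ℝ) * jX (.sg 1) * jX .p + jX (.sg 0) * jB ν k) * jX (.u (k + 1)) + jR ν k := by
  simp only [jR]; ring

lemma jB_mem (ν : ℝ) (k : ℕ) : jB ν k ∈ jS 2 := by
  have h1 : (jX .p : JP) ∈ jS 2 := p_mem_jS (by norm_num)
  exact sub_mem (mul_mem (mul_mem (C_mem_jS _ _) (x_mem_jS _)) (q_mem_jS _))
    (mul_mem (mul_mem (mul_mem (C_mem_jS _ _) (u_mem_jS (by norm_num))) (u_mem_jS le_rfl))
      (pow_mem h1 2))

lemma jB_coeff_mem (ν : ℝ) (k : ℕ) :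
    jC (k : ℝ) * jX (.sg 1) * jX .p + jX (.sg 0) * jB ν k ∈ jS 2 :=
  add_mem (mul_mem (mul_mem (C_mem_jS _ _) (sg_mem_jS _ _)) (p_mem_jS (by norm_num)))
    (mul_mem (sg_mem_jS _ _) (jB_mem ν k))

lemma jDF_one (ν : ℝ) : jD (jF ν) = jX (.sg 0) * jX .p * jX (.u 3) +
    (jX (.sg 1) * jX .p + jX (.sg 0) * jC ν * jX .x * jX .q -
      2 * jX (.sg 0) * jX (.u 1) * jX (.u 2) * jX .p ^ 2) * jX (.u 2) +
    jX (.sg 1) * (jC ν * (jX .x * jX (.u 1) - jX (.u 0)) * jX .q) -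
    2 * jX (.sg 0) * jC ν * (jX .x * jX (.u 1) - jX (.u 0)) *
      (jX .x + jX (.u 0) * jX (.u 1)) * jX .q ^ 2 := by
  simp only [jF, jD_mul, map_add, map_sub, jD_x, jD_sg, jD_u, jD_p, jD_q, jD_C]
  norm_num
  ring

/-- The recursion for the remainders. -/
lemma jR_succ (ν : ℝ) (k : ℕ) : jR ν (k + 1) =
    jD (jC (k : ℝ) * jX (.sg 1) * jX .p + jX (.sg 0) * jB ν k) * jX (.u (k + 1)) + jD (jR ν k) := by
  have e := congrArg jD (jDF_eq ν k)
  rw [← Function.iterate_succ_apply' jD k] at e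
  rw [jR, e, map_add, map_add, jD_mul (_ * _) (jX (.u (k + 2))), jD_mul _ (jX (.u (k + 1))),
    jD_mul (jX (.sg 0)) (jX .p)]
  simp only [jB, jD_sg, jD_u, jD_p, Nat.cast_add, Nat.cast_one, mul_add, map_add, map_mul, map_one, mul_one]
  have : jC 2 = 2 := map_ofNat jC 2
  rw [this]
  ring

lemma jR_one (ν : ℝ) : jR ν 1 = 
    2 * jX (.sg 0) * jX (.u 1) * jX (.u 2) ^ 2 * jX .p ^ 2  +
    jX (.sg 1) * (jC ν * (jX .x * jX (.u 1) - jX (.u 0)) * jX .q) -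
    2 * jX (.sg 0) * jC ν * (jX .x * jX (.u 1) - jX (.u 0)) *
      (jX .x + jX (.u 0) * jX (.u 1)) * jX .q ^ 2 := by
  rw [jR, Function.iterate_one, jDF_one, jB]
  have : (jC (2 * (1:ℕ) + 2 : ℝ) : JP) = 4 := by
      rw [← map_ofNat jC 4]; norm_num
  rw [this]
  simp
  ring

lemma jR_two_mem (ν : ℝ) : jR ν 2 ∈ jS 2 := by
  have hp : (jX .p : JP) ∈ jS 1 := p_mem_jS le_rfl
  have hu0 : (jX (.u 0) : JP) ∈ jS 1 := u_mem_jS (Nat.zero_le _)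
  have hu1 : (jX (.u 1) : JP) ∈ jS 1 := u_mem_jS le_rfl
  have h01 : jS 1 ≤ jS 2 := jS_mono (by norm_num)
  have hu2 : (jX (.u 2) : JP) ∈ jS 2 := u_mem_jS le_rfl
  have hx := x_mem_jS 1
  have hq := q_mem_jS 1
  have hs := sg_mem_jS 1
  have hC := C_mem_jS 1
  have h2 := ofNat_mem_jS 1 2
  have hG : jX (.sg 1) * (jC ν * (jX .x * jX (.u 1) - jX (.u 0)) * jX .q) -
    2 * jX (.sg 0) * jC ν * (jX .x * jX (.u 1) - jX (.u 0)) *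
      (jX .x + jX (.u 0) * jX (.u 1)) * jX .q ^ 2 ∈ jS 1 :=
    sub_mem (mul_mem (hs 1) (mul_mem (mul_mem (hC _) (sub_mem (mul_mem hx hu1) hu0)) hq))
      (mul_mem (mul_mem (mul_mem (mul_mem (mul_mem h2 (hs 0)) (hC _))
        (sub_mem (mul_mem hx hu1) hu0)) (add_mem hx (mul_mem hu0 hu1))) (pow_mem hq 2))
  have e : jR ν 2 = jD (jX (.sg 1)  * jX .p + jX (.sg 0) * (jC ν * jX .x * jX .q)) * jX (.u 2)
      + jD (-2 * jX (.sg 0) * jX (.u 1) * jX .p ^ 2) * jX (.u 2) ^ 2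
      + jD (jX (.sg 1) * (jC ν * (jX .x * jX (.u 1) - jX (.u 0)) * jX .q) -
    2 * jX (.sg 0) * jC ν * (jX .x * jX (.u 1) - jX (.u 0)) *
      (jX .x + jX (.u 0) * jX (.u 1)) * jX .q ^ 2) := by
    have hC4 : (jC (2 * (1:ℕ) + 2 : ℝ) : JP) = 4 := by
      rw [← map_ofNat jC 4]; norm_num
    have h4 : jD (4 : JP) = 0 := by rw [← map_ofNat jC 4, jD_C]
    have h1 : jD (1 : JP) = 0 := by rw [← map_one jC, jD_C]
    have hh2 : jD (2 : JP) = 0 := by rw [← map_ofNat jC 2, jD_C]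
    rw [jR_succ, jR_one, jB, hC4]
    simp only [jD_mul, map_add, map_sub, jD_x, jD_sg, jD_u, jD_p, jD_q, jD_C, h1, h4, hh2, pow_two,
      map_neg, Nat.cast_one, map_one]
    ring
  rw [e]
  refine add_mem (add_mem (mul_mem (jD_mem (add_mem (mul_mem (hs _) hp) (mul_mem (hs _)
    (mul_mem (mul_mem (hC _) hx) hq)))) hu2) (mul_mem (jD_mem ?_) (pow_mem hu2 2))) (jD_mem hG)
  exact mul_mem (mul_mem (mul_mem (neg_mem h2) (hs 0)) hu1) (pow_mem hp 2)

lemma jR_succ_exists (ν : ℝ) (k : ℕ) :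
    ∃ G ∈ jS 3, jR ν (k + 1) = G * jX (.u (k + 1)) + jD (jR ν k) :=
  ⟨_, jD_mem (jB_coeff_mem ν k), jR_succ ν k⟩

lemma jR_mem (ν : ℝ) {k : ℕ} (hk : 2 ≤ k) : jR ν k ∈ jS k := by
  induction k, hk using Nat.le_induction with
  | base => exact jR_two_mem ν
  | succ k hk ih =>
    obtain ⟨G, hG, e⟩ := jR_succ_exists ν k
    rw [e]
    exact add_mem (mul_mem (jS_mono (by omega) hG) (u_mem_jS le_rfl)) (jD_mem ih)

lemma jR_affine (ν : ℝ) {k : ℕ} (hk : 4 ≤ k) :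
    ∃ A ∈ jS 3, ∃ B ∈ jS (k - 1), jR ν k = A * jX (.u k) + B := by
  induction k, hk using Nat.le_induction with
  | base =>
    obtain ⟨A, hA, B, hB, h⟩ := jD_affine (jR_mem ν (k := 3) (by norm_num))
    obtain ⟨G, hG, e⟩ := jR_succ_exists ν 3
    refine ⟨G + A, add_mem hG hA, B, hB, ?_⟩
    rw [e, h, add_mul, add_assoc]
  | succ k hk ih =>
    obtain ⟨A, hA, B, hB, h⟩ := ih
    obtain ⟨G, hG, e⟩ := jR_succ_exists ν k
    refine ⟨G + A, add_mem hG hA, jX (.u k) * jD A + jD B,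
      add_mem (mul_mem (u_mem_jS (by omega)) (jS_mono (by omega) (jD_mem hA)))
        (jS_mono (by omega) (jD_mem hB)), ?_⟩
    rw [e, h, map_add, jD_mul, jD_u, add_mul, add_assoc, add_assoc]

lemma jR_affine_two (ν : ℝ) {k : ℕ} (hk : 6 ≤ k) :
    ∃ A ∈ jS 3, ∃ B ∈ jS (k - 2), ∃ E ∈ jS (k - 2),
      jR ν k = A * jX (.u k) + (B * jX (.u (k - 1)) + E) := by
  induction k, hk using Nat.le_induction with
  | base =>
    obtain ⟨A, hA, B, hB, h⟩ := jR_affine ν (k := 5) (by norm_num)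
    obtain ⟨A', hA', B', hB', h'⟩ := jD_affine hB
    obtain ⟨G, hG, e⟩ := jR_succ_exists ν 5
    refine ⟨G + A, add_mem hG hA, jD A + A', add_mem (jD_mem hA) hA', B', hB', ?_⟩
    rw [e, h, map_add, jD_mul, jD_u, h', add_mul, add_mul, add_assoc, add_assoc, add_assoc,
      mul_comm (jD A)]
  | succ k hk ih =>
    obtain ⟨A, hA, B, hB, E, hE, h⟩ := ih
    obtain ⟨m, rfl⟩ : ∃ m, k = m + 2 := ⟨k - 2, by omega⟩
    have e1 : m + 2 - 1 = m + 1 := by omega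
    have e2 : m + 2 + 1 - 2 = m + 1 := by omega
    have e3 : m + 2 + 1 - 1 = m + 2 := by omega
    have e4 : m + 2 - 2 = m := by omega
    rw [e1] at h
    rw [e4] at hB hE
    rw [e2, e3]
    obtain ⟨G, hG, e⟩ := jR_succ_exists ν (m + 2)
    refine ⟨G + A, add_mem hG hA, jD A + B,
      add_mem (jS_mono (by omega) (jD_mem hA)) (jS_mono (by omega) hB),
      jX (.u (m + 1)) * jD B + jD E,
      add_mem (mul_mem (u_mem_jS (by omega)) (jD_mem hB)) (jD_mem hE), ?_⟩
    rw [e, h, map_add, map_add, jD_mul, jD_mul, jD_u, jD_u]; ring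

lemma jF_mem (ν : ℝ) : jF ν ∈ jS 2 :=
  mul_mem (sg_mem_jS _ _) (add_mem (mul_mem (p_mem_jS (by norm_num)) (u_mem_jS le_rfl))
    (mul_mem (mul_mem (C_mem_jS _ _) (sub_mem (mul_mem (x_mem_jS _) (u_mem_jS (by norm_num)))
      (u_mem_jS (by norm_num)))) (q_mem_jS _)))

lemma jDF_mem (ν : ℝ) (k : ℕ) : jD^[k] (jF ν) ∈ jS (k + 2) := by
  induction k with
  | zero => simpa using jF_mem ν
  | succ k ih =>
    rw [Function.iterate_succ_apply']
    exact jS_mono (by omega) (jD_mem ih)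

end

/-! ### Evaluation of differential polynomials -/

/-- The values of the variables at a point `x` and a jet `z`. -/
noncomputable def jval (s : ℕ → ℝ → ℝ) (x : ℝ) (z : ℕ → ℝ) : JVar → ℝ
  | .x => x
  | .sg i => s i x
  | .p => 1 / (1 + z 1 ^ 2)
  | .q => 1 / (x ^ 2 + z 0 ^ 2)
  | .u i => z i

/-- Evaluation of differential polynomials as a ring homomorphism. -/
noncomputable def jE (v : JVar → ℝ) : JP →+* ℝ :=
  (MvPolynomial.eval v : MvPolynomial JVar ℝ →+* ℝ)

/-- The value of a differential polynomial at a point and a jet. -/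
noncomputable def jev (s : ℕ → ℝ → ℝ) (r : JP) (x : ℝ) (z : ℕ → ℝ) : ℝ := jE (jval s x z) r

section
variable (s : ℕ → ℝ → ℝ) (x : ℝ) (z : ℕ → ℝ)

lemma jev_X (v : JVar) : jev s (jX v) x z = jval s x z v := MvPolynomial.eval_X v
@[simp] lemma jev_x : jev s (jX .x) x z = x := jev_X s x z _
@[simp] lemma jev_sg (i : ℕ) : jev s (jX (.sg i)) x z = s i x := jev_X s x z _
@[simp] lemma jev_p : jev s (jX .p) x z = 1 / (1 + z 1 ^ 2) := jev_X s x z _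
@[simp] lemma jev_q : jev s (jX .q) x z = 1 / (x ^ 2 + z 0 ^ 2) := jev_X s x z _
@[simp] lemma jev_u (i : ℕ) : jev s (jX (.u i)) x z = z i := jev_X s x z _
@[simp] lemma jev_C (c : ℝ) : jev s (jC c) x z = c := MvPolynomial.eval_C c
@[simp] lemma jev_add (r r' : JP) : jev s (r + r') x z = jev s r x z + jev s r' x z :=
  map_add (jE _) r r'
@[simp] lemma jev_sub (r r' : JP) : jev s (r - r') x z = jev s r x z - jev s r' x z :=
  map_sub (jE _) r r'
@[simp] lemma jev_neg (r : JP) : jev s (-r) x z = - jev s r x z := map_neg (jE _) r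
@[simp] lemma jev_mul (r r' : JP) : jev s (r * r') x z = jev s r x z * jev s r' x z :=
  map_mul (jE _) r r'
@[simp] lemma jev_pow (r : JP) (n : ℕ) : jev s (r ^ n) x z = jev s r x z ^ n :=
  map_pow (jE _) r n
@[simp] lemma jev_one : jev s 1 x z = 1 := map_one (jE _)
@[simp] lemma jev_zero : jev s 0 x z = 0 := map_zero (jE _)
@[simp] lemma jev_two : jev s 2 x z = 2 := map_ofNat (jE _) 2

end

lemma jev_congr {s : ℕ → ℝ → ℝ} {m : ℕ} {r : JP} (hr : r ∈ jS m) {x : ℝ} {z z' : ℕ → ℝ}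
    (h : ∀ j ≤ m, z j = z' j) : jev s r x z = jev s r x z' := by
  refine jS_induction (P := fun r => jev s r x z = jev s r x z') ?_ ?_ ?_ ?_ hr
  · intro v hv
    match v, hv with
    | .x, _ => simp
    | .sg i, _ => simp
    | .p, hv => simp [h 1 hv]
    | .q, _ => simp [h 0 (Nat.zero_le _)]
    | .u i, hv => simp [h i hv]
  · intro c; simp
  · intro r r' _ _ hl hr; simp [hl, hr]
  · intro r r' _ _ hl hr; simp [hl, hr]

/-- The coefficients of the flow: `s i` are the derivatives of the nonnegative function `s 0` on
`[1, a]` vanishing at the end points, and `ν = n - 1`. -/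
structure Coef (a ν : ℝ) (s : ℕ → ℝ → ℝ) : Prop where
  one_lt : 1 < a
  two_le : 2 ≤ ν
  deriv : ∀ i, ∀ x ∈ Icc 1 a, HasDerivWithinAt (s i) (s (i + 1) x) (Icc 1 a) x
  nonneg : ∀ x ∈ Icc 1 a, 0 ≤ s 0 x
  left : s 0 1 = 0
  right : s 0 a = 0

namespace Coef
variable {a ν : ℝ} {s : ℕ → ℝ → ℝ} (h : Coef a ν s)
include h

lemma left_mem : (1 : ℝ) ∈ Icc 1 a := ⟨le_rfl, h.one_lt.le⟩
lemma right_mem : a ∈ Icc 1 a := ⟨h.one_lt.le, le_rfl⟩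

lemma cont (i : ℕ) : ContinuousOn (s i) (Icc 1 a) := fun x hx =>
  (h.deriv i x hx).continuousWithinAt

lemma bound (i : ℕ) : ∃ C, 0 ≤ C ∧ ∀ x ∈ Icc 1 a, |s i x| ≤ C := by
  obtain ⟨C, hC⟩ := isCompact_Icc.exists_bound_of_continuousOn (h.cont i)
  exact ⟨C, (norm_nonneg _).trans (hC 1 h.left_mem), hC⟩

lemma bounds (m : ℕ) : ∃ C, 1 ≤ C ∧ ∀ i ≤ m, ∀ x ∈ Icc 1 a, |s i x| ≤ C := by
  choose C hC0 hC using fun i => h.bound i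
  refine ⟨1 + ∑ i ∈ Finset.range (m + 1), C i, ?_, fun i hi x hx => ?_⟩
  · linarith [Finset.sum_nonneg fun i (_ : i ∈ Finset.range (m + 1)) => hC0 i]
  · have := Finset.single_le_sum (f := C) (fun i _ => hC0 i)
      (Finset.mem_range.2 (Nat.lt_succ_of_le hi))
    linarith [hC i x hx]

lemma uniqueDiff {x : ℝ} (hx : x ∈ Icc 1 a) : UniqueDiffWithinAt ℝ (Icc 1 a) x :=
  uniqueDiffOn_Icc h.one_lt x hx

end Coef

lemma jev_hasDerivWithinAt {a ν : ℝ} {s : ℕ → ℝ → ℝ} (hc : Coef a ν s) {m : ℕ} {r : JP}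
    (hr : r ∈ jS m) {z : ℕ → ℝ → ℝ} {x : ℝ} (hx : x ∈ Icc 1 a)
    (hz : ∀ j ≤ m, HasDerivWithinAt (z j) (z (j + 1) x) (Icc 1 a) x) :
    HasDerivWithinAt (fun y => jev s r y fun j => z j y) (jev s (jD r) x fun j => z j x)
      (Icc 1 a) x := by
  refine jS_induction (P := fun r => HasDerivWithinAt (fun y => jev s r y fun j => z j y)
    (jev s (jD r) x fun j => z j x) (Icc 1 a) x) ?_ ?_ ?_ ?_ hr
  · intro v hv
    match v, hv with
    | .x, _ => simp only [jev_x, jD_x, jev_one]; exact hasDerivWithinAt_id x _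
    | .sg i, _ => simpa using hc.deriv i x hx
    | .p, hv =>
      have h0 : (1 + z 1 x ^ 2) ≠ 0 := by positivity
      have := (((hz 1 hv).fun_pow 2).const_add 1).fun_inv h0
      simp only [jev_p, jD_p, jev_mul, jev_neg, jev_two, jev_u, jev_pow, one_div]
      refine this.congr_deriv ?_
      field_simp
      ring
    | .q, _ =>
      have hx0 : 0 < x := zero_lt_one.trans_le hx.1
      have h0 : (x ^ 2 + z 0 x ^ 2) ≠ 0 := by positivity
      have := (((hasDerivWithinAt_id x (Icc 1 a)).fun_pow 2).fun_add
        ((hz 0 (Nat.zero_le _)).fun_pow 2)).fun_inv h0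
      simp only [jev_q, jD_q, jev_mul, jev_neg, jev_two, jev_u, jev_pow, one_div, jev_add, jev_x]
      refine this.congr_deriv ?_
      simp only [id]
      field_simp
      ring
    | .u i, hv => simpa using hz i hv
  · intro c; simpa using hasDerivWithinAt_const x (Icc 1 a) c
  · intro r r' _ _ h h'; simpa using h.fun_add h'
  · intro r r' _ _ h h'
    simp only [jev_mul, jD_mul, jev_add]
    exact (h.fun_mul h').congr_deriv (by ring)

lemma jev_continuousOn {a ν : ℝ} {s : ℕ → ℝ → ℝ} (hc : Coef a ν s) {m : ℕ} {r : JP}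
    (hr : r ∈ jS m) {E : Type*} [TopologicalSpace E] {S : Set E} {ξ : E → ℝ} {Z : ℕ → E → ℝ}
    (hξ : ContinuousOn ξ S) (hξm : MapsTo ξ S (Icc 1 a)) (hZ : ∀ j ≤ m, ContinuousOn (Z j) S) :
    ContinuousOn (fun y => jev s r (ξ y) fun j => Z j y) S := by
  refine jS_induction (P := fun r => ContinuousOn (fun y => jev s r (ξ y) fun j => Z j y) S)
    ?_ ?_ ?_ ?_ hr
  · intro v hv
    match v, hv with
    | .x, _ => simpa using hξ
    | .sg i, _ => simp only [jev_sg]; exact (hc.cont i).comp hξ hξm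
    | .p, hv =>
      simp only [jev_p]
      exact continuousOn_const.div (continuousOn_const.add ((hZ 1 hv).pow 2))
        fun y _ => by positivity
    | .q, _ =>
      simp only [jev_q]
      refine continuousOn_const.div ((hξ.pow 2).add ((hZ 0 (Nat.zero_le _)).pow 2)) fun y hy => ?_
      have : 0 < ξ y := zero_lt_one.trans_le (hξm hy).1
      positivity
    | .u i, hv => simpa using hZ i hv
  · intro c; simpa using continuousOn_const
  · intro r r' _ _ h h'; simpa using h.fun_add h'
  · intro r r' _ _ h h'; simpa using h.fun_mul h'

lemma jev_contDiffOn {a : ℝ} {s : ℕ → ℝ → ℝ} {n : WithTop ℕ∞}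
    (hs : ∀ i, ContDiffOn ℝ n (s i) (Icc 1 a)) {m : ℕ} {r : JP}
    (hr : r ∈ jS m) {E : Type*} [NormedAddCommGroup E] [NormedSpace ℝ E] {S : Set E}
    {ξ : E → ℝ} {Z : ℕ → E → ℝ}
    (hξ : ContDiffOn ℝ n ξ S) (hξm : MapsTo ξ S (Icc 1 a)) (hZ : ∀ j ≤ m, ContDiffOn ℝ n (Z j) S) :
    ContDiffOn ℝ n (fun y => jev s r (ξ y) fun j => Z j y) S := by
  refine jS_induction (P := fun r => ContDiffOn ℝ n (fun y => jev s r (ξ y) fun j => Z j y) S)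
    ?_ ?_ ?_ ?_ hr
  · intro v hv
    match v, hv with
    | .x, _ => simpa using hξ
    | .sg i, _ => simp only [jev_sg]; exact (hs i).comp hξ hξm
    | .p, hv =>
      simp only [jev_p]
      exact contDiffOn_const.div (contDiffOn_const.add ((hZ 1 hv).pow 2))
        fun y _ => by positivity
    | .q, _ =>
      simp only [jev_q]
      refine contDiffOn_const.div ((hξ.pow 2).add ((hZ 0 (Nat.zero_le _)).pow 2)) fun y hy => ?_
      have : 0 < ξ y := zero_lt_one.trans_le (hξm hy).1
      positivity
    | .u i, hv => simpa using hZ i hv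
  · intro c; simpa using contDiffOn_const
  · intro r r' _ _ h h'; simpa using h.add h'
  · intro r r' _ _ h h'; simpa using h.mul h'

lemma abs_one_div_sub_le {A B δ : ℝ} (hA : 1 ≤ A) (hB : 1 ≤ B) (h : |A - B| ≤ δ) :
    |1 / A - 1 / B| ≤ δ := by
  have hA0 : 0 < A := by linarith
  have hB0 : 0 < B := by linarith
  have e : 1 / A - 1 / B = (B - A) / (A * B) := by field_simp
  rw [e, abs_div, abs_of_pos (mul_pos hA0 hB0), abs_sub_comm]
  exact (div_le_self (abs_nonneg _) (by nlinarith)).trans h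

lemma abs_sq_sub_sq_le {x y M δ : ℝ} (hx : |x| ≤ M) (hy : |y| ≤ M) (h : |x - y| ≤ δ) :
    |x ^ 2 - y ^ 2| ≤ 2 * M * δ := by
  have e : x ^ 2 - y ^ 2 = (x + y) * (x - y) := by ring
  rw [e, abs_mul]
  have := abs_add_le x y
  exact mul_le_mul (by linarith) h (abs_nonneg _) (by linarith [abs_nonneg x])

lemma lipschitz_of_deriv_le {a : ℝ} {w w' : ℝ → ℝ} {K : ℝ}
    (hw : ∀ x ∈ Icc 1 a, HasDerivWithinAt w (w' x) (Icc 1 a) x)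
    (hK : ∀ x ∈ Icc 1 a, |w' x| ≤ K) {x y : ℝ} (hx : x ∈ Icc 1 a) (hy : y ∈ Icc 1 a) :
    |w x - w y| ≤ K * |x - y| :=
  (convex_Icc 1 a).norm_image_sub_le_of_norm_hasDerivWithin_le hw hK hy hx

/-- Differential polynomials are bounded and Lipschitz on bounded sets of jets. -/
lemma jev_bound_lipschitz {a ν : ℝ} {s : ℕ → ℝ → ℝ} (hc : Coef a ν s) {m : ℕ} {r : JP}
    (hr : r ∈ jS m) (M : ℝ) : ∃ K, 0 ≤ K ∧ ∀ x ∈ Icc 1 a, ∀ z : ℕ → ℝ, (∀ j ≤ m, |z j| ≤ M) →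
      |jev s r x z| ≤ K ∧ ∀ x' ∈ Icc 1 a, ∀ (z' : ℕ → ℝ) (δ : ℝ), (∀ j ≤ m, |z' j| ≤ M) →
        |x - x'| ≤ δ → (∀ j ≤ m, |z j - z' j| ≤ δ) →
        |jev s r x z - jev s r x' z'| ≤ K * δ := by
  have ha := hc.one_lt
  refine jS_induction (P := fun r => ∃ K, 0 ≤ K ∧ ∀ x ∈ Icc 1 a, ∀ z : ℕ → ℝ,
      (∀ j ≤ m, |z j| ≤ M) →
      |jev s r x z| ≤ K ∧ ∀ x' ∈ Icc 1 a, ∀ (z' : ℕ → ℝ) (δ : ℝ), (∀ j ≤ m, |z' j| ≤ M) →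
        |x - x'| ≤ δ → (∀ j ≤ m, |z j - z' j| ≤ δ) →
        |jev s r x z - jev s r x' z'| ≤ K * δ) ?_ ?_ ?_ ?_ hr
  · intro v hv
    match v, hv with
    | .x, _ =>
      refine ⟨a, by linarith, fun x hx z _ => ⟨?_, fun x' hx' z' δ _ hxδ hδ => ?_⟩⟩
      · rw [jev_x, abs_of_nonneg (by linarith [hx.1])]; exact hx.2
      · rw [jev_x, jev_x]
        nlinarith [abs_nonneg (x - x')]
    | .sg i, _ =>
      obtain ⟨C, hC1, hC⟩ := hc.bounds (i + 1)
      refine ⟨C, by linarith, fun x hx z _ =>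
        ⟨by simpa using hC i (by omega) x hx, fun x' hx' z' δ _ hxδ hδ => ?_⟩⟩
      rw [jev_sg, jev_sg]
      exact (lipschitz_of_deriv_le (hc.deriv i) (hC (i + 1) le_rfl) hx hx').trans
        (mul_le_mul_of_nonneg_left hxδ (by linarith))
    | .p, hv =>
      refine ⟨1 + 2 * |M|, by positivity, fun x hx z hz => ⟨?_, fun x' hx' z' δ hz' hxδ hδ => ?_⟩⟩
      · have : (1 : ℝ) ≤ 1 + z 1 ^ 2 := by nlinarith
        rw [jev_p, abs_of_pos (by positivity)]
        exact ((div_le_one (by positivity)).2 this).trans (by linarith [abs_nonneg M])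
      · rw [jev_p, jev_p]
        have h0 := (abs_nonneg _).trans (hδ 1 hv)
        refine (abs_one_div_sub_le (by nlinarith) (by nlinarith) (δ := 2 * |M| * δ) ?_).trans
          (by linarith)
        rw [add_sub_add_left_eq_sub]
        exact abs_sq_sub_sq_le ((hz 1 hv).trans (le_abs_self _)) ((hz' 1 hv).trans (le_abs_self _))
          (hδ 1 hv)
    | .q, _ =>
      refine ⟨1 + 2 * a + 2 * |M|, by positivity,
        fun x hx z hz => ⟨?_, fun x' hx' z' δ hz' hxδ hδ => ?_⟩⟩
      · have : (1 : ℝ) ≤ x ^ 2 + z 0 ^ 2 := by nlinarith [hx.1]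
        rw [jev_q, abs_of_pos (by positivity)]
        exact ((div_le_one (by positivity)).2 this).trans (by linarith [abs_nonneg M])
      · rw [jev_q, jev_q]
        have hv : 0 ≤ m := Nat.zero_le _
        have h0 := (abs_nonneg _).trans (hδ 0 hv)
        refine (abs_one_div_sub_le (by nlinarith [hx.1]) (by nlinarith [hx'.1])
          (δ := 2 * a * δ + 2 * |M| * δ) ?_).trans (by linarith)
        rw [add_sub_add_comm]
        exact (abs_add_le _ _).trans (add_le_add
          (abs_sq_sub_sq_le (by rw [abs_of_nonneg (by linarith [hx.1])]; exact hx.2)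
            (by rw [abs_of_nonneg (by linarith [hx'.1])]; exact hx'.2) hxδ)
          (abs_sq_sub_sq_le ((hz 0 hv).trans (le_abs_self _))
          ((hz' 0 hv).trans (le_abs_self _)) (hδ 0 hv)))
    | .u i, hv =>
      refine ⟨1 + |M|, by positivity, fun x hx z hz => ⟨?_, fun x' hx' z' δ hz' hxδ hδ => ?_⟩⟩
      · simpa using (hz i hv).trans (by linarith [le_abs_self M])
      · have h0 := (abs_nonneg _).trans (hδ i hv)
        rw [jev_u, jev_u]
        nlinarith [hδ i hv, abs_nonneg M]
  · intro c
    refine ⟨|c|, abs_nonneg c, fun x hx z _ => ⟨by simp, fun x' hx' z' δ _ _ hδ => ?_⟩⟩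
    have := (abs_nonneg _).trans (hδ 0 (Nat.zero_le _))
    simpa using mul_nonneg (abs_nonneg c) this
  · rintro r r' - - ⟨K, hK0, hK⟩ ⟨K', hK0', hK'⟩
    refine ⟨K + K', add_nonneg hK0 hK0', fun x hx z hz =>
      ⟨?_, fun x' hx' z' δ hz' hxδ hδ => ?_⟩⟩
    · rw [jev_add]
      exact (abs_add_le _ _).trans (add_le_add (hK x hx z hz).1 (hK' x hx z hz).1)
    · rw [jev_add, jev_add, add_sub_add_comm, add_mul]
      exact (abs_add_le _ _).trans (add_le_add ((hK x hx z hz).2 x' hx' z' δ hz' hxδ hδ)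
        ((hK' x hx z hz).2 x' hx' z' δ hz' hxδ hδ))
  · rintro r r' - - ⟨K, hK0, hK⟩ ⟨K', hK0', hK'⟩
    have hKK := mul_nonneg hK0 hK0'
    refine ⟨2 * (K * K'), by positivity, fun x hx z hz =>
      ⟨?_, fun x' hx' z' δ hz' hxδ hδ => ?_⟩⟩
    · rw [jev_mul, abs_mul]
      refine (mul_le_mul (hK x hx z hz).1 (hK' x hx z hz).1 (abs_nonneg _) hK0).trans (by linarith)
    · rw [jev_mul, jev_mul]
      have e : ∀ a b c d : ℝ, a * b - c * d = a * (b - d) + (a - c) * d := by intros; ring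
      rw [e]
      refine (abs_add_le _ _).trans ?_
      rw [abs_mul, abs_mul]
      have h1 := (hK x hx z hz)
      have h2 := (hK' x hx z hz)
      have h4 := (hK' x' hx' z' hz').1
      have h0 := (abs_nonneg _).trans (hδ 0 (Nat.zero_le _))
      have m1 := mul_le_mul h1.1 (h2.2 x' hx' z' δ hz' hxδ hδ) (abs_nonneg _) hK0
      have m2 := mul_le_mul (h1.2 x' hx' z' δ hz' hxδ hδ) h4 (abs_nonneg _) (by positivity)
      linarith

lemma jev_bound {a ν : ℝ} {s : ℕ → ℝ → ℝ} (hc : Coef a ν s) {m : ℕ} {r : JP}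
    (hr : r ∈ jS m) (M : ℝ) : ∃ K, 0 ≤ K ∧ ∀ x ∈ Icc 1 a, ∀ z : ℕ → ℝ, (∀ j ≤ m, |z j| ≤ M) →
      |jev s r x z| ≤ K := by
  obtain ⟨K, h0, hK⟩ := jev_bound_lipschitz hc hr M
  exact ⟨K, h0, fun x hx z hz => (hK x hx z hz).1⟩

lemma jev_lipschitz {a ν : ℝ} {s : ℕ → ℝ → ℝ} (hc : Coef a ν s) {m : ℕ} {r : JP}
    (hr : r ∈ jS m) (M : ℝ) : ∃ K, 0 ≤ K ∧ ∀ x ∈ Icc 1 a, ∀ z z' : ℕ → ℝ,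
      (∀ j ≤ m, |z j| ≤ M) → (∀ j ≤ m, |z' j| ≤ M) → ∀ δ, (∀ j ≤ m, |z j - z' j| ≤ δ) →
      |jev s r x z - jev s r x z'| ≤ K * δ := by
  obtain ⟨K, h0, hK⟩ := jev_bound_lipschitz hc hr M
  exact ⟨K, h0, fun x hx z z' hz hz' δ hδ => (hK x hx z hz).2 x hx z' δ hz'
    (by simpa using (abs_nonneg _).trans (hδ 0 (Nat.zero_le _))) hδ⟩

/-! ### Maximum principles -/

lemma deriv_mul_sub_nonpos_of_max {W : ℝ → ℝ} {c d x₀ W' : ℝ} (hx₀ : x₀ ∈ Icc c d)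
    (hmax : ∀ x ∈ Icc c d, W x ≤ W x₀) (h : HasDerivWithinAt W W' (Icc c d) x₀) {y : ℝ}
    (hy : y ∈ Icc c d) : W' * (y - x₀) ≤ 0 := by
  have hm : IsLocalMaxOn W (Icc c d) x₀ := IsMaxOn.localize hmax
  have hseg : segment ℝ x₀ y ⊆ Icc c d := (convex_Icc c d).segment_subset hx₀ hy
  have := hm.hasFDerivWithinAt_nonpos h.hasFDerivWithinAt (sub_mem_posTangentConeAt_of_segment_subset hseg)
  simpa [mul_comm] using this

lemma second_deriv_nonpos_of_max {W W₁ : ℝ → ℝ} {c d x₀ W₂ : ℝ} (hx₀ : x₀ ∈ Icc c d)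
    (hd : x₀ < d) (hmax : ∀ x ∈ Icc c d, W x ≤ W x₀)
    (h1 : ∀ x ∈ Icc c d, HasDerivWithinAt W (W₁ x) (Icc c d) x)
    (h2 : HasDerivWithinAt W₁ W₂ (Icc c d) x₀) (h0 : W₁ x₀ = 0) : W₂ ≤ 0 := by
  by_contra! hpos
  have h3 : HasDerivWithinAt W₁ W₂ (Ioi x₀) x₀ :=
    (h2.mono (Icc_subset_Icc_left hx₀.1)).mono_of_mem_nhdsWithin
      (Filter.mem_of_superset (Ioo_mem_nhdsGT hd) Ioo_subset_Icc_self)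
  rw [hasDerivWithinAt_iff_tendsto_slope' (by simp)] at h3
  have h4 := (h3.eventually_const_lt hpos)
  obtain ⟨e, he, hsub⟩ := (mem_nhdsGT_iff_exists_Ioo_subset.1 h4)
  have he : x₀ < e := he
  set b := min ((x₀ + e) / 2) d with hb
  have hb1 : x₀ < b := lt_min (by linarith) hd
  have hb2 : b < e := (min_le_left _ _).trans_lt (by linarith)
  have hbd : b ≤ d := min_le_right _ _
  have hss : Icc x₀ b ⊆ Icc c d := Icc_subset_Icc hx₀.1 hbd
  have hmono : StrictMonoOn W (Icc x₀ b) := by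
    refine strictMonoOn_of_hasDerivWithinAt_pos (f' := W₁) (convex_Icc _ _)
      (fun x hx => (h1 x (hss hx)).continuousWithinAt.mono hss) ?_ ?_
    · intro x hx
      exact (h1 x (hss (interior_subset hx))).mono (interior_subset.trans hss)
    · intro x hx
      rw [interior_Icc] at hx
      have : 0 < slope W₁ x₀ x := hsub ⟨hx.1, hx.2.trans hb2⟩
      rw [slope_def_field, h0, sub_zero] at this
      exact (div_pos_iff_of_pos_right (by linarith [hx.1])).1 this
  exact absurd (hmono ⟨le_rfl, hb1.le⟩ ⟨hb1.le, le_rfl⟩ hb1) (hmax b (hss ⟨hb1.le, le_rfl⟩)).not_gt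

/-- A degenerate elliptic operator `A ∂² + B ∂` is nonpositive at a spatial maximum, provided that
at the end points `A` vanishes and `B` points inwards. -/
lemma elliptic_nonpos_of_max {W W₁ : ℝ → ℝ} {c d x₀ W₂ A B : ℝ} (hcd : c < d) (hx₀ : x₀ ∈ Icc c d)
    (hmax : ∀ x ∈ Icc c d, W x ≤ W x₀)
    (h1 : ∀ x ∈ Icc c d, HasDerivWithinAt W (W₁ x) (Icc c d) x)
    (h2 : HasDerivWithinAt W₁ W₂ (Icc c d) x₀) (hA : 0 ≤ A)
    (hc : x₀ = c → A = 0 ∧ 0 ≤ B) (hd : x₀ = d → A = 0 ∧ B ≤ 0) : A * W₂ + B * W₁ x₀ ≤ 0 := by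
  have hs := fun y hy => deriv_mul_sub_nonpos_of_max (y := y) hx₀ hmax (h1 x₀ hx₀) hy
  have hsc := hs c ⟨le_rfl, hcd.le⟩
  have hsd := hs d ⟨hcd.le, le_rfl⟩
  rcases hx₀.1.eq_or_lt with e | hlt
  · obtain ⟨rfl, hB⟩ := hc e.symm
    subst e
    have : W₁ c ≤ 0 := by nlinarith
    nlinarith
  rcases hx₀.2.eq_or_lt with e | hlt'
  · obtain ⟨rfl, hB⟩ := hd e
    subst e
    have : 0 ≤ W₁ x₀ := by nlinarith
    nlinarith
  · have h0 : W₁ x₀ = 0 := le_antisymm (by nlinarith) (by nlinarith)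
    have := second_deriv_nonpos_of_max hx₀ hlt' hmax h1 h2 h0
    rw [h0]; nlinarith

/-- The weak maximum principle for functions with a differential inequality at spatial maxima. -/
lemma max_principle {E : Type*} [TopologicalSpace E] {K : Set E} (hK : IsCompact K) {T C : ℝ}
    {φ : ℝ → E → ℝ} (hφ : ContinuousOn (fun y : ℝ × E => φ y.1 y.2) (Icc 0 T ×ˢ K))
    (h0 : ∀ x ∈ K, φ 0 x ≤ 0)
    (h : ∀ t ∈ Icc 0 T, 0 < t → ∀ x ∈ K, 0 < φ t x → (∀ y ∈ K, φ t y ≤ φ t x) →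
      ∃ d, HasDerivWithinAt (fun t => φ t x) d (Icc 0 T) t ∧ d ≤ C * φ t x) :
    ∀ t ∈ Icc 0 T, ∀ x ∈ K, φ t x ≤ 0 := by
  intro t ht x hx
  by_contra! hpos
  have hcont : ContinuousOn (fun y : ℝ × E => exp (-(C + 1) * y.1) * φ y.1 y.2) (Icc 0 T ×ˢ K) :=
    (by fun_prop : Continuous fun y : ℝ × E => exp (-(C + 1) * y.1)).continuousOn.mul hφ
  obtain ⟨⟨t₀, x₀⟩, ⟨ht₀, hx₀⟩, hm⟩ := (isCompact_Icc.prod hK).exists_isMaxOn ⟨(t, x), ht, hx⟩ hcont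
  have hm : ∀ t ∈ Icc 0 T, ∀ x ∈ K,
    exp (-(C + 1) * t) * φ t x ≤ exp (-(C + 1) * t₀) * φ t₀ x₀ := fun t ht x hx => hm (mk_mem_prod ht hx)
  simp only at ht₀ hx₀
  have hp : 0 < φ t₀ x₀ := by
    have := (mul_pos (exp_pos (-(C + 1) * t)) hpos).trans_le (hm t ht x hx)
    exact (mul_pos_iff_of_pos_left (exp_pos _)).1 this
  have ht0 : 0 < t₀ := ht₀.1.lt_of_ne fun e => by
    subst e; exact absurd (h0 x₀ hx₀) hp.not_ge
  obtain ⟨d, hd, hle⟩ := h t₀ ht₀ ht0 x₀ hx₀ hp fun y hy => by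
    exact (mul_le_mul_iff_right₀ (exp_pos _)).1 (hm t₀ ht₀ y hy)
  have hexp : HasDerivWithinAt (fun t => exp (-(C + 1) * t))
      (exp (-(C + 1) * t₀) * (-(C + 1))) (Icc 0 T) t₀ := by
    simpa using (((hasDerivAt_id t₀).const_mul (-(C + 1))).exp).hasDerivWithinAt
  have := deriv_mul_sub_nonpos_of_max ht₀ (fun s hs => hm s hs x₀ hx₀) (hexp.mul hd)
    (y := 0) ⟨le_rfl, ht₀.1.trans ht₀.2⟩
  have hE := exp_pos (-(C + 1) * t₀)
  have h1 : exp (-(C + 1) * t₀) * (-(C + 1)) * φ t₀ x₀ + exp (-(C + 1) * t₀) * d < 0 := by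
    have : exp (-(C + 1) * t₀) * (d - (C + 1) * φ t₀ x₀) < 0 :=
      mul_neg_of_pos_of_neg hE (by linarith)
    linarith
  nlinarith

/-- The maximum principle for a two-point function comparing the oscillation of `w` with a
modulus of continuity `g`. -/
lemma modulus_principle {a T C L Λ : ℝ} {w w₁ w₂ A B R : ℝ → ℝ → ℝ}
    {g g₁ g₂ : ℝ → ℝ}
    (hw : ContinuousOn (fun y : ℝ × ℝ => w y.1 y.2) (Icc 0 T ×ˢ Icc 1 a))
    (hw1 : ∀ t ∈ Icc 0 T, ∀ x ∈ Icc 1 a, HasDerivWithinAt (w t) (w₁ t x) (Icc 1 a) x)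
    (hw2 : ∀ t ∈ Icc 0 T, ∀ x ∈ Icc 1 a, HasDerivWithinAt (w₁ t) (w₂ t x) (Icc 1 a) x)
    (hwt : ∀ t ∈ Icc 0 T, ∀ x ∈ Icc 1 a, HasDerivWithinAt (fun t => w t x)
      (A t x * w₂ t x + B t x * w₁ t x + R t x) (Icc 0 T) t)
    (hA : ∀ t ∈ Icc 0 T, ∀ x ∈ Icc 1 a, 0 ≤ A t x)
    (hAl : ∀ t ∈ Icc 0 T, A t 1 = 0 ∧ 0 ≤ B t 1) (hAr : ∀ t ∈ Icc 0 T, A t a = 0 ∧ B t a ≤ 0)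
    (hg : ContinuousOn g (Icc 0 (a - 1))) (hg0 : g 0 = 0)
    (hg1 : ∀ d ∈ Ioc 0 (a - 1), HasDerivAt g (g₁ d) d)
    (hg2 : ∀ d ∈ Ioc 0 (a - 1), HasDerivAt g₁ (g₂ d) d)
    (hΛ : 0 ≤ Λ)
    (hinit : ∀ x ∈ Icc 1 a, ∀ y ∈ Icc 1 a, y ≤ x → w 0 x - w 0 y ≤ Λ * g (x - y))
    (hineq : ∀ t ∈ Icc 0 T, ∀ x ∈ Icc 1 a, ∀ y ∈ Icc 1 a, y < x →
      0 < w t x - w t y - Λ * exp (L * t) * g (x - y) →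
      Λ * exp (L * t) * ((A t x + A t y) * g₂ (x - y) + (B t x - B t y) * g₁ (x - y)) +
      (R t x - R t y) ≤ Λ * exp (L * t) * (L * g (x - y)) +
        C * (w t x - w t y - Λ * exp (L * t) * g (x - y))) :
    ∀ t ∈ Icc 0 T, ∀ x ∈ Icc 1 a, ∀ y ∈ Icc 1 a, y ≤ x →
      w t x - w t y ≤ Λ * exp (L * t) * g (x - y) := by
  set K : Set (ℝ × ℝ) := (Icc 1 a ×ˢ Icc 1 a) ∩ {z | z.2 ≤ z.1} with hKdef
  have hK : IsCompact K := (isCompact_Icc.prod isCompact_Icc).inter_right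
    (isClosed_le continuous_snd continuous_fst)
  have hdm : ∀ z ∈ K, z.1 - z.2 ∈ Icc 0 (a - 1) := fun z hz =>
    ⟨sub_nonneg.2 hz.2, by linarith [hz.1.1.2, hz.1.2.1]⟩
  have key := max_principle (T := T) (C := C) hK
    (φ := fun t z => w t z.1 - w t z.2 - Λ * exp (L * t) * g (z.1 - z.2)) ?_ ?_ ?_
  · intro t ht x hx y hy hyx
    have := key t ht (x, y) ⟨⟨hx, hy⟩, hyx⟩
    simp only at this
    linarith
  · refine ((hw.comp (f := fun y : ℝ × ℝ × ℝ => (y.1, y.2.1)) (by fun_prop) ?_).sub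
      (hw.comp (f := fun y : ℝ × ℝ × ℝ => (y.1, y.2.2)) (by fun_prop) ?_)).sub
      (((by fun_prop : Continuous fun y : ℝ × ℝ × ℝ => Λ * exp (L * y.1)).continuousOn).mul
        (hg.comp (f := fun y : ℝ × ℝ × ℝ => y.2.1 - y.2.2) (by fun_prop) ?_))
    · rintro ⟨t, x, y⟩ ⟨ht, hz⟩; exact ⟨ht, hz.1.1⟩
    · rintro ⟨t, x, y⟩ ⟨ht, hz⟩; exact ⟨ht, hz.1.2⟩
    · rintro ⟨t, x, y⟩ ⟨ht, hz⟩; exact hdm _ hz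
  · rintro ⟨x, y⟩ ⟨⟨hx, hy⟩, hyx⟩
    have := hinit x hx y hy hyx
    simpa using this
  · rintro t ht - ⟨x, y⟩ ⟨⟨hx, hy⟩, hyx⟩ hpos hmax
    simp only at hx hy hyx hpos
    have hyx : y < x := lt_of_le_of_ne hyx fun e => by
      subst e; simp [hg0] at hpos
    set G := Λ * exp (L * t) with hG
    have hG0 : 0 ≤ G := mul_nonneg hΛ (exp_pos _).le
    have hmx : ∀ x' ∈ Icc 1 a, ∀ y' ∈ Icc 1 a, y' ≤ x' →
      w t x' - w t y' - G * g (x' - y') ≤ w t x - w t y - G * g (x - y) :=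
      fun x' hx' y' hy' hle => hmax (x', y') ⟨⟨hx', hy'⟩, hle⟩
    have hGd : ∀ d ∈ Ioc 0 (a - 1), HasDerivAt (fun d => G * g d) (G * g₁ d) d :=
      fun d hd => (hg1 d hd).const_mul G
    set m := (x + y) / 2 with hm
    have hI1 : Icc m a ⊆ Icc 1 a := Icc_subset_Icc_left (by linarith [hx.1, hy.1])
    have hI2 : Icc 1 m ⊆ Icc 1 a := Icc_subset_Icc_right (by linarith [hx.2, hy.2])
    have ex := elliptic_nonpos_of_max (c := m) (d := a) (x₀ := x) (A := A t x) (B := B t x)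
      (W := fun x' => w t x' - w t y - G * g (x' - y)) (W₁ := fun x' => w₁ t x' - G * g₁ (x' - y))
      (W₂ := w₂ t x - G * g₂ (x - y)) (by linarith [hx.2]) ⟨by linarith, hx.2⟩
      (fun x' hx' => hmx x' (hI1 hx') y hy (by linarith [hx'.1])) ?_ ?_ (hA t ht x hx)
      (fun e => absurd e (by intro e; linarith)) (fun e => by rw [e]; exact hAr t ht)
    · have ey := elliptic_nonpos_of_max (c := 1) (d := m) (x₀ := y) (A := A t y) (B := B t y)
        (W := fun y' => w t x - w t y' - G * g (x - y'))
        (W₁ := fun y' => - w₁ t y' + G * g₁ (x - y'))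
        (W₂ := - w₂ t y - G * g₂ (x - y)) (by linarith [hy.1]) ⟨hy.1, by linarith⟩
        (fun y' hy' => hmx x hx y' (hI2 hy') (by linarith [hy'.2])) ?_ ?_ (hA t ht y hy)
        (fun e => by rw [e]; exact hAl t ht) (fun e => absurd e (by intro e; linarith))
      · have hexp : HasDerivWithinAt (fun t => Λ * exp (L * t) * g (x - y))
            (G * (L * g (x - y))) (Icc 0 T) t := by
          have := ((((hasDerivAt_id t).const_mul L).exp).const_mul Λ).mul_const (g (x - y))
          refine this.hasDerivWithinAt.congr_deriv ?_
          simp only [id, hG]; ring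
        refine ⟨_, ((hwt t ht x hx).sub (hwt t ht y hy)).sub hexp, ?_⟩
        have := hineq t ht x hx y hy hyx hpos
        simp only at ex ey ⊢
        nlinarith
      · intro y' hy'
        have hd : x - y' ∈ Ioc 0 (a - 1) := ⟨by linarith [hy'.2], by linarith [hx.2, hy'.1]⟩
        have := ((((hw1 t ht y' (hI2 hy')).mono hI2).const_sub (w t x)).sub
          ((hGd _ hd).comp_hasDerivWithinAt y' ((hasDerivWithinAt_id y' (Icc 1 m)).const_sub x)))
        exact this.congr_deriv (by ring)
      · have hd : x - y ∈ Ioc 0 (a - 1) := ⟨by linarith, by linarith [hx.2, hy.1]⟩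
        have := ((((hw2 t ht y hy).mono hI2).neg).add
          (((hg2 _ hd).const_mul G).comp_hasDerivWithinAt y
            ((hasDerivWithinAt_id y (Icc 1 m)).const_sub x)))
        exact this.congr_deriv (by ring)
    · intro x' hx'
      have hd : x' - y ∈ Ioc 0 (a - 1) := ⟨by linarith [hx'.1], by linarith [hy.1, hx'.2]⟩
      have := ((((hw1 t ht x' (hI1 hx')).mono hI1).sub_const (w t y)).sub
        ((hGd _ hd).comp_hasDerivWithinAt x' ((hasDerivWithinAt_id x' (Icc m a)).sub_const y)))
      exact this.congr_deriv (by ring)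
    · have hd : x - y ∈ Ioc 0 (a - 1) := ⟨by linarith, by linarith [hx.2, hy.1]⟩
      have := (((hw2 t ht x hx).mono hI1).sub
        (((hg2 _ hd).const_mul G).comp_hasDerivWithinAt x
          ((hasDerivWithinAt_id x (Icc m a)).sub_const y)))
      exact this.congr_deriv (by ring)

namespace Coef
variable {a ν : ℝ} {s : ℕ → ℝ → ℝ} (h : Coef a ν s)
include h

lemma deriv_left : 0 ≤ s 1 1 := by
  have := deriv_mul_sub_nonpos_of_max (W := fun x => - s 0 x) h.left_mem
    (fun x hx => by simpa [h.left] using h.nonneg x hx) (h.deriv 0 1 h.left_mem).neg h.right_mem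
  nlinarith [h.one_lt]

lemma deriv_right : s 1 a ≤ 0 := by
  have := deriv_mul_sub_nonpos_of_max (W := fun x => - s 0 x) h.right_mem
    (fun x hx => by simpa [h.right] using h.nonneg x hx) (h.deriv 0 a h.right_mem).neg h.left_mem
  nlinarith [h.one_lt]

end Coef

/-! ### A priori estimates -/

/-- `U j` is the `j`-th spatial derivative of a solution of the flow on `[0, T] × [1, a]`, for
`j < k`, with initial jet `f`. -/
structure JetSol (s : ℕ → ℝ → ℝ) (ν a : ℝ) (k : ℕ) (T : ℝ) (f : ℕ → ℝ → ℝ)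
    (U : ℕ → ℝ → ℝ → ℝ) : Prop where
  cont : ∀ j < k, ContinuousOn (fun y : ℝ × ℝ => U j y.1 y.2) (Icc 0 T ×ˢ Icc 1 a)
  dx : ∀ j, j + 1 < k → ∀ t ∈ Icc 0 T, ∀ x ∈ Icc 1 a,
    HasDerivWithinAt (U j t) (U (j + 1) t x) (Icc 1 a) x
  dt : ∀ j, j + 2 < k → ∀ t ∈ Icc 0 T, ∀ x ∈ Icc 1 a,
    HasDerivWithinAt (fun t => U j t x) (jev s (jD^[j] (jF ν)) x fun i => U i t x) (Icc 0 T) t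
  init : ∀ j < k, ∀ x ∈ Icc 1 a, U j 0 x = f j x

/-- The derivative of the Lagrangian angle as a differential polynomial. -/
noncomputable def jH (ν : ℝ) : JP :=
  jX .p * jX (.u 2) + jC ν * (jX .x * jX (.u 1) - jX (.u 0)) * jX .q

lemma jF_eq (ν : ℝ) : jF ν = jX (.sg 0) * jH ν := rfl

lemma jH_mem (ν : ℝ) : jH ν ∈ jS 2 :=
  add_mem (mul_mem (p_mem_jS (by norm_num)) (u_mem_jS le_rfl))
    (mul_mem (mul_mem (C_mem_jS _ _) (sub_mem (mul_mem (x_mem_jS _) (u_mem_jS (by norm_num)))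
      (u_mem_jS (by norm_num)))) (q_mem_jS _))

/-- The Lagrangian angle. -/
noncomputable def angle (ν x : ℝ) (z : ℕ → ℝ) : ℝ := ν * arctan (z 0 / x) + arctan (z 1)

section
variable {a ν T : ℝ} {s f : ℕ → ℝ → ℝ} {k : ℕ} {U : ℕ → ℝ → ℝ → ℝ}

lemma JetSol.angle_cont (hU : JetSol s ν a k T f U) (hk : 2 ≤ k) :
    ContinuousOn (fun y : ℝ × ℝ => angle ν y.2 fun i => U i y.1 y.2) (Icc 0 T ×ˢ Icc 1 a) := by
  have h0 := hU.cont 0 (by omega)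
  have h1 := hU.cont 1 (by omega)
  have h2 : ContinuousOn (fun y : ℝ × ℝ => U 0 y.1 y.2 / y.2) (Icc 0 T ×ˢ Icc 1 a) :=
    h0.div continuous_snd.continuousOn fun y hy => by linarith [hy.2.1]
  exact (continuousOn_const.mul (continuous_arctan.comp_continuousOn h2)).add
    (continuous_arctan.comp_continuousOn h1)

lemma JetSol.angle_dx (hU : JetSol s ν a k T f U) (hk : 3 ≤ k) {t x : ℝ} (ht : t ∈ Icc 0 T)
    (hx : x ∈ Icc 1 a) : HasDerivWithinAt (fun y => angle ν y fun i => U i t y)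
      (jev s (jH ν) x fun i => U i t x) (Icc 1 a) x := by
  have h0 := hU.dx 0 (by omega) t ht x hx
  have h1 := hU.dx 1 (by omega) t ht x hx
  have hx0 : x ≠ 0 := by linarith [hx.1]
  refine (((h0.div (hasDerivWithinAt_id x _) hx0).arctan.const_mul ν).add h1.arctan).congr_deriv ?_
  simp only [jH, jev_add, jev_mul, jev_p, jev_u, jev_C, jev_sub, jev_x, jev_q, id]
  have : x ^ 2 + U 0 t x ^ 2 ≠ 0 := by positivity
  have : 1 + U 1 t x ^ 2 ≠ 0 := by positivity
  simp
  field_simp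
  ring

lemma JetSol.angle_dxx (hc : Coef a ν s) (hU : JetSol s ν a k T f U) (hk : 4 ≤ k) {t x : ℝ}
    (ht : t ∈ Icc 0 T) (hx : x ∈ Icc 1 a) :
    HasDerivWithinAt (fun y => jev s (jH ν) y fun i => U i t y)
      (jev s (jD (jH ν)) x fun i => U i t x) (Icc 1 a) x :=
  jev_hasDerivWithinAt hc (jH_mem ν) hx fun j hj => hU.dx j (by omega) t ht x hx

lemma JetSol.angle_dt (hU : JetSol s ν a k T f U) (hk : 4 ≤ k) {t x : ℝ} (ht : t ∈ Icc 0 T)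
    (hx : x ∈ Icc 1 a) : HasDerivWithinAt (fun t => angle ν x fun i => U i t x)
      (jev s (jX .p * jX (.sg 0)) x (fun i => U i t x) * jev s (jD (jH ν)) x (fun i => U i t x) +
        jev s (jX .p * jX (.sg 1) + jC ν * jX .x * jX .q * jX (.sg 0)) x (fun i => U i t x) *
          jev s (jH ν) x (fun i => U i t x)) (Icc 0 T) t := by
  have h0 := hU.dt 0 (by omega) t ht x hx
  have h1 := hU.dt 1 (by omega) t ht x hx
  have hx0 : x ≠ 0 := by linarith [hx.1]
  refine (((h0.div_const x).arctan.const_mul ν).add h1.arctan).congr_deriv ?_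
  simp only [Function.iterate_one, Function.iterate_zero, id, jF_eq, jD_mul, jD_sg]
  simp only [jev_add, jev_mul, jev_p, jev_C, jev_x, jev_q, jev_sg]
  have : x ^ 2 + U 0 t x ^ 2 ≠ 0 := by positivity
  have : 1 + U 1 t x ^ 2 ≠ 0 := by positivity
  generalize jev s (jH ν) x (fun i => U i t x) = H
  generalize jev s (jD (jH ν)) x (fun i => U i t x) = H'
  field_simp
  ring

lemma JetSol.angle_lower (hc : Coef a ν s) (hU : JetSol s ν a k T f U) (hk : 4 ≤ k) {c : ℝ}
    (hf : ∀ x ∈ Icc 1 a, c ≤ angle ν x fun i => f i x) {t x : ℝ} (ht : t ∈ Icc 0 T)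
    (hx : x ∈ Icc 1 a) : c ≤ angle ν x fun i => U i t x := by
  have key := max_principle (T := T) (C := 0) (isCompact_Icc (a := (1 : ℝ)) (b := a))
    (φ := fun t x => c - angle ν x fun i => U i t x)
    (continuousOn_const.sub (hU.angle_cont (by omega))) ?_ ?_ t ht x hx
  · linarith
  · intro x hx
    have := hf x hx
    have h0 := hU.init 0 (by omega) x hx
    have h1 := hU.init 1 (by omega) x hx
    simp only [angle] at this ⊢
    rw [h0, h1]; linarith
  · intro t ht _ x hx _ hmax
    refine ⟨_, (hU.angle_dt hk ht hx).const_sub c, ?_⟩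
    have hp : (0 : ℝ) < 1 / (1 + U 1 t x ^ 2) := by positivity
    have := elliptic_nonpos_of_max hc.one_lt hx hmax
      (fun y hy => (hU.angle_dx (by omega) ht hy).const_sub c)
      ((hU.angle_dxx hc hk ht hx).fun_neg) (A := jev s (jX .p * jX (.sg 0)) x (fun i => U i t x))
      (B := jev s (jX .p * jX (.sg 1) + jC ν * jX .x * jX .q * jX (.sg 0)) x (fun i => U i t x))
      ?_ ?_ ?_
    · linarith
    · simp only [jev_mul, jev_p, jev_sg]
      exact mul_nonneg hp.le (hc.nonneg x hx)
    · rintro rfl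
      simp only [jev_add, jev_mul, jev_p, jev_sg, hc.left, mul_zero, add_zero, true_and]
      exact mul_nonneg hp.le hc.deriv_left
    · rintro rfl
      simp only [jev_add, jev_mul, jev_p, jev_sg, hc.right, mul_zero, add_zero, true_and]
      exact mul_nonpos_of_nonneg_of_nonpos hp.le hc.deriv_right

lemma JetSol.right_const (hc : Coef a ν s) (hU : JetSol s ν a k T f U) (hk : 4 ≤ k) {t : ℝ}
    (ht : t ∈ Icc 0 T) : U 0 t a = f 0 a := by
  have := Convex.norm_image_sub_le_of_norm_hasDerivWithin_le (f := fun t => U 0 t a) (C := 0)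
    (fun t ht => hU.dt 0 (by omega) t ht a hc.right_mem) (fun t _ => by
      simp [jF_eq, hc.right]) (convex_Icc 0 T) ⟨le_rfl, ht.1.trans ht.2⟩ ht
  rw [← hU.init 0 (by omega) a hc.right_mem]
  exact sub_eq_zero.1 (norm_le_zero_iff.1 (by simpa using this))

end

/-- Initial data with supercritical phase. -/
structure Init (a ν : ℝ) (f : ℕ → ℝ → ℝ) : Prop where
  cont : ∀ j, ContinuousOn (f j) (Icc 1 a)
  phase : ∀ x ∈ Icc 1 a, (ν - 1) * (π / 2) < angle ν x fun i => f i x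

lemma Init.bound {a ν : ℝ} {f : ℕ → ℝ → ℝ} (h : Init a ν f) (j : ℕ) :
    ∃ M, 0 ≤ M ∧ ∀ x ∈ Icc 1 a, |f j x| ≤ M := by
  obtain ⟨M, hM⟩ := isCompact_Icc.exists_bound_of_continuousOn (h.cont j)
  exact ⟨max M 0, le_max_right _ _, fun x hx => (hM x hx).trans (le_max_left _ _)⟩

lemma apriori_lower {a ν : ℝ} {s f : ℕ → ℝ → ℝ} (hc : Coef a ν s) (hf : Init a ν f) {k : ℕ}
    (hk : 4 ≤ k) : ∃ M, 0 ≤ M ∧ ∀ T U, JetSol s ν a k T f U → ∀ t ∈ Icc 0 T, ∀ x ∈ Icc 1 a,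
      0 < U 0 t x ∧ U 0 t x ≤ M ∧ -M ≤ U 1 t x := by
  have hcont : ContinuousOn (fun x => angle ν x fun i => f i x) (Icc 1 a) :=
    (continuousOn_const.mul (continuous_arctan.comp_continuousOn ((hf.cont 0).div
      continuous_id.continuousOn fun y hy => by simp; linarith [hy.1]))).add
    (continuous_arctan.comp_continuousOn (hf.cont 1))
  obtain ⟨x₀, hx₀, hmin⟩ := isCompact_Icc.exists_isMinOn ⟨1, hc.left_mem⟩ hcont
  set c := angle ν x₀ fun i => f i x₀ with hcdef
  have hcpos := hf.phase x₀ hx₀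
  rw [← hcdef] at hcpos
  obtain ⟨M0, hM0, hM⟩ := hf.bound 0
  set V := |tan (c - ν * (π / 2))| with hV
  refine ⟨M0 + V * a, by have := hc.one_lt; positivity, fun T U hU => ?_⟩
  have hν := hc.two_le
  have hpi := pi_pos
  have h1 : ∀ t ∈ Icc 0 T, ∀ x ∈ Icc 1 a, 0 < U 0 t x ∧ -V ≤ U 1 t x := by
    intro t ht x hx
    have hl : c ≤ angle ν x fun i => U i t x := hU.angle_lower hc hk (fun x hx => hmin hx) ht hx
    simp only [angle] at hl
    have b1 := arctan_lt_pi_div_two (U 1 t x)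
    have b2 := arctan_lt_pi_div_two (U 0 t x / x)
    have b3 := neg_pi_div_two_lt_arctan (U 1 t x)
    constructor
    · have h : 0 < arctan (U 0 t x / x) := by
        by_contra! hh
        nlinarith
      exact (div_pos_iff_of_pos_right (by linarith [hx.1])).1 (arctan_pos.1 h)
    · have h : c - ν * (π / 2) < arctan (U 1 t x) := by nlinarith
      have := tan_lt_tan_of_lt_of_lt_pi_div_two (by linarith) b1 h
      rw [tan_arctan] at this
      exact (neg_abs_le _).trans this.le
  intro t ht x hx
  have hVn : 0 ≤ V := abs_nonneg _
  have ha := hc.one_lt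
  refine ⟨(h1 t ht x hx).1, ?_, ?_⟩
  · have hmono : MonotoneOn (fun x => U 0 t x + V * x) (Icc 1 a) := by
      have hd : ∀ x ∈ Icc 1 a, HasDerivWithinAt (fun x => U 0 t x + V * x) (U 1 t x + V) (Icc 1 a) x :=
        fun x hx => by
          simpa using (hU.dx 0 (by omega) t ht x hx).fun_add ((hasDerivWithinAt_id x _).const_mul V)
      refine monotoneOn_of_hasDerivWithinAt_nonneg (convex_Icc _ _)
        (fun x hx => (hd x hx).continuousWithinAt)
        (fun x hx => (hd x (interior_subset hx)).mono interior_subset) fun x hx => ?_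
      linarith [(h1 t ht x (interior_subset hx)).2]
    have := hmono hx hc.right_mem hx.2
    simp only [hU.right_const hc hk ht] at this
    have h2 := (le_abs_self _).trans (hM a hc.right_mem)
    nlinarith [hx.1]
  · have := (h1 t ht x hx).2
    nlinarith

lemma apriori_upper {a ν : ℝ} {s f : ℕ → ℝ → ℝ} (hc : Coef a ν s) (hf : Init a ν f) {k : ℕ}
    (hk : 4 ≤ k) (T₀ : ℝ) : ∃ M, 0 ≤ M ∧ ∀ T ≤ T₀, ∀ U, JetSol s ν a k T f U → ∀ t ∈ Icc 0 T,
      ∀ x ∈ Icc 1 a, U 1 t x ≤ M := by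
  obtain ⟨M0, hM0, hM⟩ := apriori_lower hc hf hk
  obtain ⟨M1, hM1, hfM⟩ := hf.bound 1
  obtain ⟨S, hS0, hS⟩ := hc.bound 1
  have ha := hc.one_lt
  have hν := hc.two_le
  set L := S * ν * a with hL
  have hL0 : 0 ≤ L := by positivity
  set N := M0 + M1 + 1 with hN
  refine ⟨N * exp (L * T₀), by positivity, fun T hT U hU t ht x hx => ?_⟩
  have key := max_principle (T := T) (C := L) (isCompact_Icc (a := (1 : ℝ)) (b := a))
    (φ := fun t x => U 1 t x - N * exp (L * t)) ?_ ?_ ?_ t ht x hx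
  · have : exp (L * t) ≤ exp (L * T₀) := exp_le_exp.2 (by nlinarith [ht.2])
    have hN0 : 0 ≤ N := by positivity
    nlinarith
  · exact (hU.cont 1 (by omega)).sub (by fun_prop)
  · intro x hx
    have := (le_abs_self _).trans (hfM x hx)
    simp only [hU.init 1 (by omega) x hx, mul_zero, exp_zero]
    linarith
  · intro t ht _ x hx hpos hmax
    have hexp : HasDerivWithinAt (fun t => N * exp (L * t)) (N * (exp (L * t) * L)) (Icc 0 T) t := by
      simpa using ((((hasDerivAt_id t).const_mul L).exp).const_mul N).hasDerivWithinAt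
    refine ⟨_, (hU.dt 1 (by omega) t ht x hx).sub hexp, ?_⟩
    obtain ⟨h0, h0', -⟩ := hM T U hU t ht x hx
    have he : 1 ≤ exp (L * t) := one_le_exp (mul_nonneg hL0 ht.1)
    have h1 : M0 + 1 ≤ U 1 t x := by nlinarith
    have hp : (0 : ℝ) < 1 / (1 + U 1 t x ^ 2) := by positivity
    have hx1 := hx.1
    have hq : (0 : ℝ) < 1 / (x ^ 2 + U 0 t x ^ 2) := by positivity
    have hq1 : 1 / (x ^ 2 + U 0 t x ^ 2) ≤ 1 :=
      (div_le_one (by positivity)).2 (by nlinarith [sq_nonneg (U 0 t x)])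
    have hell := elliptic_nonpos_of_max hc.one_lt hx hmax
      (fun y hy => (hU.dx 1 (by omega) t ht y hy).sub_const (N * exp (L * t)))
      (hU.dx 2 (by omega) t ht x hx)
      (A := s 0 x * (1 / (1 + U 1 t x ^ 2)))
      (B := s 1 x * (1 / (1 + U 1 t x ^ 2)) + s 0 x * ν * x * (1 / (x ^ 2 + U 0 t x ^ 2)) -
        2 * s 0 x * U 1 t x * U 2 t x * (1 / (1 + U 1 t x ^ 2)) ^ 2)
      (mul_nonneg (hc.nonneg x hx) hp.le)
      (by
        rintro rfl
        simpa [hc.left] using mul_nonneg hc.deriv_left (by positivity))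
      (by
        rintro rfl
        simpa [hc.right] using mul_nonpos_of_nonpos_of_nonneg hc.deriv_right (by positivity))
    simp only [Function.iterate_one, jDF_one, jev_add, jev_mul, jev_sub, jev_p, jev_u, jev_C, jev_x,
      jev_q, jev_sg, jev_pow, jev_two]
    set p := 1 / (1 + U 1 t x ^ 2)
    set q := 1 / (x ^ 2 + U 0 t x ^ 2)
    have hd : 0 ≤ x * U 1 t x - U 0 t x := by nlinarith
    have hd' : x * U 1 t x - U 0 t x ≤ a * U 1 t x := by nlinarith [hx.2]
    have hU1 : 0 ≤ U 1 t x := by linarith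
    have r1 : s 1 x * (ν * (x * U 1 t x - U 0 t x) * q) ≤ L * U 1 t x := by
      have e1 : ν * (x * U 1 t x - U 0 t x) * q ≤ ν * (a * U 1 t x) * 1 := by gcongr
      calc _ ≤ S * (ν * (a * U 1 t x) * 1) :=
            mul_le_mul ((le_abs_self _).trans (hS x hx)) e1 (by positivity) hS0
        _ = L * U 1 t x := by rw [hL]; ring
    have r2 : 0 ≤ 2 * s 0 x * ν * (x * U 1 t x - U 0 t x) * (x + U 0 t x * U 1 t x) * q ^ 2 := by
      have := hc.nonneg x hx
      positivity
    linarith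

/-- The solutions with initial jet `f` have a uniformly bounded jet of order `m`. -/
def JetBound (s : ℕ → ℝ → ℝ) (ν a : ℝ) (k : ℕ) (T₀ : ℝ) (f : ℕ → ℝ → ℝ) (m : ℕ) : Prop :=
  ∃ M, 0 ≤ M ∧ ∀ T ≤ T₀, ∀ U, JetSol s ν a k T f U → ∀ t ∈ Icc 0 T, ∀ x ∈ Icc 1 a,
    ∀ j ≤ m, |U j t x| ≤ M

lemma jetBound_one {a ν : ℝ} {s f : ℕ → ℝ → ℝ} (hc : Coef a ν s) (hf : Init a ν f) {k : ℕ}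
    (hk : 4 ≤ k) (T₀ : ℝ) : JetBound s ν a k T₀ f 1 := by
  obtain ⟨M0, hM0, hM⟩ := apriori_lower hc hf hk
  obtain ⟨M1, hM1, hM'⟩ := apriori_upper hc hf hk T₀
  refine ⟨M0 + M1, by positivity, fun T hT U hU t ht x hx j hj => ?_⟩
  obtain ⟨h1, h2, h3⟩ := hM T U hU t ht x hx
  have h4 := hM' T hT U hU t ht x hx
  interval_cases j <;> rw [abs_le] <;> constructor <;> linarith

lemma JetBound.succ {a ν : ℝ} {s f : ℕ → ℝ → ℝ} {k m : ℕ} {T₀ : ℝ}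
    (h : JetBound s ν a k T₀ f m) (h' : ∃ M, 0 ≤ M ∧ ∀ T ≤ T₀, ∀ U, JetSol s ν a k T f U →
      ∀ t ∈ Icc 0 T, ∀ x ∈ Icc 1 a, |U (m + 1) t x| ≤ M) : JetBound s ν a k T₀ f (m + 1) := by
  obtain ⟨M, h0, hM⟩ := h
  obtain ⟨M', h0', hM'⟩ := h'
  refine ⟨max M M', le_max_of_le_left h0, fun T hT U hU t ht x hx j hj => ?_⟩
  rcases hj.eq_or_lt with rfl | hj
  · exact (hM' T hT U hU t ht x hx).trans (le_max_right _ _)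
  · exact (hM T hT U hU t ht x hx j (by omega)).trans (le_max_left _ _)

/-- A two-sided version of `modulus_principle`. -/
lemma abs_modulus_principle {a T C L Λ : ℝ} {w w₁ w₂ A B R : ℝ → ℝ → ℝ}
    {g g₁ g₂ : ℝ → ℝ}
    (hw : ContinuousOn (fun y : ℝ × ℝ => w y.1 y.2) (Icc 0 T ×ˢ Icc 1 a))
    (hw1 : ∀ t ∈ Icc 0 T, ∀ x ∈ Icc 1 a, HasDerivWithinAt (w t) (w₁ t x) (Icc 1 a) x)
    (hw2 : ∀ t ∈ Icc 0 T, ∀ x ∈ Icc 1 a, HasDerivWithinAt (w₁ t) (w₂ t x) (Icc 1 a) x)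
    (hwt : ∀ t ∈ Icc 0 T, ∀ x ∈ Icc 1 a, HasDerivWithinAt (fun t => w t x)
      (A t x * w₂ t x + B t x * w₁ t x + R t x) (Icc 0 T) t)
    (hA : ∀ t ∈ Icc 0 T, ∀ x ∈ Icc 1 a, 0 ≤ A t x)
    (hAl : ∀ t ∈ Icc 0 T, A t 1 = 0 ∧ 0 ≤ B t 1) (hAr : ∀ t ∈ Icc 0 T, A t a = 0 ∧ B t a ≤ 0)
    (hg : ContinuousOn g (Icc 0 (a - 1))) (hg0 : g 0 = 0)
    (hg1 : ∀ d ∈ Ioc 0 (a - 1), HasDerivAt g (g₁ d) d)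
    (hg2 : ∀ d ∈ Ioc 0 (a - 1), HasDerivAt g₁ (g₂ d) d)
    (hΛ : 0 ≤ Λ)
    (hinit : ∀ x ∈ Icc 1 a, ∀ y ∈ Icc 1 a, y ≤ x → |w 0 x - w 0 y| ≤ Λ * g (x - y))
    (hineq : ∀ t ∈ Icc 0 T, ∀ x ∈ Icc 1 a, ∀ y ∈ Icc 1 a, y < x →
      0 < |w t x - w t y| - Λ * exp (L * t) * g (x - y) →
      Λ * exp (L * t) * ((A t x + A t y) * g₂ (x - y) + (B t x - B t y) * g₁ (x - y)) +
      |R t x - R t y| ≤ Λ * exp (L * t) * (L * g (x - y)) +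
        C * (|w t x - w t y| - Λ * exp (L * t) * g (x - y)))
    (hgn : ∀ d ∈ Icc 0 (a - 1), 0 ≤ g d) :
    ∀ t ∈ Icc 0 T, ∀ x ∈ Icc 1 a, ∀ y ∈ Icc 1 a, y ≤ x →
      |w t x - w t y| ≤ Λ * exp (L * t) * g (x - y) := by
  have hG : ∀ t, ∀ x ∈ Icc 1 a, ∀ y ∈ Icc 1 a, y < x → 0 ≤ Λ * exp (L * t) * g (x - y) :=
    fun t x hx y hy h => mul_nonneg (mul_nonneg hΛ (exp_pos _).le)
      (hgn _ ⟨by linarith, by linarith [hx.2, hy.1]⟩)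
  intro t ht x hx y hy hyx
  refine abs_le'.2 ⟨?_, ?_⟩
  · refine modulus_principle (C := C) hw hw1 hw2 hwt hA hAl hAr hg hg0 hg1 hg2 hΛ
      (fun x hx y hy h => (le_abs_self _).trans (hinit x hx y hy h)) ?_ t ht x hx y hy hyx
    intro t ht x hx y hy h hφ
    have h2 := hG t x hx y hy h
    have h1 : |w t x - w t y| = w t x - w t y := abs_of_nonneg (by linarith)
    have := hineq t ht x hx y hy h (by rwa [h1])
    rw [h1] at this
    linarith [le_abs_self (R t x - R t y)]
  · have := modulus_principle (C := C) (w := fun t x => - w t x) (w₁ := fun t x => - w₁ t x)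
      (w₂ := fun t x => - w₂ t x) (R := fun t x => - R t x) (L := L) hw.neg
      (fun t ht x hx => (hw1 t ht x hx).fun_neg) (fun t ht x hx => (hw2 t ht x hx).fun_neg)
      (fun t ht x hx => (hwt t ht x hx).fun_neg.congr_deriv (by ring)) hA hAl hAr hg hg0 hg1 hg2 hΛ
      (fun x hx y hy h => by
        have := (neg_le_abs _).trans (hinit x hx y hy h)
        linarith) ?_ t ht x hx y hy hyx
    · linarith
    intro t ht x hx y hy h hφ
    have h2 := hG t x hx y hy h
    have h1 : |w t x - w t y| = -w t x - -w t y := by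
      rw [abs_of_nonpos (by linarith)]; ring
    have := hineq t ht x hx y hy h (by rwa [h1])
    rw [h1] at this
    linarith [neg_le_abs (R t x - R t y)]

lemma Coef.abs_deriv_le {a ν : ℝ} {s : ℕ → ℝ → ℝ} (hc : Coef a ν s) {w : ℝ → ℝ} {w' K x : ℝ}
    (hx : x ∈ Icc 1 a) (h : HasDerivWithinAt w w' (Icc 1 a) x)
    (hK : ∀ y ∈ Icc 1 a, |w y - w x| ≤ K * |y - x|) : |w'| ≤ K := by
  rw [hasDerivWithinAt_iff_tendsto_slope] at h
  have : (nhdsWithin x (Icc 1 a \ {x})).NeBot :=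
    accPt_principal_iff_nhdsWithin.1 (hc.uniqueDiff hx).accPt
  refine le_of_tendsto h.abs (Filter.mem_of_superset self_mem_nhdsWithin fun y hy => ?_)
  have hne : 0 < |y - x| := abs_pos.2 (sub_ne_zero.2 hy.2)
  simp only [Set.mem_ofPred_eq, slope_def_field, abs_div]
  exact (div_le_iff₀ hne).2 (hK y hy.1)

section
variable {a ν : ℝ} {s : ℕ → ℝ → ℝ}

lemma Coef.sg_lipschitz (hc : Coef a ν s) (i : ℕ) : ∃ K, 0 ≤ K ∧ ∀ x ∈ Icc 1 a, ∀ y ∈ Icc 1 a,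
    |s i x - s i y| ≤ K * |x - y| := by
  obtain ⟨K, h0, hK⟩ := hc.bound (i + 1)
  exact ⟨K, h0, fun x hx y hy => lipschitz_of_deriv_le (hc.deriv i) hK hx hy⟩

lemma Coef.sg_taylor (hc : Coef a ν s) : ∃ K, 0 ≤ K ∧ ∀ x ∈ Icc 1 a, ∀ y ∈ Icc 1 a, y ≤ x →
    |s 0 x - s 0 y - s 1 x * (x - y)| ≤ K * (x - y) ^ 2 := by
  obtain ⟨K, h0, hK⟩ := hc.sg_lipschitz 1
  refine ⟨K, h0, fun x hx y hy hxy => ?_⟩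
  have hss : Icc y x ⊆ Icc 1 a := Icc_subset_Icc hy.1 hx.2
  have := Convex.norm_image_sub_le_of_norm_hasDerivWithin_le (f := fun z => s 0 z - s 1 x * z)
    (f' := fun z => s 1 z - s 1 x) (C := K * (x - y)) (s := Icc y x) (x := y) (y := x)
    (fun z hz => by
      simpa using ((hc.deriv 0 z (hss hz)).mono hss).fun_sub
        ((hasDerivWithinAt_id z _).const_mul (s 1 x)))
    (fun z hz => (hK z (hss hz) x hx).trans (by
      have : |z - x| ≤ x - y := abs_le.2 ⟨by linarith [hz.1], by linarith [hz.2]⟩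
      gcongr)) (convex_Icc _ _) ⟨le_rfl, hxy⟩ ⟨hxy, le_rfl⟩
  rw [Real.norm_eq_abs, Real.norm_eq_abs, abs_of_nonneg (sub_nonneg.2 hxy)] at this
  calc _ = |s 0 x - s 1 x * x - (s 0 y - s 1 x * y)| := by ring_nf
    _ ≤ _ := this
    _ = _ := by ring

/-- The drift of the equation for the angle is controlled by its diffusion if `p` has a small
relative modulus of continuity. -/
lemma Coef.drift_le (hc : Coef a ν s) (κm M : ℝ) (hM : 0 ≤ M) : ∃ C, 0 ≤ C ∧
    ∀ x ∈ Icc 1 a, ∀ y ∈ Icc 1 a, y < x → ∀ z z' : ℕ → ℝ, |z 0| ≤ M → |z' 0| ≤ M →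
      |z 0 - z' 0| ≤ M * (x - y) → ∀ κ, 0 ≤ κ → κ ≤ κm → ∀ p p',
      0 ≤ p → p ≤ 1 → 0 ≤ p' → p' ≤ 1 → p - p' ≤ κ * p → p' - p ≤ κ * p' →
      (p * s 1 x + jev s (jC ν * jX .x * jX .q * jX (.sg 0)) x z) -
      (p' * s 1 y + jev s (jC ν * jX .x * jX .q * jX (.sg 0)) y z') ≤
        κ * (p * s 0 x + p' * s 0 y) / (x - y) + C * (x - y) := by
  obtain ⟨K, hK0, hK⟩ := jev_bound_lipschitz hc (m := 0) (r := jC ν * jX .x * jX .q * jX (.sg 0))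
    (mul_mem (mul_mem (mul_mem (C_mem_jS _ _) (x_mem_jS _)) (q_mem_jS _)) (sg_mem_jS _ _)) M
  obtain ⟨S1, hS10, hS1⟩ := hc.sg_lipschitz 1
  obtain ⟨S2, hS20, hS2⟩ := hc.sg_taylor
  refine ⟨K * (M + 1) + S1 + |κm| * S2, by positivity, ?_⟩
  intro x hx y hy hyx z z' hz hz' hzz κ hκ0 hκm p p' hp0 hp1 hp0' hp1' h1 h2
  have hd : 0 < x - y := sub_pos.2 hyx
  have e1 := (hK x hx z (fun j hj => by obtain rfl : j = 0 := by omega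
                                        exact hz)).2 y hy z' ((M + 1) * (x - y))
    (fun j hj => by obtain rfl : j = 0 := by omega
                    exact hz') (by rw [abs_of_pos hd]; nlinarith)
    (fun j hj => by obtain rfl : j = 0 := by omega
                    nlinarith)
  have e2 := hS1 x hx y hy
  rw [abs_of_pos hd] at e2
  have e3 := abs_le.1 (hS2 x hx y hy hyx.le)
  have hsx := hc.nonneg x hx
  have hsy := hc.nonneg y hy
  have e1' := (le_abs_self _).trans e1
  have e2' := (le_abs_self _).trans e2
  have e4 : p' * (s 1 x - s 1 y) ≤ S1 * (x - y) := by
    calc _ ≤ p' * (S1 * (x - y)) := by gcongr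
      _ ≤ 1 * (S1 * (x - y)) := by gcongr
      _ = _ := one_mul _
  have e5 : (p - p') * s 1 x ≤ κ * (p * s 0 x + p' * s 0 y) / (x - y) + κ * S2 * (x - y) := by
    rw [← sub_le_iff_le_add, le_div_iff₀ hd]
    rcases le_total 0 (s 1 x) with h | h
    · have f1 : (p - p') * s 1 x * (x - y) ≤ κ * p * (s 1 x * (x - y)) := by
        have := mul_le_mul_of_nonneg_right h1 (mul_nonneg h hd.le)
        linarith
      have f2 : κ * p * (s 1 x * (x - y)) ≤ κ * p * (s 0 x + S2 * (x - y) ^ 2) := by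
        gcongr; linarith
      have f3 : κ * p * (S2 * (x - y) ^ 2) ≤ κ * 1 * (S2 * (x - y) ^ 2) := by gcongr
      have f4 : 0 ≤ κ * (p' * s 0 y) := by positivity
      linarith
    · have f1 : (p - p') * s 1 x * (x - y) ≤ κ * p' * (-s 1 x * (x - y)) := by
        have := mul_le_mul_of_nonneg_right h2 (mul_nonneg (neg_nonneg.2 h) hd.le)
        linarith
      have f2 : κ * p' * (-s 1 x * (x - y)) ≤ κ * p' * (s 0 y + S2 * (x - y) ^ 2) := by
        gcongr; linarith
      have f3 : κ * p' * (S2 * (x - y) ^ 2) ≤ κ * 1 * (S2 * (x - y) ^ 2) := by gcongr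
      have f4 : 0 ≤ κ * (p * s 0 x) := by positivity
      linarith
  have e6 : κ * S2 * (x - y) ≤ |κm| * S2 * (x - y) := by
    gcongr; exact hκm.trans (le_abs_self _)
  linarith
end

lemma angle_modulus {a ν : ℝ} {s f : ℕ → ℝ → ℝ} (hc : Coef a ν s) (hf : Init a ν f) {k : ℕ}
    (hk : 4 ≤ k) (T₀ : ℝ) {g g₁ g₂ κ : ℝ → ℝ} {κm Cg Λ₀ : ℝ}
    (hg : ContinuousOn g (Icc 0 (a - 1))) (hg0 : g 0 = 0)
    (hg1 : ∀ d ∈ Ioc 0 (a - 1), HasDerivAt g (g₁ d) d)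
    (hg2 : ∀ d ∈ Ioc 0 (a - 1), HasDerivAt g₁ (g₂ d) d)
    (hgn : ∀ d ∈ Icc 0 (a - 1), 0 ≤ g d) (hg1n : ∀ d ∈ Ioc 0 (a - 1), 0 ≤ g₁ d)
    (hrel : ∀ d ∈ Ioc 0 (a - 1), g₂ d * d = -(κ d * g₁ d))
    (hκ : ∀ d ∈ Ioc 0 (a - 1), 0 ≤ κ d ∧ κ d ≤ κm) (hCg0 : 0 ≤ Cg)
    (hCg : ∀ d ∈ Ioc 0 (a - 1), g₁ d * d ≤ Cg * g d) (hΛ₀ : 0 ≤ Λ₀)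
    (hΛ : ∀ d ∈ Icc 0 (a - 1), d ≤ Λ₀ * g d)
    (hp : ∀ T ≤ T₀, ∀ U, JetSol s ν a k T f U → ∀ t ∈ Icc 0 T, ∀ x ∈ Icc 1 a, ∀ y ∈ Icc 1 a, y < x →
      1 / (1 + U 1 t x ^ 2) - 1 / (1 + U 1 t y ^ 2) ≤ κ (x - y) * (1 / (1 + U 1 t x ^ 2)) ∧
      1 / (1 + U 1 t y ^ 2) - 1 / (1 + U 1 t x ^ 2) ≤ κ (x - y) * (1 / (1 + U 1 t y ^ 2))) :
    ∃ Λ, 0 ≤ Λ ∧ ∀ T ≤ T₀, ∀ U, JetSol s ν a k T f U → ∀ t ∈ Icc 0 T, ∀ x ∈ Icc 1 a,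
      ∀ y ∈ Icc 1 a, y ≤ x →
      |angle ν x (fun i => U i t x) - angle ν y (fun i => U i t y)| ≤ Λ * g (x - y) := by
  obtain ⟨M, hM0, hM⟩ := jetBound_one hc hf hk T₀
  obtain ⟨C, hC0, hC⟩ := hc.drift_le κm M hM0
  obtain ⟨N0, hN00, hN0⟩ := hf.bound 0
  obtain ⟨N1, hN10, hN1⟩ := hf.bound 1
  obtain ⟨N2, hN20, hN2⟩ := hf.bound 2
  obtain ⟨P, hP0, hP⟩ := jev_bound hc (jH_mem ν) (N0 + N1 + N2)
  have hν := hc.two_le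
  set L := C * Cg with hL
  have hL0 : 0 ≤ L := by positivity
  refine ⟨P * Λ₀ * exp (L * T₀), by positivity, fun T hT U hU t ht x hx y hy hyx => ?_⟩
  have hmem : ∀ x ∈ Icc 1 a, ∀ y ∈ Icc 1 a, y ≤ x → x - y ∈ Icc 0 (a - 1) :=
    fun x hx y hy h => ⟨sub_nonneg.2 h, by linarith [hx.2, hy.1]⟩
  have hT0 : (0 : ℝ) ∈ Icc 0 T := ⟨le_rfl, ht.1.trans ht.2⟩
  have hpp : ∀ t x, (0 : ℝ) < 1 / (1 + U 1 t x ^ 2) := fun t x => by positivity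
  have hp1 : ∀ t x, 1 / (1 + U 1 t x ^ 2) ≤ 1 := fun t x =>
    (div_le_one (by positivity)).2 (by nlinarith [sq_nonneg (U 1 t x)])
  have key := abs_modulus_principle (a := a) (T := T) (C := 0) (L := L) (Λ := P * Λ₀)
    (w := fun t x => angle ν x (fun i => U i t x)) (w₁ := fun t x => jev s (jH ν) x fun i => U i t x)
    (w₂ := fun t x => jev s (jD (jH ν)) x fun i => U i t x)
    (A := fun t x => jev s (jX .p * jX (.sg 0)) x (fun i => U i t x))
    (B := fun t x => jev s (jX .p * jX (.sg 1) + jC ν * jX .x * jX .q * jX (.sg 0)) x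
      (fun i => U i t x)) (R := fun _ _ => 0)
    (hU.angle_cont (by omega)) (fun t ht x hx => hU.angle_dx (by omega) ht hx)
    (fun t ht x hx => hU.angle_dxx hc hk ht hx)
    (fun t ht x hx => (hU.angle_dt hk ht hx).congr_deriv (by ring)) ?_ ?_ ?_ hg hg0 hg1 hg2
    (by positivity) ?_ ?_ hgn t ht x hx y hy hyx
  · refine key.trans ?_
    have : exp (L * t) ≤ exp (L * T₀) := exp_le_exp.2 (by nlinarith [ht.2])
    exact mul_le_mul_of_nonneg_right (by gcongr) (hgn _ (hmem x hx y hy hyx))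
  · intro t ht x hx
    simp only [jev_mul, jev_p, jev_sg]
    exact mul_nonneg (hpp t x).le (hc.nonneg x hx)
  · intro t ht
    simp only [jev_add, jev_mul, jev_p, jev_sg, hc.left, mul_zero, add_zero, true_and]
    exact mul_nonneg (hpp t 1).le hc.deriv_left
  · intro t ht
    simp only [jev_add, jev_mul, jev_p, jev_sg, hc.right, mul_zero, add_zero, true_and]
    exact mul_nonpos_of_nonneg_of_nonpos (hpp t a).le hc.deriv_right
  · intro x hx y hy h
    have := lipschitz_of_deriv_le (w := fun y => angle ν y fun i => U i 0 y) (K := P)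
      (fun x hx => hU.angle_dx (by omega) hT0 hx) (fun x hx => by
        refine hP x hx _ fun j hj => ?_
        rw [hU.init j (by omega) x hx]
        interval_cases j
        · linarith [hN0 x hx]
        · linarith [hN1 x hx]
        · linarith [hN2 x hx]) hx hy
    rw [abs_of_nonneg (sub_nonneg.2 h)] at this
    refine this.trans ?_
    rw [mul_assoc]
    exact mul_le_mul_of_nonneg_left (hΛ _ (hmem x hx y hy h)) hP0
  · intro t ht x hx y hy h _
    have hd : 0 < x - y := sub_pos.2 h
    have hdm : x - y ∈ Ioc 0 (a - 1) := ⟨hd, (hmem x hx y hy h.le).2⟩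
    simp only [sub_self, abs_zero, add_zero, zero_mul]
    have hΛe : 0 ≤ P * Λ₀ * exp (L * t) := by positivity
    refine mul_le_mul_of_nonneg_left ?_ hΛe
    obtain ⟨h1, h2⟩ := hp T hT U hU t ht x hx y hy h
    have hlip := lipschitz_of_deriv_le (w := U 0 t) (K := M)
      (fun x hx => hU.dx 0 (by omega) t ht x hx) (fun x hx => hM T hT U hU t ht x hx 1 le_rfl) hx hy
    rw [abs_of_pos hd] at hlip
    have e := hC x hx y hy h (fun i => U i t x) (fun i => U i t y)
      (hM T hT U hU t ht x hx 0 (by norm_num)) (hM T hT U hU t ht y hy 0 (by norm_num)) hlip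
      (κ (x - y)) (hκ _ hdm).1 (hκ _ hdm).2 _ _ (hpp t x).le (hp1 t x) (hpp t y).le (hp1 t y) h1 h2
    have e2 := mul_le_mul_of_nonneg_right e (hg1n _ hdm)
    have e3 := hCg _ hdm
    have e4 : κ (x - y) * (1 / (1 + U 1 t x ^ 2) * s 0 x + 1 / (1 + U 1 t y ^ 2) * s 0 y) / (x - y) *
        g₁ (x - y) = - ((1 / (1 + U 1 t x ^ 2) * s 0 x + 1 / (1 + U 1 t y ^ 2) * s 0 y)
          * g₂ (x - y)) := by
      have : g₂ (x - y) = -(κ (x - y) * g₁ (x - y)) / (x - y) := by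
        rw [← hrel _ hdm]; field_simp
      rw [this]; field_simp
    have e5 : C * (g₁ (x - y) * (x - y)) ≤ C * (Cg * g (x - y)) := by gcongr
    have e6 : L * g (x - y) = C * (Cg * g (x - y)) := by rw [hL]; ring
    simp only [jev_add, jev_mul, jev_p, jev_sg, jev_C, jev_x, jev_q] at e2 ⊢
    rw [add_mul, e4] at e2
    rw [e6]
    linarith

lemma abs_cos_sq_sub_le (α β : ℝ) : |cos α ^ 2 - cos β ^ 2| ≤ 2 * |α - β| := by
  have h1 : |cos α - cos β| ≤ |α - β| := by
    have := Convex.norm_image_sub_le_of_norm_hasDerivWithin_le (f := cos) (f' := fun x => - sin x)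
      (C := 1) (s := univ) (x := β) (y := α) (fun x _ => (hasDerivAt_cos x).hasDerivWithinAt)
      (fun x _ => by simpa using abs_sin_le_one x) convex_univ trivial trivial
    simpa using this
  have h2 : |cos α + cos β| ≤ 2 := (abs_add_le _ _).trans (by linarith [abs_cos_le_one α, abs_cos_le_one β])
  rw [sq_sub_sq, abs_mul]
  exact mul_le_mul h2 h1 (abs_nonneg _) (by norm_num)

lemma Coef.one_div_q_le {x : ℝ} (hx : 1 ≤ x) (u : ℝ) : 1 / (x ^ 2 + u ^ 2) ≤ 1 :=
  (div_le_one (by positivity)).2 (by nlinarith [sq_nonneg u])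

lemma angle_hoelder {a ν : ℝ} {s f : ℕ → ℝ → ℝ} (hc : Coef a ν s) (hf : Init a ν f) {k : ℕ}
    (hk : 4 ≤ k) (T₀ : ℝ) {M : ℝ} (hM : ∀ T ≤ T₀, ∀ U, JetSol s ν a k T f U → ∀ t ∈ Icc 0 T,
      ∀ x ∈ Icc 1 a, ∀ j ≤ 1, |U j t x| ≤ M) :
    ∃ Λ, 0 ≤ Λ ∧ ∀ T ≤ T₀, ∀ U, JetSol s ν a k T f U → ∀ t ∈ Icc 0 T, ∀ x ∈ Icc 1 a,
      ∀ y ∈ Icc 1 a, y ≤ x →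
      |angle ν x (fun i => U i t x) - angle ν y (fun i => U i t y)| ≤
        Λ * (x - y) ^ (1 / (1 + M ^ 2)) := by
  set γ : ℝ := 1 / (1 + M ^ 2) with hγ
  have hγ0 : 0 < γ := by positivity
  have hγ1 : γ ≤ 1 := (div_le_one (by positivity)).2 (by nlinarith [sq_nonneg M])
  have ha : 0 < a - 1 := sub_pos.2 hc.one_lt
  refine angle_modulus hc hf hk T₀ (g := fun d => d ^ γ) (g₁ := fun d => γ * d ^ (γ - 1))
    (g₂ := fun d => γ * ((γ - 1) * d ^ (γ - 1 - 1))) (κ := fun _ => 1 - γ) (κm := 1 - γ) (Cg := 1)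
    (Λ₀ := (a - 1) ^ (1 - γ)) (continuous_rpow_const hγ0.le).continuousOn (zero_rpow hγ0.ne')
    (fun d hd => hasDerivAt_rpow_const (Or.inl hd.1.ne'))
    (fun d hd => (hasDerivAt_rpow_const (Or.inl hd.1.ne')).const_mul γ)
    (fun d hd => rpow_nonneg hd.1 _) (fun d hd => mul_nonneg hγ0.le (rpow_nonneg hd.1.le _))
    ?_ (fun d _ => ⟨by linarith, le_rfl⟩) zero_le_one ?_ (rpow_nonneg ha.le _) ?_ ?_
  · intro d hd
    have : d ^ (γ - 1) = d ^ (γ - 1 - 1) * d := by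
      conv_rhs => rw [← rpow_one d, ← rpow_mul hd.1.le, ← rpow_add hd.1]
      norm_num
    rw [this]; ring
  · intro d hd
    have : d ^ γ = d ^ (γ - 1) * d := by
      conv_rhs => rw [← rpow_one d, ← rpow_mul hd.1.le, ← rpow_add hd.1]
      norm_num
    simp only [this]
    have h : 0 ≤ d ^ (γ - 1) * d := mul_nonneg (rpow_nonneg hd.1.le _) hd.1.le
    nlinarith
  · intro d hd
    rcases hd.1.eq_or_lt with rfl | h
    · simp [zero_rpow hγ0.ne']
    · calc d = d ^ (1 - γ) * d ^ γ := by rw [← rpow_add h]; simp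
        _ ≤ _ := by
          have := rpow_le_rpow hd.1 hd.2 (sub_nonneg.2 hγ1)
          have := rpow_nonneg hd.1 γ
          gcongr
  · intro T hT U hU t ht x hx y hy _
    have h : ∀ x ∈ Icc 1 a, γ ≤ 1 / (1 + U 1 t x ^ 2) ∧ 1 / (1 + U 1 t x ^ 2) ≤ 1 := by
      intro x hx
      have := hM T hT U hU t ht x hx 1 le_rfl
      have h2 : U 1 t x ^ 2 ≤ M ^ 2 := sq_le_sq' (abs_le.1 this).1 (abs_le.1 this).2
      exact ⟨one_div_le_one_div_of_le (by positivity) (by linarith),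
        (div_le_one (by positivity)).2 (by nlinarith [sq_nonneg (U 1 t x)])⟩
    obtain ⟨h1, h1'⟩ := h x hx
    obtain ⟨h2, h2'⟩ := h y hy
    constructor <;> nlinarith

lemma p_hoelder {a ν : ℝ} {s f : ℕ → ℝ → ℝ} (hc : Coef a ν s) (hf : Init a ν f) {k : ℕ}
    (hk : 4 ≤ k) (T₀ : ℝ) {M : ℝ} (hM0 : 0 ≤ M) (hM : ∀ T ≤ T₀, ∀ U, JetSol s ν a k T f U →
      ∀ t ∈ Icc 0 T, ∀ x ∈ Icc 1 a, ∀ j ≤ 1, |U j t x| ≤ M) :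
    ∃ Λ, 0 ≤ Λ ∧ ∀ T ≤ T₀, ∀ U, JetSol s ν a k T f U → ∀ t ∈ Icc 0 T, ∀ x ∈ Icc 1 a,
      ∀ y ∈ Icc 1 a, y ≤ x →
      |1 / (1 + U 1 t x ^ 2) - 1 / (1 + U 1 t y ^ 2)| ≤ Λ * (x - y) ^ (1 / (1 + M ^ 2)) := by
  obtain ⟨Λ, hΛ0, hΛ⟩ := angle_hoelder hc hf hk T₀ hM
  have ha : 0 < a - 1 := sub_pos.2 hc.one_lt
  have ha' := hc.one_lt
  have hν := hc.two_le
  set γ : ℝ := 1 / (1 + M ^ 2) with hγ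
  have hγ0 : 0 < γ := by positivity
  have hγ1 : γ ≤ 1 := (div_le_one (by positivity)).2 (by nlinarith [sq_nonneg M])
  have hp1 : 0 ≤ (a - 1) ^ (1 - γ) := rpow_nonneg ha.le _
  refine ⟨2 * (Λ + ν * ((a * M + M) * (a - 1) ^ (1 - γ))), by positivity, ?_⟩
  intro T hT U hU t ht x hx y hy hyx
  have hd : ∀ x ∈ Icc 1 a, HasDerivWithinAt (fun y => arctan (U 0 t y / y))
      ((x * U 1 t x - U 0 t x) * (1 / (x ^ 2 + U 0 t x ^ 2))) (Icc 1 a) x := by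
    intro x hx
    have hx0 : x ≠ 0 := by linarith [hx.1]
    refine (((hU.dx 0 (by omega) t ht x hx).div (hasDerivWithinAt_id x _) hx0).arctan).congr_deriv ?_
    have : x ^ 2 + U 0 t x ^ 2 ≠ 0 := by positivity
    simp
    field_simp
  have hb : ∀ x ∈ Icc 1 a, |(x * U 1 t x - U 0 t x) * (1 / (x ^ 2 + U 0 t x ^ 2))| ≤ a * M + M := by
    intro x hx
    have h0 := hM T hT U hU t ht x hx 0 (by norm_num)
    have h1 := hM T hT U hU t ht x hx 1 (by norm_num)
    have hx0 : 0 ≤ x := by linarith [hx.1]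
    rw [abs_mul, abs_of_nonneg (a := 1 / _) (by positivity)]
    have : |x * U 1 t x - U 0 t x| ≤ a * M + M := (abs_sub _ _).trans (by
      rw [abs_mul, abs_of_nonneg hx0]
      gcongr; exact hx.2)
    calc _ ≤ (a * M + M) * 1 :=
          mul_le_mul this (Coef.one_div_q_le hx.1 _) (by positivity) (by positivity)
      _ = _ := mul_one _
  have e1 := lipschitz_of_deriv_le hd hb hx hy
  have e2 := hΛ T hT U hU t ht x hx y hy hyx
  have hd0 : 0 ≤ x - y := sub_nonneg.2 hyx
  rw [abs_of_nonneg hd0] at e1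
  have e3 : x - y ≤ (a - 1) ^ (1 - γ) * (x - y) ^ γ := by
    rcases hd0.eq_or_lt with h | h
    · rw [← h]; simp [zero_rpow hγ0.ne']
    · calc x - y = (x - y) ^ (1 - γ) * (x - y) ^ γ := by rw [← rpow_add h]; simp
        _ ≤ _ := by
          have := rpow_le_rpow hd0 (show x - y ≤ a - 1 by linarith [hx.2, hy.1]) (sub_nonneg.2 hγ1)
          have := rpow_nonneg hd0 γ
          gcongr
  have e4 : (a * M + M) * (x - y) ≤ (a * M + M) * ((a - 1) ^ (1 - γ) * (x - y) ^ γ) := by gcongr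
  have e5 : |arctan (U 1 t x) - arctan (U 1 t y)| ≤
      (Λ + ν * ((a * M + M) * (a - 1) ^ (1 - γ))) * (x - y) ^ γ := by
    have h : arctan (U 1 t x) - arctan (U 1 t y) =
      (angle ν x (fun i => U i t x) - angle ν y (fun i => U i t y)) -
        ν * (arctan (U 0 t x / x) - arctan (U 0 t y / y)) := by
      simp only [angle]; ring
    rw [h]
    refine (abs_sub _ _).trans ?_
    rw [abs_mul, abs_of_nonneg (by linarith : 0 ≤ ν)]
    have := mul_le_mul_of_nonneg_left (e1.trans e4) (by linarith : 0 ≤ ν)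
    linarith
  rw [← cos_sq_arctan, ← cos_sq_arctan]
  refine (abs_cos_sq_sub_le _ _).trans ?_
  linarith

lemma jetBound_two {a ν : ℝ} {s f : ℕ → ℝ → ℝ} (hc : Coef a ν s) (hf : Init a ν f) {k : ℕ}
    (hk : 4 ≤ k) (T₀ : ℝ) : JetBound s ν a k T₀ f 2 := by
  have h1 := jetBound_one hc hf hk T₀
  refine h1.succ ?_
  obtain ⟨M, hM0, hM⟩ := h1
  obtain ⟨Λ, hΛ0, hΛ⟩ := p_hoelder hc hf hk T₀ hM0 hM
  have ha : 0 < a - 1 := sub_pos.2 hc.one_lt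
  have ha' := hc.one_lt
  have hν := hc.two_le
  set γ : ℝ := 1 / (1 + M ^ 2) with hγ
  have hγ0 : 0 < γ := by positivity
  set K := Λ / γ with hK
  have hK0 : 0 ≤ K := by positivity
  have hKγ : Λ = K * γ := by rw [hK]; field_simp
  set e : ℝ → ℝ := fun d => exp (-(K / γ) * d ^ γ) with he
  have hec : Continuous e := continuous_exp.comp (continuous_const.mul (continuous_rpow_const hγ0.le))
  set e0 := e (a - 1) with he0
  have he0p : 0 < e0 := exp_pos _
  have hel : ∀ d ∈ Icc 0 (a - 1), e0 ≤ e d ∧ e d ≤ 1 := by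
    intro d hd
    have h1 := rpow_le_rpow hd.1 hd.2 hγ0.le
    have h2 := rpow_nonneg hd.1 γ
    have h3 : 0 ≤ K / γ := by positivity
    refine ⟨exp_le_exp.2 (by nlinarith), exp_le_one_iff.2 (by nlinarith)⟩
  have hgl : ∀ d ∈ Icc 0 (a - 1), e0 * d ≤ ∫ r in (0 : ℝ)..d, e r := by
    intro d hd
    have := intervalIntegral.integral_mono_on (μ := MeasureTheory.volume) (f := fun _ => e0) hd.1 intervalIntegrable_const
      (hec.intervalIntegrable 0 d) fun r hr => (hel r ⟨hr.1, hr.2.trans hd.2⟩).1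
    simpa [mul_comm] using this
  have hgu : ∀ d ∈ Icc 0 (a - 1), ∫ r in (0 : ℝ)..d, e r ≤ d := by
    intro d hd
    have := intervalIntegral.integral_mono_on (μ := MeasureTheory.volume) (g := fun _ => (1 : ℝ)) hd.1
      (hec.intervalIntegrable 0 d) intervalIntegrable_const
      fun r hr => (hel r ⟨hr.1, hr.2.trans hd.2⟩).2
    simpa using this
  have hgd : ∀ d, HasDerivAt (fun d => ∫ r in (0 : ℝ)..d, e r) (e d) d := fun d =>
    (hec.integral_hasStrictDerivAt 0 d).hasDerivAt
  have key := angle_modulus hc hf hk T₀ (g := fun d => ∫ r in (0 : ℝ)..d, e r)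
    (g₁ := e) (g₂ := fun d => e d * (-(K / γ) * (γ * d ^ (γ - 1)))) (κ := fun d => K * d ^ γ)
    (κm := K * (a - 1) ^ γ) (Cg := e0⁻¹) (Λ₀ := e0⁻¹)
    (fun d _ => (hgd d).continuousAt.continuousWithinAt) (by simp) (fun d _ => hgd d)
    (fun d hd => ((hasDerivAt_rpow_const (Or.inl hd.1.ne')).const_mul _).exp)
    (fun d hd => (mul_nonneg he0p.le hd.1).trans (hgl d hd)) (fun d _ => (exp_pos _).le) ?_ ?_
    (by positivity) ?_ (by positivity) ?_ ?_
  · obtain ⟨P, hP0, hP⟩ := key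
    refine ⟨(1 + M ^ 2) * (P + ν * (a * M + M)), by positivity, fun T hT U hU t ht x hx => ?_⟩
    have hH := hc.abs_deriv_le hx (hU.angle_dx (by omega) ht hx) (K := P) fun y hy => by
      rcases le_total x y with h | h
      · refine (hP T hT U hU t ht y hy x hx h).trans ?_
        rw [abs_of_nonneg (sub_nonneg.2 h)]
        exact mul_le_mul_of_nonneg_left (hgu _ ⟨sub_nonneg.2 h, by linarith [hx.1, hy.2]⟩) hP0
      · rw [abs_sub_comm, abs_sub_comm y]
        refine (hP T hT U hU t ht x hx y hy h).trans ?_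
        rw [abs_of_nonneg (sub_nonneg.2 h)]
        exact mul_le_mul_of_nonneg_left (hgu _ ⟨sub_nonneg.2 h, by linarith [hx.2, hy.1]⟩) hP0
    have h0 := hM T hT U hU t ht x hx 0 (by norm_num)
    have h1 := hM T hT U hU t ht x hx 1 (by norm_num)
    simp only [jH, jev_add, jev_mul, jev_p, jev_u, jev_C, jev_sub, jev_x, jev_q] at hH
    have hx0 : 0 ≤ x := by linarith [hx.1]
    have hb : |ν * (x * U 1 t x - U 0 t x) * (1 / (x ^ 2 + U 0 t x ^ 2))| ≤ ν * (a * M + M) := by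
      rw [abs_mul, abs_mul, abs_of_nonneg (a := 1 / _) (by positivity),
        abs_of_nonneg (by linarith : 0 ≤ ν)]
      have : |x * U 1 t x - U 0 t x| ≤ a * M + M := (abs_sub _ _).trans (by
        rw [abs_mul, abs_of_nonneg hx0]
        gcongr; exact hx.2)
      calc _ ≤ (ν * (a * M + M)) * 1 := mul_le_mul (by gcongr) (Coef.one_div_q_le hx.1 _)
            (by positivity) (by positivity)
        _ = _ := mul_one _
    have h3 : U 2 t x = (1 + U 1 t x ^ 2) * (1 / (1 + U 1 t x ^ 2) * U 2 t x +
        ν * (x * U 1 t x - U 0 t x) * (1 / (x ^ 2 + U 0 t x ^ 2)) -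
        ν * (x * U 1 t x - U 0 t x) * (1 / (x ^ 2 + U 0 t x ^ 2))) := by
      field_simp; ring
    have h2 : U 1 t x ^ 2 ≤ M ^ 2 := sq_le_sq' (abs_le.1 h1).1 (abs_le.1 h1).2
    show |U 2 t x| ≤ _
    rw [h3, abs_mul, abs_of_nonneg (by positivity)]
    refine mul_le_mul (by linarith) ((abs_sub _ _).trans (add_le_add hH hb)) (abs_nonneg _)
      (by positivity)
  · intro d hd
    have : d ^ γ = d ^ (γ - 1) * d := by
      conv_rhs => rw [← rpow_one d, ← rpow_mul hd.1.le, ← rpow_add hd.1]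
      norm_num
    simp only [this]
    field_simp
  · intro d hd
    have h1 := rpow_le_rpow hd.1.le hd.2 hγ0.le
    have h2 := rpow_nonneg hd.1.le γ
    exact ⟨by positivity, by gcongr⟩
  · intro d hd
    have hd' := Ioc_subset_Icc_self hd
    rw [le_inv_mul_iff₀ he0p]
    have h1 := hgl d hd'
    have h2 := mul_le_mul_of_nonneg_right (hel d hd').2 (mul_nonneg he0p.le hd.1.le)
    linarith
  · intro d hd
    rw [le_inv_mul_iff₀ he0p]
    exact hgl d hd
  · intro T hT U hU t ht x hx y hy hyx
    have h : ∀ x ∈ Icc 1 a, γ ≤ 1 / (1 + U 1 t x ^ 2) := by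
      intro x hx
      have := hM T hT U hU t ht x hx 1 le_rfl
      have h2 : U 1 t x ^ 2 ≤ M ^ 2 := sq_le_sq' (abs_le.1 this).1 (abs_le.1 this).2
      exact one_div_le_one_div_of_le (by positivity) (by linarith)
    have h3 := abs_le.1 (hΛ T hT U hU t ht x hx y hy hyx.le)
    have h4 : 0 ≤ K * (x - y) ^ γ := mul_nonneg hK0 (rpow_nonneg (sub_nonneg.2 hyx.le) _)
    have h5 : Λ * (x - y) ^ γ = K * (x - y) ^ γ * γ := by rw [hKγ]; ring
    rw [h5] at h3
    have h1 := mul_le_mul_of_nonneg_left (h x hx) h4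
    have h2 := mul_le_mul_of_nonneg_left (h y hy) h4
    constructor <;> linarith

/-- The concave modulus of continuity `(1 - exp (-κ d)) / κ`. -/
noncomputable def expMod (κ d : ℝ) : ℝ := (1 - exp (-κ * d)) / κ

lemma expMod_hasDerivAt {κ : ℝ} (hκ : 0 < κ) (d : ℝ) :
    HasDerivAt (expMod κ) (exp (-κ * d)) d := by
  have := ((((hasDerivAt_id d).const_mul (-κ)).exp).const_sub 1).div_const κ
  refine this.congr_deriv ?_
  simp only [id]
  field_simp

lemma expMod_le {κ : ℝ} (hκ : 0 < κ) (d : ℝ) : expMod κ d ≤ d := by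
  rw [expMod, div_le_iff₀ hκ]
  linarith [add_one_le_exp (-κ * d)]

lemma le_expMod {κ d D : ℝ} (hκ : 0 < κ) (hd : 0 ≤ d) (hD : d ≤ D) :
    d ≤ exp (κ * D) * expMod κ d := by
  have h1 : 1 + κ * d ≤ exp (κ * d) := by linarith [add_one_le_exp (κ * d)]
  have h2 : exp (κ * d) ≤ exp (κ * D) := exp_le_exp.2 (by gcongr)
  have h3 : d ≤ exp (κ * d) * expMod κ d := by
    have : exp (κ * d) * expMod κ d = (exp (κ * d) - 1) / κ := by
      rw [expMod, mul_div_assoc', mul_sub, ← exp_add]; simp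
    rw [this, le_div_iff₀ hκ]; linarith
  have h4 : 0 ≤ expMod κ d := div_nonneg (sub_nonneg.2 (exp_le_one_iff.2 (by nlinarith))) hκ.le
  exact h3.trans (by gcongr)

lemma jetBound_succ {a ν : ℝ} {s f : ℕ → ℝ → ℝ} (hc : Coef a ν s) (hf : Init a ν f) {k m : ℕ}
    (hm : 2 ≤ m) (hk : m + 2 < k) {T₀ : ℝ} (h : JetBound s ν a k T₀ f m) :
    JetBound s ν a k T₀ f (m + 1) := by
  refine h.succ ?_
  obtain ⟨M, hM0, hM⟩ := h
  obtain ⟨N, hN0, hN⟩ := hf.bound (m + 1)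
  have hmem1 : jC (m : ℝ) * jX (.sg 1) * jX .p ∈ jS 1 :=
    mul_mem (mul_mem (C_mem_jS _ _) (sg_mem_jS _ _)) (p_mem_jS le_rfl)
  obtain ⟨K1, hK10, hK1⟩ := jev_bound_lipschitz hc hmem1 M
  obtain ⟨Kβ, hKβ0, hKβ⟩ := jev_bound hc (jB_mem ν m) M
  obtain ⟨K, hK0, hK⟩ := jev_bound_lipschitz hc (jR_mem ν hm) M
  have ha' := hc.one_lt
  set κ := (Kβ + 1) * (1 + M ^ 2) with hκ
  have hκ0 : 0 < κ := by positivity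
  set Cg := exp (κ * (a - 1)) with hCg
  have hCg0 : 0 < Cg := exp_pos _
  set L := K1 * (M + 1) * Cg + (K * (M + 1) * Cg + K) with hL
  have hL0 : 0 ≤ L := by positivity
  refine ⟨(N * Cg + 1) * exp (L * T₀), by positivity, fun T hT U hU t ht x hx => ?_⟩
  have hT0 : (0 : ℝ) ∈ Icc 0 T := ⟨le_rfl, ht.1.trans ht.2⟩
  have hgle : ∀ x ∈ Icc 1 a, ∀ y ∈ Icc 1 a, y ≤ x → x - y ≤ Cg * expMod κ (x - y) :=
    fun x hx y hy h => le_expMod hκ0 (sub_nonneg.2 h) (by linarith [hx.2, hy.1])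
  have hgn : ∀ d, 0 ≤ d → 0 ≤ expMod κ d := fun d hd =>
    div_nonneg (sub_nonneg.2 (exp_le_one_iff.2 (by nlinarith))) hκ0.le
  have key := abs_modulus_principle (a := a) (T := T) (C := K) (L := L) (Λ := N * Cg + 1)
    (w := U m) (w₁ := U (m + 1)) (w₂ := U (m + 2))
    (A := fun t x => s 0 x * (1 / (1 + U 1 t x ^ 2)))
    (B := fun t x => jev s (jC (m : ℝ) * jX (.sg 1) * jX .p) x (fun i => U i t x) +
      s 0 x * jev s (jB ν m) x (fun i => U i t x))
    (R := fun t x => jev s (jR ν m) x (fun i => U i t x)) (g := expMod κ)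
    (g₁ := fun d => exp (-κ * d)) (g₂ := fun d => exp (-κ * d) * (-κ))
    (hU.cont m (by omega)) (hU.dx m (by omega)) (hU.dx (m + 1) (by omega))
    (fun t ht x hx => (hU.dt m hk t ht x hx).congr_deriv (by
      simp only [jDF_eq, jev_add, jev_mul, jev_sg, jev_p, jev_u])) ?_ ?_ ?_
    (fun d _ => (expMod_hasDerivAt hκ0 d).continuousAt.continuousWithinAt) (by simp [expMod])
    (fun d _ => expMod_hasDerivAt hκ0 d)
    (fun d _ => by simpa using ((hasDerivAt_id d).const_mul (-κ)).exp) (by positivity) ?_ ?_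
    (fun d hd => hgn d hd.1)
  · refine hc.abs_deriv_le hx (hU.dx m (by omega) t ht x hx) fun y hy => ?_
    have hexp : exp (L * t) ≤ exp (L * T₀) := exp_le_exp.2 (by nlinarith [ht.2])
    have aux : ∀ x ∈ Icc 1 a, ∀ y ∈ Icc 1 a, y ≤ x →
        |U m t x - U m t y| ≤ (N * Cg + 1) * exp (L * T₀) * |x - y| := by
      intro x hx y hy h
      refine (key t ht x hx y hy h).trans ?_
      rw [abs_of_nonneg (sub_nonneg.2 h)]
      exact mul_le_mul (by gcongr) (expMod_le hκ0 _) (hgn _ (sub_nonneg.2 h)) (by positivity)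
    rcases le_total x y with h | h
    · exact aux y hy x hx h
    · rw [abs_sub_comm, abs_sub_comm y]; exact aux x hx y hy h
  · intro t ht x hx
    have := hc.nonneg x hx
    positivity
  · intro t ht
    simp only [jev_mul, jev_C, jev_sg, jev_p, hc.left, zero_mul, add_zero, true_and]
    have := hc.deriv_left
    positivity
  · intro t ht
    simp only [jev_mul, jev_C, jev_sg, jev_p, hc.right, zero_mul, add_zero, true_and]
    have h1 : (m : ℝ) * s 1 a ≤ 0 := mul_nonpos_of_nonneg_of_nonpos (by positivity) hc.deriv_right
    exact mul_nonpos_of_nonpos_of_nonneg h1 (by positivity)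
  · intro x hx y hy h
    have := lipschitz_of_deriv_le (w := U m 0) (K := N)
      (fun x hx => hU.dx m (by omega) 0 hT0 x hx) (fun x hx => by
        rw [hU.init _ (by omega) x hx]; exact hN x hx) hx hy
    rw [abs_of_nonneg (sub_nonneg.2 h)] at this
    have h1 := mul_le_mul_of_nonneg_left (hgle x hx y hy h) hN0
    have h2 := hgn _ (sub_nonneg.2 h)
    linarith
  · intro t ht x hx y hy hyx hφ
    have hd : 0 < x - y := sub_pos.2 hyx
    have hbx := hM T hT U hU t ht x hx
    have hby := hM T hT U hU t ht y hy
    set g := expMod κ (x - y) with hg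
    have hdg := hgle x hx y hy hyx.le
    have hg0 := hgn _ hd.le
    set e := exp (-κ * (x - y)) with he
    have he0 : 0 < e := exp_pos _
    have he1 : e ≤ 1 := exp_le_one_iff.2 (by nlinarith)
    set G := (N * Cg + 1) * exp (L * t) with hG
    have hG1 : 1 ≤ G := by
      have h1 : 1 ≤ exp (L * t) := one_le_exp (mul_nonneg hL0 ht.1)
      have h2 : 0 ≤ N * Cg := by positivity
      nlinarith
    have hlip : ∀ j < m, |U j t x - U j t y| ≤ M * (x - y) := by
      intro j hj
      have := lipschitz_of_deriv_le (w := U j t) (K := M) (fun x hx => hU.dx j (by omega) t ht x hx)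
        (fun x hx => hM T hT U hU t ht x hx (j + 1) (by omega)) hx hy
      rwa [abs_of_pos hd] at this
    set φ := |U m t x - U m t y| - G * g with hφd
    have hR : |jev s (jR ν m) x (fun i => U i t x) - jev s (jR ν m) y (fun i => U i t y)| ≤
        K * ((M + 1) * (x - y) + |U m t x - U m t y|) := by
      refine (hK x hx _ hbx).2 y hy _ _ hby ?_ fun j hj => ?_
      · rw [abs_of_pos hd]
        have := abs_nonneg (U m t x - U m t y)
        nlinarith
      · rcases hj.eq_or_lt with rfl | hj
        · have : 0 ≤ (M + 1) * (x - y) := by positivity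
          linarith
        · have := abs_nonneg (U m t x - U m t y)
          have := hlip j hj
          linarith
    have hB1 : jev s (jC (m : ℝ) * jX (.sg 1) * jX .p) x (fun i => U i t x) -
        jev s (jC (m : ℝ) * jX (.sg 1) * jX .p) y (fun i => U i t y) ≤ K1 * ((M + 1) * (x - y)) := by
      refine (le_abs_self _).trans ((hK1 x hx _ fun j hj => hbx j (by omega)).2 y hy _ _
        (fun j hj => hby j (by omega)) ?_ fun j hj => ?_)
      · rw [abs_of_pos hd]; nlinarith
      · have := hlip j (by omega)
        linarith
    have hσ : ∀ x ∈ Icc 1 a, s 0 x * |jev s (jB ν m) x (fun i => U i t x)| ≤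
        κ * (s 0 x * (1 / (1 + U 1 t x ^ 2))) := by
      intro x hx
      have h1 := hKβ x hx (fun i => U i t x) fun j hj => hM T hT U hU t ht x hx j (by omega)
      have h2 := hM T hT U hU t ht x hx 1 (by omega)
      have h3 : U 1 t x ^ 2 ≤ M ^ 2 := sq_le_sq' (abs_le.1 h2).1 (abs_le.1 h2).2
      have h4 : Kβ ≤ κ * (1 / (1 + U 1 t x ^ 2)) := by
        rw [mul_one_div, le_div_iff₀ (by positivity), hκ]
        exact mul_le_mul (by linarith) (by linarith) (by positivity) (by positivity)
      have := mul_le_mul_of_nonneg_left (h1.trans h4) (hc.nonneg x hx)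
      linarith
    have hσx := hσ x hx
    have hσy := hσ y hy
    have bx := mul_le_mul_of_nonneg_left (le_abs_self (jev s (jB ν m) x (fun i => U i t x)))
      (hc.nonneg x hx)
    have b_y := mul_le_mul_of_nonneg_left (neg_abs_le (jev s (jB ν m) y (fun i => U i t y)))
      (hc.nonneg y hy)
    set Ax := s 0 x * (1 / (1 + U 1 t x ^ 2))
    set Ay := s 0 y * (1 / (1 + U 1 t y ^ 2))
    set βx := s 0 x * jev s (jB ν m) x (fun i => U i t x)
    set βy := s 0 y * jev s (jB ν m) y (fun i => U i t y)
    set b1x := jev s (jC (m : ℝ) * jX (.sg 1) * jX .p) x (fun i => U i t x)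
    set b1y := jev s (jC (m : ℝ) * jX (.sg 1) * jX .p) y (fun i => U i t y)
    have h1 : -κ * (Ax + Ay) + (b1x + βx - (b1y + βy)) ≤ K1 * (M + 1) * (x - y) := by linarith
    have h2 := mul_le_mul_of_nonneg_left h1 he0.le
    have h3 : e * (K1 * (M + 1) * (x - y)) ≤ 1 * (K1 * (M + 1) * (Cg * g)) := by gcongr
    have h4 : (Ax + Ay) * (e * -κ) + (b1x + βx - (b1y + βy)) * e ≤ K1 * (M + 1) * Cg * g := by
      linarith
    have h5 := mul_le_mul_of_nonneg_left h4 (by linarith : 0 ≤ G)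
    have h6 : K * ((M + 1) * (x - y)) ≤ K * ((M + 1) * (Cg * g)) := by gcongr
    have h7 : K * ((M + 1) * (Cg * g)) ≤ G * (K * ((M + 1) * (Cg * g))) :=
      le_mul_of_one_le_left (by positivity) hG1
    have h8 : K * |U m t x - U m t y| = K * φ + K * (G * g) := by rw [hφd]; ring
    have h9 : G * (L * g) = G * (K1 * (M + 1) * Cg * g) + G * (K * ((M + 1) * (Cg * g))) +
      K * (G * g) := by rw [hL]; ring
    rw [h9]
    linarith

/-- A priori estimates for all derivatives of solutions with supercritical initial phase. -/
theorem apriori {a ν : ℝ} {s f : ℕ → ℝ → ℝ} (hc : Coef a ν s) (hf : Init a ν f) {k : ℕ}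
    (hk : 4 ≤ k) (T₀ : ℝ) : JetBound s ν a k T₀ f (k - 2) := by
  have : ∀ m, 2 ≤ m → m + 1 < k → JetBound s ν a k T₀ f m := by
    intro m hm
    induction m, hm using Nat.le_induction with
    | base => exact fun _ => jetBound_two hc hf hk T₀
    | succ m hm ih => exact fun h => jetBound_succ hc hf hm (by omega) (ih (by omega))
  exact this _ (by omega) (by omega)

/-! ### Tools from calculus -/

lemma integral_eq_sub_of_within {c d : ℝ} {w w' : ℝ → ℝ}
    (hw : ∀ x ∈ Icc c d, HasDerivWithinAt w (w' x) (Icc c d) x) (hw' : ContinuousOn w' (Icc c d))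
    {x y : ℝ} (hx : x ∈ Icc c d) (hy : y ∈ Icc c d) (hxy : x ≤ y) :
    ∫ r in x..y, w' r = w y - w x := by
  have hss : Icc x y ⊆ Icc c d := Icc_subset_Icc hx.1 hy.2
  refine intervalIntegral.integral_eq_sub_of_hasDerivAt_of_le hxy
    (fun r hr => (hw r (hss hr)).continuousWithinAt.mono hss) (fun r hr => ?_)
    ((hw'.mono hss).intervalIntegrable_of_Icc hxy)
  exact (hw r (hss (Ioo_subset_Icc_self hr))).hasDerivAt
    (Icc_mem_nhds (hx.1.trans_lt hr.1) (hr.2.trans_le hy.2))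

lemma hasDerivWithinAt_integral {c d : ℝ} {g : ℝ → ℝ} (hg : ContinuousOn g (Icc c d)) {x : ℝ}
    (hx : x ∈ Icc c d) : HasDerivWithinAt (fun x => ∫ r in c..x, g r) (g x) (Icc c d) x := by
  have : Fact (x ∈ Icc c d) := ⟨hx⟩
  exact intervalIntegral.integral_hasDerivWithinAt_right
    ((hg.mono (Icc_subset_Icc_right hx.2)).intervalIntegrable_of_Icc hx.1)
    (hg.stronglyMeasurableAtFilter_nhdsWithin measurableSet_Icc x) (hg x hx)

lemma abs_integral_le {c d K : ℝ} {g : ℝ → ℝ} (hcd : c ≤ d) (hg : ∀ x ∈ Icc c d, |g x| ≤ K) :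
    |∫ x in c..d, g x| ≤ K * (d - c) := by
  have := intervalIntegral.norm_integral_le_of_norm_le_const (a := c) (b := d) (f := g) (C := K)
    fun x hx => hg x (by rw [uIoc_of_le hcd] at hx; exact Ioc_subset_Icc_self hx)
  rwa [Real.norm_eq_abs, abs_of_nonneg (sub_nonneg.2 hcd)] at this

lemma integral_mono_Icc {c d : ℝ} {g h : ℝ → ℝ} (hcd : c ≤ d) (hg : ContinuousOn g (Icc c d))
    (hh : ContinuousOn h (Icc c d)) (hgh : ∀ x ∈ Icc c d, g x ≤ h x) :
    ∫ x in c..d, g x ≤ ∫ x in c..d, h x :=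
  intervalIntegral.integral_mono_on hcd (hg.intervalIntegrable_of_Icc hcd)
    (hh.intervalIntegrable_of_Icc hcd) hgh

/-- Interpolation between the size of a function and the oscillation of its derivative. -/
lemma abs_deriv_le_of_small {c d δ η ρ : ℝ} {w w' : ℝ → ℝ}
    (hw : ∀ x ∈ Icc c d, HasDerivWithinAt w (w' x) (Icc c d) x) (hρ : 0 < ρ)
    (hρ' : 2 * ρ ≤ d - c) (hδ : ∀ x ∈ Icc c d, |w x| ≤ δ)
    (hη : ∀ x ∈ Icc c d, ∀ y ∈ Icc c d, |x - y| ≤ ρ → |w' x - w' y| ≤ η) :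
    ∀ x ∈ Icc c d, |w' x| ≤ η + 2 * δ / ρ := by
  have key : ∀ x y, x ∈ Icc c d → y ∈ Icc c d → y = x + ρ →
      ∃ ξ ∈ Icc x y, |w' ξ| ≤ 2 * δ / ρ := by
    rintro x y hx hy rfl
    have hss : Icc x (x + ρ) ⊆ Icc c d := Icc_subset_Icc hx.1 hy.2
    obtain ⟨ξ, hξ, h⟩ := exists_hasDerivAt_eq_slope w w' (show x < x + ρ by linarith)
      (fun r hr => (hw r (hss hr)).continuousWithinAt.mono hss)
      (fun r hr => (hw r (hss (Ioo_subset_Icc_self hr))).hasDerivAt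
        (Icc_mem_nhds (hx.1.trans_lt hr.1) (hr.2.trans_le hy.2)))
    refine ⟨ξ, Ioo_subset_Icc_self hξ, ?_⟩
    rw [h, abs_div, add_sub_cancel_left, abs_of_pos hρ]
    have h1 := hδ _ hx
    have h2 := hδ _ hy
    have := (abs_sub (w (x + ρ)) (w x)).trans (add_le_add h2 h1)
    gcongr
    linarith
  intro x hx
  have fin : ∀ ξ ∈ Icc c d, |x - ξ| ≤ ρ → |w' ξ| ≤ 2 * δ / ρ → |w' x| ≤ η + 2 * δ / ρ := by
    intro ξ hξ h1 h2
    have h3 := hη x hx ξ hξ h1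
    have : w' x = (w' x - w' ξ) + w' ξ := by ring
    rw [this]
    exact (abs_add_le _ _).trans (by linarith)
  rcases le_total (x + ρ) d with h | h
  · have hy : x + ρ ∈ Icc c d := ⟨by linarith [hx.1], h⟩
    obtain ⟨ξ, hξ, h1⟩ := key x _ hx hy rfl
    exact fin ξ ⟨hx.1.trans hξ.1, hξ.2.trans hy.2⟩
      (abs_le.2 ⟨by linarith [hξ.2], by linarith [hξ.1]⟩) h1
  · have hy : x - ρ ∈ Icc c d := ⟨by linarith, by linarith [hx.2]⟩
    obtain ⟨ξ, hξ, h1⟩ := key _ x hy hx (by ring)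
    exact fin ξ ⟨hy.1.trans hξ.1, hξ.2.trans hx.2⟩
      (abs_le.2 ⟨by linarith [hξ.2], by linarith [hξ.1]⟩) h1

/-- Differentiation under the integral sign on compact intervals. -/
lemma hasDerivWithinAt_integral_param {T c d : ℝ} {G G' : ℝ → ℝ → ℝ}
    (hG : ContinuousOn (fun y : ℝ × ℝ => G y.1 y.2) (Icc 0 T ×ˢ Icc c d))
    (hG' : ContinuousOn (fun y : ℝ × ℝ => G' y.1 y.2) (Icc 0 T ×ˢ Icc c d))
    (h : ∀ t ∈ Icc 0 T, ∀ x ∈ Icc c d, HasDerivWithinAt (G t) (G' t x) (Icc c d) x)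
    {t x : ℝ} (ht : t ∈ Icc 0 T) (hx : x ∈ Icc c d) :
    HasDerivWithinAt (fun x => ∫ r in (0 : ℝ)..t, G r x) (∫ r in (0 : ℝ)..t, G' r x) (Icc c d) x := by
  have hsl : ∀ {H : ℝ → ℝ → ℝ}, ContinuousOn (fun y : ℝ × ℝ => H y.1 y.2) (Icc 0 T ×ˢ Icc c d) →
      ∀ x ∈ Icc c d, IntervalIntegrable (fun r => H r x) MeasureTheory.volume 0 t := fun hH x hx =>
    ContinuousOn.intervalIntegrable_of_Icc ht.1 (hH.comp (f := fun r => (r, x)) (by fun_prop)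
      fun r hr => ⟨⟨hr.1, hr.2.trans ht.2⟩, hx⟩)
  have huc := (isCompact_Icc.prod isCompact_Icc).uniformContinuousOn_of_continuous hG'
  rw [hasDerivWithinAt_iff_isLittleO, Asymptotics.isLittleO_iff]
  intro ε hε
  obtain ⟨δ, hδ, hu⟩ := Metric.uniformContinuousOn_iff.1 huc (ε / (T + 1))
    (div_pos hε (by linarith [ht.1, ht.2]))
  have hT : 0 < T + 1 := by linarith [ht.1, ht.2]
  filter_upwards [self_mem_nhdsWithin, mem_nhdsWithin_of_mem_nhds (Metric.ball_mem_nhds x hδ)]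
    with y hy hyb
  have hss : uIcc x y ⊆ Icc c d := uIcc_subset_Icc hx hy
  have e : (∫ r in (0 : ℝ)..t, G r y) - (∫ r in (0 : ℝ)..t, G r x) -
      (y - x) • (∫ r in (0 : ℝ)..t, G' r x) = ∫ r in (0 : ℝ)..t, (G r y - G r x - (y - x) * G' r x) := by
    rw [intervalIntegral.integral_sub ((hsl hG y hy).sub (hsl hG x hx)) ((hsl hG' x hx).const_mul _),
      intervalIntegral.integral_sub (hsl hG y hy) (hsl hG x hx),
      intervalIntegral.integral_const_mul, smul_eq_mul]
  rw [e]
  have hb : ∀ r ∈ Icc 0 t, |G r y - G r x - (y - x) * G' r x| ≤ ε / (T + 1) * |y - x| := by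
    intro r hr
    have hr' : r ∈ Icc 0 T := ⟨hr.1, hr.2.trans ht.2⟩
    have := Convex.norm_image_sub_le_of_norm_hasDerivWithin_le
      (f := fun z => G r z - z * G' r x) (f' := fun z => G' r z - G' r x) (C := ε / (T + 1))
      (s := uIcc x y) (x := x) (y := y)
      (fun z hz => by
        simpa using ((h r hr' z (hss hz)).mono hss).fun_sub
          ((hasDerivWithinAt_id z _).mul_const (G' r x)))
      (fun z hz => by
        have hzx : |z - x| ≤ |y - x| := abs_sub_left_of_mem_uIcc hz
        have hd : dist ((r, z) : ℝ × ℝ) (r, x) < δ := by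
          rw [Prod.dist_eq]
          simp only [dist_self, Real.dist_eq]
          exact max_lt hδ (hzx.trans_lt (by simpa [Real.dist_eq] using hyb))
        exact (hu (r, z) ⟨hr', hss hz⟩ (r, x) ⟨hr', hx⟩ hd).le) (convex_uIcc x y)
      left_mem_uIcc right_mem_uIcc
    rw [Real.norm_eq_abs, Real.norm_eq_abs] at this
    calc _ = |G r y - y * G' r x - (G r x - x * G' r x)| := by ring_nf
      _ ≤ _ := this
  have := abs_integral_le ht.1 hb
  rw [Real.norm_eq_abs, Real.norm_eq_abs]
  refine this.trans ?_
  have h1 : ε / (T + 1) * |y - x| * (t - 0) ≤ ε / (T + 1) * |y - x| * (T + 1) := by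
    gcongr; linarith [ht.2]
  refine h1.trans (le_of_eq ?_)
  field_simp

/-- A comparison principle for functions of time. -/
lemma abs_sub_le_of_abs_deriv_le {T : ℝ} {y g y' g' : ℝ → ℝ}
    (hy : ∀ t ∈ Icc 0 T, HasDerivWithinAt y (y' t) (Icc 0 T) t)
    (hg : ∀ t ∈ Icc 0 T, HasDerivWithinAt g (g' t) (Icc 0 T) t)
    (h : ∀ t ∈ Icc 0 T, |y' t| ≤ g' t) {t : ℝ} (ht : t ∈ Icc 0 T) : |y t - y 0| ≤ g t - g 0 := by
  have h0 : (0 : ℝ) ∈ Icc 0 T := ⟨le_rfl, ht.1.trans ht.2⟩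
  have mono : ∀ (z z' : ℝ → ℝ), (∀ t ∈ Icc 0 T, HasDerivWithinAt z (z' t) (Icc 0 T) t) →
      (∀ t ∈ Icc 0 T, 0 ≤ z' t) → z 0 ≤ z t := fun z z' hz hz' =>
    monotoneOn_of_hasDerivWithinAt_nonneg (convex_Icc 0 T)
      (fun r hr => (hz r hr).continuousWithinAt)
      (fun r hr => (hz r (interior_subset hr)).mono interior_subset)
      (fun r hr => hz' r (interior_subset hr)) h0 ht ht.1
  have h1 := mono _ _ (fun t ht => (hg t ht).fun_sub (hy t ht)) fun t ht => by
    linarith [le_abs_self (y' t), h t ht]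
  have h2 := mono _ _ (fun t ht => (hg t ht).fun_add (hy t ht)) fun t ht => by
    linarith [neg_abs_le (y' t), h t ht]
  exact abs_le.2 ⟨by linarith, by linarith⟩

/-! ### Jets of functions and the energy -/

/-- A sequence of functions each of which is the derivative of the previous one. -/
def IsJet (a : ℝ) (U : ℕ → ℝ → ℝ) : Prop :=
  ∀ j, ∀ x ∈ Icc 1 a, HasDerivWithinAt (U j) (U (j + 1) x) (Icc 1 a) x

/-- An inner product equivalent to the one of the Sobolev space of order `k`. -/
noncomputable def pairing (k : ℕ) (a : ℝ) (U W : ℕ → ℝ → ℝ) : ℝ :=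
  ∑ j ∈ Finset.range k, U j 1 * W j 1 + ∫ x in (1 : ℝ)..a, U k x * W k x

/-- The jet of the right-hand side of the flow. -/
noncomputable def FJ (s : ℕ → ℝ → ℝ) (ν : ℝ) (U : ℕ → ℝ → ℝ) (j : ℕ) (x : ℝ) : ℝ :=
  jev s (jD^[j] (jF ν)) x fun i => U i x

lemma IsJet.cont {a : ℝ} {U : ℕ → ℝ → ℝ} (h : IsJet a U) (j : ℕ) :
    ContinuousOn (U j) (Icc 1 a) := fun x hx => (h j x hx).continuousWithinAt

lemma isJet_FJ {a ν : ℝ} {s U : ℕ → ℝ → ℝ} (hc : Coef a ν s) (h : IsJet a U) :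
    IsJet a (FJ s ν U) := fun j x hx => by
  have := jev_hasDerivWithinAt hc (jDF_mem ν j) hx (z := U) fun i _ => h i x hx
  rwa [← Function.iterate_succ_apply' jD j (jF ν)] at this

lemma pairing_sq_le {k : ℕ} {a R : ℝ} {U : ℕ → ℝ → ℝ} (ha : 1 < a) (hE : pairing k a U U ≤ R) :
    (∀ j < k, U j 1 ^ 2 ≤ R) ∧ ∫ x in (1 : ℝ)..a, U k x ^ 2 ≤ R := by
  have h1 : 0 ≤ ∫ x in (1 : ℝ)..a, U k x ^ 2 :=
    intervalIntegral.integral_nonneg ha.le fun x _ => sq_nonneg _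
  have h2 : ∀ j ∈ Finset.range k, 0 ≤ U j 1 ^ 2 := fun j _ => sq_nonneg _
  have h3 := Finset.sum_nonneg h2
  simp only [pairing, ← pow_two] at hE
  refine ⟨fun j hj => ?_, by linarith⟩
  have := Finset.single_le_sum h2 (Finset.mem_range.2 hj)
  linarith

lemma pairing_self_nonneg (k : ℕ) {a : ℝ} (U : ℕ → ℝ → ℝ) (ha : 1 < a) : 0 ≤ pairing k a U U :=
  add_nonneg (Finset.sum_nonneg fun _ _ => mul_self_nonneg _)
    (intervalIntegral.integral_nonneg ha.le fun _ _ => mul_self_nonneg _)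

lemma jet_top_modulus {k : ℕ} {a R ε : ℝ} {U : ℕ → ℝ → ℝ} (ha : 1 < a) (hU : IsJet a U)
    (hE : pairing (k + 1) a U U ≤ R) (hε : 0 < ε) {x y : ℝ} (hx : x ∈ Icc 1 a) (hy : y ∈ Icc 1 a)
    (hxy : x ≤ y) : |U k y - U k x| ≤ (y - x) / (2 * ε) + ε / 2 * R := by
  rw [← integral_eq_sub_of_within (hU k) (hU.cont _) hx hy hxy]
  have hss : Icc x y ⊆ Icc 1 a := Icc_subset_Icc hx.1 hy.2
  have hcont : ContinuousOn (U (k + 1)) (Icc x y) := (hU.cont _).mono hss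
  have h1 : ∀ r, |U (k + 1) r| ≤ 1 / (2 * ε) + ε / 2 * U (k + 1) r ^ 2 := fun r => by
    rw [← sq_abs (U (k + 1) r)]
    have : 0 ≤ (1 - ε * |U (k + 1) r|) ^ 2 / (2 * ε) := by positivity
    have e : (1 - ε * |U (k + 1) r|) ^ 2 / (2 * ε) =
      1 / (2 * ε) + ε / 2 * |U (k + 1) r| ^ 2 - |U (k + 1) r| := by field_simp; ring
    linarith
  have hint : IntervalIntegrable (fun r => U (k + 1) r ^ 2) MeasureTheory.volume x y :=
    (hcont.pow 2).intervalIntegrable_of_Icc hxy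
  calc |∫ r in x..y, U (k + 1) r| ≤ ∫ r in x..y, |U (k + 1) r| :=
        intervalIntegral.abs_integral_le_integral_abs hxy
    _ ≤ ∫ r in x..y, (1 / (2 * ε) + ε / 2 * U (k + 1) r ^ 2) :=
        integral_mono_Icc hxy hcont.abs (continuousOn_const.add ((hcont.pow 2).const_mul _))
          fun r _ => h1 r
    _ = (y - x) / (2 * ε) + ε / 2 * ∫ r in x..y, U (k + 1) r ^ 2 := by
        rw [intervalIntegral.integral_add intervalIntegrable_const (hint.const_mul _),
          intervalIntegral.integral_const, intervalIntegral.integral_const_mul, smul_eq_mul,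
          mul_one_div]
    _ ≤ _ := by
        have h2 : ∫ r in x..y, U (k + 1) r ^ 2 ≤ ∫ r in (1 : ℝ)..a, U (k + 1) r ^ 2 :=
          intervalIntegral.integral_mono_interval hx.1 hxy hy.2
            (Filter.Eventually.of_forall fun r => sq_nonneg _)
            (((hU.cont _).pow 2).intervalIntegrable_of_Icc ha.le)
        have := (pairing_sq_le ha hE).2
        gcongr
        linarith

lemma jet_bound {k : ℕ} {a R : ℝ} {U : ℕ → ℝ → ℝ} (ha : 1 < a) (hU : IsJet a U)
    (hE : pairing k a U U ≤ R) : ∀ j < k, ∀ x ∈ Icc 1 a, |U j x| ≤ (2 * R + a) * a ^ k := by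
  have hR : 0 ≤ R := (pairing_self_nonneg k U ha).trans hE
  have h1 : (1 : ℝ) ∈ Icc 1 a := ⟨le_rfl, ha.le⟩
  have hz : ∀ j < k, |U j 1| ≤ 1 + R := fun j hj => by
    have := (pairing_sq_le ha hE).1 j hj
    rw [← sq_abs] at this
    nlinarith [sq_nonneg (|U j 1| - 1), abs_nonneg (U j 1)]
  have key : ∀ m j, j + 1 + m = k → ∀ x ∈ Icc 1 a, |U j x| ≤ (2 * R + a) * a ^ m := by
    intro m
    induction m with
    | zero =>
      rintro j rfl x hx
      have h2 := jet_top_modulus ha hU hE one_pos h1 hx hx.1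
      have h3 := hz j (by omega)
      have : |U j x| ≤ |U j x - U j 1| + |U j 1| := by
        simpa using abs_add_le (U j x - U j 1) (U j 1)
      have := hx.2
      rw [pow_zero]
      linarith
    | succ m ih =>
      intro j hj x hx
      have h2 := ih (j + 1) (by omega)
      have h3 := hz j (by omega)
      have h4 := Convex.norm_image_sub_le_of_norm_hasDerivWithin_le (f := U j) (hU j)
        (fun y hy => h2 y hy) (convex_Icc 1 a) h1 hx
      rw [Real.norm_eq_abs, Real.norm_eq_abs, abs_of_nonneg (sub_nonneg.2 hx.1)] at h4
      have : |U j x| ≤ |U j x - U j 1| + |U j 1| := by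
        simpa using abs_add_le (U j x - U j 1) (U j 1)
      have hp : 1 ≤ a ^ m := one_le_pow₀ ha.le
      have h5 : (2 * R + a) * a ^ m * (x - 1) ≤ (2 * R + a) * a ^ m * (a - 1) := by
        have := hx.2
        gcongr
      have h6 : 2 * R + a ≤ (2 * R + a) * a ^ m := le_mul_of_one_le_right (by linarith) hp
      rw [pow_succ]
      nlinarith
  intro j hj x hx
  refine (key (k - (j + 1)) j (by omega) x hx).trans ?_
  gcongr
  · exact ha.le
  · omega

lemma jet_modulus {k : ℕ} {a R η : ℝ} (ha : 1 < a) (hR : 0 ≤ R) (hη : 0 < η) :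
    ∃ ρ > 0, ∀ U : ℕ → ℝ → ℝ, IsJet a U → pairing k a U U ≤ R → ∀ j < k,
      ∀ x ∈ Icc 1 a, ∀ y ∈ Icc 1 a, |x - y| ≤ ρ → |U j x - U j y| ≤ η := by
  set S := (2 * R + a) * a ^ k with hS
  have hS0 : 0 ≤ S := by positivity
  set ε := η / (R + 1) with hε
  have hε0 : 0 < ε := by positivity
  refine ⟨min (ε * η) (η / (S + 1)), by positivity, fun U hU hE j hj => ?_⟩
  have key : ∀ x ∈ Icc 1 a, ∀ y ∈ Icc 1 a, x ≤ y → y - x ≤ min (ε * η) (η / (S + 1)) →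
      |U j y - U j x| ≤ η := by
    intro x hx y hy hxy hd
    rcases lt_or_ge (j + 1) k with h | h
    · have h4 := Convex.norm_image_sub_le_of_norm_hasDerivWithin_le (f := U j) (hU j)
        (fun y hy => jet_bound ha hU hE (j + 1) h y hy) (convex_Icc 1 a) hx hy
      rw [Real.norm_eq_abs, Real.norm_eq_abs, abs_of_nonneg (sub_nonneg.2 hxy)] at h4
      refine h4.trans ?_
      have h5 := hd.trans (min_le_right _ _)
      rw [le_div_iff₀ (by positivity)] at h5
      nlinarith
    · obtain rfl : k = j + 1 := by omega
      have h4 := jet_top_modulus ha hU hE hε0 hx hy hxy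
      have h5 := hd.trans (min_le_left _ _)
      have h6 : (y - x) / (2 * ε) ≤ η / 2 := by
        rw [div_le_div_iff₀ (by positivity) two_pos]; linarith
      have h7 : ε / 2 * R ≤ η / 2 := by
        have : ε * (R + 1) = η := by rw [hε]; field_simp
        nlinarith
      linarith
  intro x hx y hy hd
  rcases le_total x y with h | h
  · rw [abs_sub_comm]; exact key x hx y hy h (by rw [abs_sub_comm] at hd; exact (le_abs_self _).trans hd)
  · exact key y hy x hx h ((le_abs_self _).trans hd)

/-! ### The energy estimate -/

/-- The dissipation of the energy. -/
noncomputable def diss (s : ℕ → ℝ → ℝ) (k : ℕ) (a : ℝ) (U : ℕ → ℝ → ℝ) : ℝ :=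
  ∫ x in (1 : ℝ)..a, s 0 x * (1 / (1 + U 1 x ^ 2)) * U (k + 1) x ^ 2

lemma jet_top_sq {k : ℕ} {a : ℝ} {U : ℕ → ℝ → ℝ} (ha : 1 < a) (hU : IsJet a U) {x : ℝ}
    (hx : x ∈ Icc 1 a) : U k x ^ 2 ≤ (1 + a) ^ 2 * (1 + pairing (k + 1) a U U) := by
  set E := pairing (k + 1) a U U with hE
  have hE0 : 0 ≤ E := pairing_self_nonneg _ U ha
  set r := √(1 + E) with hr
  have hr2 : r ^ 2 = 1 + E := Real.sq_sqrt (by linarith)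
  have hr0 : 0 < r := Real.sqrt_pos.2 (by linarith)
  have h1 : (1 : ℝ) ∈ Icc 1 a := ⟨le_rfl, ha.le⟩
  have h2 := jet_top_modulus ha hU hE.ge (ε := 1 / r) (by positivity) h1 hx hx.1
  have h3 : |U k 1| ≤ r := abs_le_of_sq_le_sq
    (by linarith [(pairing_sq_le ha hE.ge).1 k (by omega)]) hr0.le
  have h4 : (x - 1) / (2 * (1 / r)) = (x - 1) / 2 * r := by field_simp
  have h5 : 1 / r / 2 * E ≤ r / 2 := by
    rw [div_div, one_div_mul_eq_div, div_le_iff₀ (by positivity)]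
    nlinarith
  have h6 : |U k x| ≤ |U k x - U k 1| + |U k 1| := by
    simpa using abs_add_le (U k x - U k 1) (U k 1)
  have h7 : (x - 1) / 2 * r ≤ (a - 1) / 2 * r := by
    have := hx.2
    gcongr
  have h8 : |U k x| ≤ (1 + a) * r := by nlinarith
  rw [← hr2, ← mul_pow, ← sq_abs]
  gcongr

lemma quad_bound {K₁ K₂ K₃ K₄ α β γ δ x y Y : ℝ} (h1 : |α| ≤ K₁) (h2 : |β| ≤ K₂) (h3 : |γ| ≤ K₃)
    (h4 : |δ| ≤ K₄) (hy : y ^ 2 ≤ Y) :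
    -(1 / 2) * α * x ^ 2 + β * x ^ 2 + γ * (x * y) + δ * x ≤
      (K₁ + K₂ + K₃ + K₄) * (1 + Y) + (K₁ + K₂ + K₃ + K₄) * x ^ 2 := by
  have q : ∀ c C y w : ℝ, |c| ≤ C → |y| ≤ w → c * y ≤ C * w := fun c C y w h h' => by
    refine (le_abs_self _).trans ?_
    rw [abs_mul]
    exact mul_le_mul h h' (abs_nonneg _) ((abs_nonneg _).trans h)
  have hx := sq_nonneg x
  have hy0 := sq_nonneg y
  have n1 : |(-(1 / 2) * x ^ 2)| ≤ 1 + Y + x ^ 2 := by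
    rw [abs_le]; constructor <;> linarith
  have n2 : |x ^ 2| ≤ 1 + Y + x ^ 2 := by
    rw [abs_le]; constructor <;> linarith
  have n3 : |x * y| ≤ 1 + Y + x ^ 2 := by
    rw [abs_le]; constructor <;> nlinarith [sq_nonneg (x + y), sq_nonneg (x - y)]
  have n4 : |x| ≤ 1 + Y + x ^ 2 := by
    rw [abs_le]; constructor <;> nlinarith [sq_nonneg (x + 1), sq_nonneg (x - 1)]
  have m1 := q _ _ _ _ h1 n1
  have m2 := q _ _ _ _ h2 n2
  have m3 := q _ _ _ _ h3 n3
  have m4 := q _ _ _ _ h4 n4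
  linarith

section
variable {a ν : ℝ} {s : ℕ → ℝ → ℝ} (hc : Coef a ν s)
include hc

lemma abs_FJ_left_le {k : ℕ} (hk : 6 ≤ k) (M : ℝ) (hM : 0 ≤ M) {j : ℕ} (hj : j + 1 < k) :
    ∃ K, 0 ≤ K ∧ ∀ U : ℕ → ℝ → ℝ, (∀ i ≤ k - 2, |U i 1| ≤ M) →
      |FJ s ν U j 1| ≤ K * (1 + |U (k - 1) 1|) := by
  rcases le_or_gt (j + 2) (k - 2) with h | h
  · obtain ⟨K, hK, hb⟩ := jev_bound hc (jS_mono h (jDF_mem ν j)) M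
    refine ⟨K, hK, fun U hU => (hb 1 hc.left_mem (fun i => U i 1) hU).trans ?_⟩
    exact le_mul_of_one_le_right hK (by linarith [abs_nonneg (U (k - 1) 1)])
  · obtain ⟨K₁, hK₁, hb₁⟩ := jev_bound hc (jS_mono (by omega : 2 ≤ k - 2) (jB_coeff_mem ν j)) M
    obtain ⟨K₂, hK₂, hb₂⟩ := jev_bound hc
      (jS_mono (by omega : j ≤ k - 2) (jR_mem ν (by omega : 2 ≤ j))) M
    refine ⟨K₁ * (1 + M) + K₂, by positivity, fun U hU => ?_⟩
    have h1 := hb₁ 1 hc.left_mem (fun i => U i 1) hU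
    have h2 := hb₂ 1 hc.left_mem (fun i => U i 1) hU
    have h3 : |U (j + 1) 1| ≤ M + |U (k - 1) 1| := by
      rcases le_or_gt (j + 1) (k - 2) with h' | h'
      · linarith [hU _ h', abs_nonneg (U (k - 1) 1)]
      · rw [show j + 1 = k - 1 by omega]; linarith
    rw [FJ, jDF_eq]
    rw [jev_add, jev_add, jev_mul, jev_mul, jev_mul, jev_sg, hc.left, zero_mul, zero_mul,
      zero_add, jev_u]
    refine (abs_add_le _ _).trans ?_
    rw [abs_mul]
    have h4 : |jev s (jC ↑j * jX (JVar.sg 1) * jX JVar.p + jX (JVar.sg 0) * jB ν j) 1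
        fun i => U i 1| * |U (j + 1) 1| ≤ K₁ * (M + |U (k - 1) 1|) := by gcongr
    have := abs_nonneg (U (k - 1) 1)
    have h5 : 0 ≤ K₁ * M * |U (k - 1) 1| := by positivity
    have h6 : 0 ≤ K₂ * |U (k - 1) 1| := by positivity
    nlinarith

lemma FJ_left_top_le {k : ℕ} (hk : 6 ≤ k) (M : ℝ) :
    ∃ K, 0 ≤ K ∧ ∀ U : ℕ → ℝ → ℝ, (∀ i ≤ k - 2, |U i 1| ≤ M) →
      FJ s ν U (k - 1) 1 * U (k - 1) 1 ≤
        1 / 2 * (((k : ℝ) - 1) * s 1 1 * (1 / (1 + U 1 1 ^ 2))) * U k 1 ^ 2 +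
          K * (1 + U (k - 1) 1 ^ 2) := by
  obtain ⟨A, hA, B, hB, hAB⟩ := jR_affine ν (by omega : 4 ≤ k - 1)
  obtain ⟨K₁, hK₁, hb₁⟩ := jev_bound hc (jS_mono (by omega : 3 ≤ k - 2) hA) M
  obtain ⟨K₂, hK₂, hb₂⟩ := jev_bound hc (jS_mono (by omega : k - 1 - 1 ≤ k - 2) hB) M
  have hs := hc.deriv_left
  refine ⟨K₁ + K₂ + k * s 1 1, by positivity, fun U hU => ?_⟩
  have h1 := hb₁ 1 hc.left_mem (fun i => U i 1) hU
  have h2 := hb₂ 1 hc.left_mem (fun i => U i 1) hU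
  have hk1 : ((k - 1 : ℕ) : ℝ) = k - 1 := by rw [Nat.cast_sub (by omega)]; simp
  rw [FJ, jDF_eq, hAB]
  simp only [jev_add, jev_mul, jev_sg, hc.left, zero_mul, zero_add, add_zero, jev_C, jev_p, jev_u,
    hk1, show k - 1 + 1 = k by omega]
  set α := jev s A 1 fun i => U i 1
  set β := jev s B 1 fun i => U i 1
  set p := 1 / (1 + U 1 1 ^ 2) with hp
  have hp0 : 0 ≤ p := by positivity
  have hp1 : p ≤ 1 := by
    rw [hp, div_le_one (by positivity)]; nlinarith [sq_nonneg (U 1 1)]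
  have hk0 : (6 : ℝ) ≤ k := by exact_mod_cast hk
  have hθ0 : 0 ≤ ((k : ℝ) - 1) * s 1 1 * p := by
    have : (0 : ℝ) ≤ k - 1 := by linarith
    positivity
  have hθ : ((k : ℝ) - 1) * s 1 1 * p ≤ k * s 1 1 := by
    have : ((k : ℝ) - 1) * s 1 1 * p ≤ ((k : ℝ) - 1) * s 1 1 * 1 := by
      have : (0 : ℝ) ≤ k - 1 := by linarith
      gcongr
    nlinarith
  set θ := ((k : ℝ) - 1) * s 1 1 * p
  set y := U (k - 1) 1
  have e1 : θ * U k 1 * y ≤ 1 / 2 * θ * U k 1 ^ 2 + 1 / 2 * θ * y ^ 2 := by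
    nlinarith [mul_nonneg hθ0 (sq_nonneg (U k 1 - y))]
  have e2 : α * y * y ≤ K₁ * y ^ 2 := by
    nlinarith [mul_le_mul_of_nonneg_right ((le_abs_self _).trans h1) (sq_nonneg y)]
  have e3 : β * y ≤ K₂ * (1 + y ^ 2) := by
    have h3 : β * y ≤ |β| * |y| := by rw [← abs_mul]; exact le_abs_self _
    have h4 : |y| ≤ 1 + y ^ 2 := by
      rw [← sq_abs]; nlinarith [sq_nonneg (|y| - 1), abs_nonneg y]
    have h5 : |β| * |y| ≤ K₂ * (1 + y ^ 2) := by gcongr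
    linarith
  have e4 : 0 ≤ (k * s 1 1) * 1 := by positivity
  have e5 := mul_le_mul_of_nonneg_right hθ (sq_nonneg y)
  nlinarith [sq_nonneg y, mul_nonneg hθ0 (sq_nonneg y)]


lemma integral_FJ_top_le {k : ℕ} (hk : 6 ≤ k) (M : ℝ) :
    ∃ K, 0 ≤ K ∧ ∀ U : ℕ → ℝ → ℝ, IsJet a U → (∀ i ≤ k - 2, ∀ x ∈ Icc 1 a, |U i x| ≤ M) →
      ∫ x in (1 : ℝ)..a, FJ s ν U k x * U k x ≤
        -(1 / 2 * (((k : ℝ) - 1) * s 1 1 * (1 / (1 + U 1 1 ^ 2))) * U k 1 ^ 2) - diss s k a U +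
          K * (1 + pairing k a U U) := by
  set P2 : JP := jX (.sg 0) * jX .p with hP2
  set bt : JP := jC (k : ℝ) * jX (.sg 1) * jX .p + jX (.sg 0) * jB ν k - jD P2 with hbt
  have hP2m : P2 ∈ jS 1 := mul_mem (sg_mem_jS _ _) (p_mem_jS le_rfl)
  have hbtm : bt ∈ jS 2 := sub_mem (jB_coeff_mem ν k) (jD_mem hP2m)
  obtain ⟨A, hA, B, hB, G, hG, hR⟩ := jR_affine_two ν hk
  obtain ⟨K₁, hK₁, hb₁⟩ := jev_bound hc (jS_mono (by omega : 3 ≤ k - 2) (jD_mem hbtm)) M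
  obtain ⟨K₂, hK₂, hb₂⟩ := jev_bound hc (jS_mono (by omega : 3 ≤ k - 2) hA) M
  obtain ⟨K₃, hK₃, hb₃⟩ := jev_bound hc hB M
  obtain ⟨K₄, hK₄, hb₄⟩ := jev_bound hc hG M
  set K := K₁ + K₂ + K₃ + K₄ with hK
  have hK0 : 0 ≤ K := by positivity
  have ha := hc.one_lt
  have ha1 : 0 ≤ a - 1 := by linarith
  refine ⟨K * (1 + (1 + a) ^ 2) * (a - 1) + K, by positivity, fun U hU hM => ?_⟩
  set E := pairing k a U U with hE
  have hE0 : 0 ≤ E := pairing_self_nonneg _ U ha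
  have hI : ∫ x in (1 : ℝ)..a, U k x ^ 2 ≤ E := (pairing_sq_le ha hE.ge).2
  set e : JP → ℝ → ℝ := fun r x => jev s r x fun i => U i x with he
  set Ψ : ℝ → ℝ := fun x => e P2 x * (U k x * U (k + 1) x) + 1 / 2 * (e bt x * (U k x * U k x))
    with hΨ
  set Ψ' : ℝ → ℝ := fun x => e (jD P2) x * (U k x * U (k + 1) x) +
    e P2 x * (U (k + 1) x * U (k + 1) x + U k x * U (k + 2) x) +
    1 / 2 * (e (jD bt) x * (U k x * U k x) + e bt x * (2 * (U k x * U (k + 1) x))) with hΨ'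
  have hd : ∀ {m r}, r ∈ jS m → ∀ x ∈ Icc 1 a, HasDerivWithinAt (e r) (e (jD r) x) (Icc 1 a) x :=
    fun hr x hx => jev_hasDerivWithinAt hc hr hx fun i _ => hU i x hx
  have hcont : ∀ {m r}, r ∈ jS m → ContinuousOn (e r) (Icc 1 a) :=
    fun hr x hx => (hd hr x hx).continuousWithinAt
  have hΨd : ∀ x ∈ Icc 1 a, HasDerivWithinAt Ψ (Ψ' x) (Icc 1 a) x := fun x hx => by
    have h1 := (hd hP2m x hx).fun_mul ((hU k x hx).fun_mul (hU (k + 1) x hx))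
    have h2 := ((hd hbtm x hx).fun_mul ((hU k x hx).fun_mul (hU k x hx))).const_mul (1 / 2)
    exact (h1.fun_add h2).congr_deriv (by simp only [hΨ']; ring)
  have c1 := hU.cont k
  have c2 := hU.cont (k + 1)
  have c3 := hU.cont (k + 2)
  have c4 := hcont hP2m
  have c5 := hcont hbtm
  have c6 := hcont (jD_mem hP2m)
  have c7 := hcont (jD_mem hbtm)
  have hΨc : ContinuousOn Ψ' (Icc 1 a) := by
    simp only [hΨ']
    exact ((c6.mul (c1.mul c2)).add (c4.mul ((c2.mul c2).add (c1.mul c3)))).add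
      (continuousOn_const.mul ((c7.mul (c1.mul c1)).add (c5.mul (continuousOn_const.mul (c1.mul c2)))))
  have hpt : ∀ x ∈ Icc 1 a, FJ s ν U k x * U k x ≤
      Ψ' x - s 0 x * (1 / (1 + U 1 x ^ 2)) * U (k + 1) x ^ 2 +
        (K * (1 + (1 + a) ^ 2 * (1 + E)) + K * U k x ^ 2) := by
    intro x hx
    have hM' : ∀ j ≤ k - 2, |U j x| ≤ M := fun j hj => hM j hj x hx
    have h1 : |e (jD bt) x| ≤ K₁ := hb₁ x hx (fun i => U i x) hM'
    have h2 : |e A x| ≤ K₂ := hb₂ x hx (fun i => U i x) hM'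
    have h3 : |e B x| ≤ K₃ := hb₃ x hx (fun i => U i x) hM'
    have h4 : |e G x| ≤ K₄ := hb₄ x hx (fun i => U i x) hM'
    have h5 : U (k - 1) x ^ 2 ≤ (1 + a) ^ 2 * (1 + E) := by
      have := jet_top_sq (k := k - 1) ha hU hx
      rwa [show k - 1 + 1 = k by omega] at this
    have e0 : FJ s ν U k x * U k x = Ψ' x - s 0 x * (1 / (1 + U 1 x ^ 2)) * U (k + 1) x ^ 2 +
        (-(1 / 2) * e (jD bt) x * U k x ^ 2 + e A x * U k x ^ 2 + e B x * (U k x * U (k - 1) x) +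
          e G x * U k x) := by
      simp only [FJ, jDF_eq, hR, hΨ', he, hbt, hP2, jev_add, jev_sub, jev_mul, jev_u, jev_p, jev_sg]
      ring
    have m := quad_bound h1 h2 h3 h4 h5 (x := U k x)
    rw [e0]
    linarith
  have c8 : ContinuousOn (fun x => s 0 x * (1 / (1 + U 1 x ^ 2)) * U (k + 1) x ^ 2) (Icc 1 a) := by
    refine (c4.congr fun x _ => ?_).mul (c2.pow 2)
    simp [he, hP2]
  have c9 : ContinuousOn (fun x => K * (1 + (1 + a) ^ 2 * (1 + E)) + K * U k x ^ 2) (Icc 1 a) :=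
    continuousOn_const.add (continuousOn_const.mul (c1.pow 2))
  have cF : ContinuousOn (fun x => FJ s ν U k x * U k x) (Icc 1 a) :=
    ((isJet_FJ hc hU).cont k).mul c1
  have i1 := hΨc.intervalIntegrable_of_Icc (μ := MeasureTheory.volume) ha.le
  have i2 := c8.intervalIntegrable_of_Icc (μ := MeasureTheory.volume) ha.le
  have i3 := c9.intervalIntegrable_of_Icc (μ := MeasureTheory.volume) ha.le
  have i4 := (c1.fun_pow 2).intervalIntegrable_of_Icc (μ := MeasureTheory.volume) ha.le
  have h := integral_mono_Icc ha.le cF ((hΨc.fun_sub c8).fun_add c9) hpt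
  rw [intervalIntegral.integral_add (i1.sub i2) i3, intervalIntegral.integral_sub i1 i2,
    integral_eq_sub_of_within hΨd hΨc hc.left_mem hc.right_mem ha.le,
    intervalIntegral.integral_add intervalIntegrable_const (i4.const_mul _),
    intervalIntegral.integral_const, intervalIntegral.integral_const_mul, smul_eq_mul] at h
  have hΨa : Ψ a ≤ 0 := by
    have : Ψ a = ((k : ℝ) - 1) * (1 / (1 + U 1 a ^ 2)) * (1 / 2 * U k a ^ 2) * s 1 a := by
      simp only [hΨ, he, hbt, hP2, jev_add, jev_sub, jev_mul, jev_p, jev_sg, jev_C, jD_mul, jD_sg,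
        hc.right]
      ring
    rw [this]
    have hk0 : (6 : ℝ) ≤ k := by exact_mod_cast hk
    have : (0 : ℝ) ≤ k - 1 := by linarith
    exact mul_nonpos_of_nonneg_of_nonpos (by positivity) hc.deriv_right
  have hΨ1 : Ψ 1 = 1 / 2 * (((k : ℝ) - 1) * s 1 1 * (1 / (1 + U 1 1 ^ 2))) * U k 1 ^ 2 := by
    simp only [hΨ, he, hbt, hP2, jev_add, jev_sub, jev_mul, jev_p, jev_sg, jev_C, jD_mul, jD_sg,
      hc.left]
    ring
  have hm : K * ∫ x in (1 : ℝ)..a, U k x ^ 2 ≤ K * E := by gcongr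
  have hm2 : 0 ≤ K * (a - 1) * E := by positivity
  rw [diss, ← hΨ1]
  nlinarith

/-- The energy estimate. -/
lemma pairing_FJ_le {k : ℕ} (hk : 6 ≤ k) (M : ℝ) (hM : 0 ≤ M) :
    ∃ K, 0 ≤ K ∧ ∀ U : ℕ → ℝ → ℝ, IsJet a U → (∀ i ≤ k - 2, ∀ x ∈ Icc 1 a, |U i x| ≤ M) →
      pairing k a (FJ s ν U) U ≤ -diss s k a U + K * (1 + pairing k a U U) := by
  obtain ⟨K₀, hK₀, hb₀⟩ := integral_FJ_top_le hc hk M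
  obtain ⟨K₁, hK₁, hb₁⟩ := FJ_left_top_le hc hk M
  have : ∀ j, ∃ K, 0 ≤ K ∧ (j + 1 < k → ∀ U : ℕ → ℝ → ℝ, (∀ i ≤ k - 2, |U i 1| ≤ M) →
      |FJ s ν U j 1| ≤ K * (1 + |U (k - 1) 1|)) := fun j => by
    by_cases hj : j + 1 < k
    · obtain ⟨K, hK, h⟩ := abs_FJ_left_le hc hk M hM hj
      exact ⟨K, hK, fun _ => h⟩
    · exact ⟨0, le_rfl, fun h => absurd h hj⟩
  choose L hL hbL using this
  have hL0 := Finset.sum_nonneg fun j (_ : j ∈ Finset.range (k - 1)) => hL j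
  refine ⟨K₀ + K₁ + 2 * ∑ j ∈ Finset.range (k - 1), L j, by positivity, fun U hU hUM => ?_⟩
  have h1 := hb₀ U hU hUM
  have hUM1 : ∀ i ≤ k - 2, |U i 1| ≤ M := fun i hi => hUM i hi 1 hc.left_mem
  have h2 := hb₁ U hUM1
  set E := pairing k a U U with hE
  have hE0 : 0 ≤ E := pairing_self_nonneg _ U hc.one_lt
  have hsq := (pairing_sq_le hc.one_lt hE.ge).1
  have h3 : ∑ j ∈ Finset.range (k - 1), FJ s ν U j 1 * U j 1 ≤
      ∑ j ∈ Finset.range (k - 1), L j * (2 * (1 + E)) := by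
    refine Finset.sum_le_sum fun j hj => ?_
    have hj' : j + 1 < k := by have := Finset.mem_range.1 hj; omega
    have h4 := hbL j hj' U hUM1
    have h5 : (1 + |U (k - 1) 1|) * |U j 1| ≤ 2 * (1 + E) := by
      have e1 := hsq j (by omega)
      have e2 := hsq (k - 1) (by omega)
      rw [← sq_abs] at e1 e2
      nlinarith [sq_nonneg (|U j 1| - 1), sq_nonneg (|U j 1| - |U (k - 1) 1|)]
    calc FJ s ν U j 1 * U j 1 ≤ |FJ s ν U j 1| * |U j 1| := by
          rw [← abs_mul]; exact le_abs_self _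
      _ ≤ L j * (1 + |U (k - 1) 1|) * |U j 1| := by gcongr
      _ ≤ L j * (2 * (1 + E)) := by rw [mul_assoc]; exact mul_le_mul_of_nonneg_left h5 (hL j)
  rw [← Finset.sum_mul] at h3
  have h6 : K₁ * (1 + U (k - 1) 1 ^ 2) ≤ K₁ * (1 + E) := by
    have := hsq (k - 1) (by omega)
    gcongr
  have h7 : pairing k a (FJ s ν U) U = ∑ j ∈ Finset.range (k - 1), FJ s ν U j 1 * U j 1 +
      FJ s ν U (k - 1) 1 * U (k - 1) 1 + ∫ x in (1 : ℝ)..a, FJ s ν U k x * U k x := by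
    rw [pairing, ← Finset.sum_range_succ, show k - 1 + 1 = k by omega]
  rw [h7]
  linarith

lemma pairing_FJ_le_of_energy {k : ℕ} (hk : 6 ≤ k) (R : ℝ) (hR : 0 ≤ R) :
    ∃ K, 0 ≤ K ∧ ∀ U : ℕ → ℝ → ℝ, IsJet a U → pairing k a U U ≤ R →
      pairing k a (FJ s ν U) U ≤ -diss s k a U + K := by
  have ha := hc.one_lt
  obtain ⟨K, hK, h⟩ := pairing_FJ_le hc hk ((2 * R + a) * a ^ k) (by positivity)
  refine ⟨K * (1 + R), by positivity, fun U hU hE => (h U hU fun i hi x hx =>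
    jet_bound ha hU hE i (by omega) x hx).trans ?_⟩
  gcongr

lemma diss_nonneg (k : ℕ) (U : ℕ → ℝ → ℝ) : 0 ≤ diss s k a U :=
  intervalIntegral.integral_nonneg hc.one_lt.le fun x hx =>
    mul_nonneg (mul_nonneg (hc.nonneg x hx) (by positivity)) (sq_nonneg _)

lemma integral_abs_FJ_le {k : ℕ} (hk : 6 ≤ k) (R : ℝ) :
    ∃ K, 0 ≤ K ∧ ∀ U : ℕ → ℝ → ℝ, IsJet a U → pairing k a U U ≤ R →
      ∫ x in (1 : ℝ)..a, |FJ s ν U (k - 1) x| ≤ diss s k a U + K := by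
  have ha := hc.one_lt
  have ha1 : 0 ≤ a - 1 := by linarith
  rcases lt_or_ge R 0 with hR | hR
  · exact ⟨0, le_rfl, fun U hU hE => absurd ((pairing_self_nonneg k U ha).trans hE) (not_le.2 hR)⟩
  set M := (2 * R + a) * a ^ k with hM
  have hP : jX (.sg 0) * jX .p ∈ jS (k - 1) := mul_mem (sg_mem_jS _ _) (p_mem_jS (by omega))
  obtain ⟨K₁, hK₁, hb₁⟩ := jev_bound hc hP M
  obtain ⟨K₂, hK₂, hb₂⟩ := jev_bound hc
    (jS_mono (by omega : 2 ≤ k - 1) (jB_coeff_mem ν (k - 1))) M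
  obtain ⟨K₃, hK₃, hb₃⟩ := jev_bound hc (jR_mem ν (by omega : 2 ≤ k - 1)) M
  refine ⟨(K₁ + K₂ + K₃) * (a - 1) + K₂ * R, by positivity, fun U hU hE => ?_⟩
  have hpt : ∀ x ∈ Icc 1 a, |FJ s ν U (k - 1) x| ≤
      s 0 x * (1 / (1 + U 1 x ^ 2)) * U (k + 1) x ^ 2 + ((K₁ + K₂ + K₃) + K₂ * U k x ^ 2) := by
    intro x hx
    have hM' : ∀ j ≤ k - 1, |U j x| ≤ M := fun j hj => jet_bound ha hU hE j (by omega) x hx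
    have h1 := hb₁ x hx (fun i => U i x) hM'
    have h2 := hb₂ x hx (fun i => U i x) hM'
    have h3 := hb₃ x hx (fun i => U i x) hM'
    rw [FJ, jDF_eq, show k - 1 + 2 = k + 1 by omega, show k - 1 + 1 = k by omega]
    rw [jev_add, jev_add, jev_mul _ _ _ (_ * _) (jX (.u (k + 1))), jev_mul _ _ _ _ (jX (.u k)),
      jev_u, jev_u]
    have hp0 : 0 ≤ s 0 x * (1 / (1 + U 1 x ^ 2)) := mul_nonneg (hc.nonneg x hx) (by positivity)
    have e1 : jev s (jX (.sg 0) * jX .p) x (fun i => U i x) = s 0 x * (1 / (1 + U 1 x ^ 2)) := by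
      simp
    rw [e1] at h1 ⊢
    refine (abs_add_le _ _).trans ((add_le_add_left (abs_add_le _ _) _).trans ?_)
    rw [abs_mul (s 0 x * _), abs_mul _ (U k x)]
    have q : ∀ y : ℝ, |y| ≤ 1 + y ^ 2 := fun y => by
      rw [← sq_abs]; nlinarith [sq_nonneg (|y| - 1), abs_nonneg y]
    have h4 := mul_le_mul_of_nonneg_left (q (U (k + 1) x)) hp0
    rw [abs_of_nonneg hp0] at h1 ⊢
    have h5 := mul_le_mul h2 (q (U k x)) (abs_nonneg _) hK₂
    linarith
  have c1 := hU.cont k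
  have c8 : ContinuousOn (fun x => s 0 x * (1 / (1 + U 1 x ^ 2)) * U (k + 1) x ^ 2) (Icc 1 a) :=
    ((hc.cont 0).mul (continuousOn_const.div (continuousOn_const.fun_add ((hU.cont 1).fun_pow 2))
      fun x _ => by positivity)).mul ((hU.cont (k + 1)).pow 2)
  have c9 : ContinuousOn (fun x => (K₁ + K₂ + K₃) + K₂ * U k x ^ 2) (Icc 1 a) :=
    continuousOn_const.add (continuousOn_const.mul (c1.pow 2))
  have h := integral_mono_Icc ha.le ((isJet_FJ hc hU).cont (k - 1)).abs (c8.fun_add c9) hpt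
  have i2 := c8.intervalIntegrable_of_Icc (μ := MeasureTheory.volume) ha.le
  have i3 := c9.intervalIntegrable_of_Icc (μ := MeasureTheory.volume) ha.le
  have i4 := (c1.fun_pow 2).intervalIntegrable_of_Icc (μ := MeasureTheory.volume) ha.le
  rw [intervalIntegral.integral_add i2 i3,
    intervalIntegral.integral_add intervalIntegrable_const (i4.const_mul _),
    intervalIntegral.integral_const, intervalIntegral.integral_const_mul, smul_eq_mul] at h
  have h2 := (pairing_sq_le ha hE).2
  have h3 : K₂ * ∫ x in (1 : ℝ)..a, U k x ^ 2 ≤ K₂ * R := by gcongr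
  rw [diss]
  linarith

end

/-! ### Spaces of polynomials -/

/-- The jet of a polynomial. -/
noncomputable def pjet (P : Polynomial ℝ) (j : ℕ) (x : ℝ) : ℝ :=
  (Polynomial.derivative^[j] P).eval x

/-- The jet of a polynomial at a point, as a linear map. -/
noncomputable def pjetL (j : ℕ) (x : ℝ) : Polynomial ℝ →ₗ[ℝ] ℝ :=
  Polynomial.leval x ∘ₗ Polynomial.derivative ^ j

lemma pjetL_apply (j : ℕ) (x : ℝ) (P : Polynomial ℝ) : pjetL j x P = pjet P j x := by
  simp [pjetL, pjet, Module.End.pow_apply, Polynomial.leval]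

lemma pjet_add (P Q : Polynomial ℝ) (j : ℕ) (x : ℝ) :
    pjet (P + Q) j x = pjet P j x + pjet Q j x := by
  simp only [← pjetL_apply, map_add]

lemma pjet_sub (P Q : Polynomial ℝ) (j : ℕ) (x : ℝ) :
    pjet (P - Q) j x = pjet P j x - pjet Q j x := by
  simp only [← pjetL_apply, map_sub]

lemma pjet_smul (c : ℝ) (P : Polynomial ℝ) (j : ℕ) (x : ℝ) :
    pjet (c • P) j x = c * pjet P j x := by
  simp only [← pjetL_apply, map_smul, smul_eq_mul]

lemma isJet_pjet (a : ℝ) (P : Polynomial ℝ) : IsJet a (pjet P) := fun j x _ => by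
  have := (Polynomial.hasDerivAt (Polynomial.derivative^[j] P) x).hasDerivWithinAt (s := Icc 1 a)
  rwa [← Function.iterate_succ_apply' (Polynomial.derivative : Polynomial ℝ → Polynomial ℝ)] at this

lemma pjet_continuous (P : Polynomial ℝ) (j : ℕ) : Continuous (pjet P j) :=
  Polynomial.continuous _

lemma pairing_comm (k : ℕ) (a : ℝ) (U W : ℕ → ℝ → ℝ) : pairing k a U W = pairing k a W U := by
  simp only [pairing, mul_comm]

lemma pairing_add_left {k : ℕ} {a : ℝ} (ha : 1 < a) {U V W Z : ℕ → ℝ → ℝ}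
    (hU : ContinuousOn (U k) (Icc 1 a)) (hV : ContinuousOn (V k) (Icc 1 a))
    (hW : ContinuousOn (W k) (Icc 1 a)) (h : ∀ j x, Z j x = U j x + V j x) :
    pairing k a Z W = pairing k a U W + pairing k a V W := by
  simp only [pairing, h, add_mul, Finset.sum_add_distrib]
  rw [intervalIntegral.integral_add ((hU.fun_mul hW).intervalIntegrable_of_Icc ha.le)
    ((hV.fun_mul hW).intervalIntegrable_of_Icc ha.le)]
  ring

lemma pairing_smul_left {k : ℕ} {a c : ℝ} {U W Z : ℕ → ℝ → ℝ} (h : ∀ j x, Z j x = c * U j x) :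
    pairing k a Z W = c * pairing k a U W := by
  simp only [pairing, h, mul_assoc, ← Finset.mul_sum, intervalIntegral.integral_const_mul]
  ring

/-- The pairing against polynomials as a linear map. -/
noncomputable def pairingL {k : ℕ} {a : ℝ} (ha : 1 < a) {U : ℕ → ℝ → ℝ} (hU : IsJet a U) :
    Polynomial ℝ →ₗ[ℝ] ℝ where
  toFun P := pairing k a U (pjet P)
  map_add' P Q := by
    simp only [pairing_comm k a U]
    exact pairing_add_left ha ((isJet_pjet a P).cont k) ((isJet_pjet a Q).cont k) (hU.cont k)
      (pjet_add P Q)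
  map_smul' c P := by
    simp only [pairing_comm k a U]
    exact pairing_smul_left (pjet_smul c P)

lemma polynomial_eq_zero_of_pairing {k : ℕ} {a : ℝ} (ha : 1 < a) (hk : 0 < k) {P : Polynomial ℝ}
    (h : pairing k a (pjet P) (pjet P) = 0) : P = 0 := by
  refine Polynomial.eq_zero_of_infinite_isRoot P ((Icc_infinite ha).mono fun x hx => ?_)
  have key : ∀ c : ℝ, |c * P.eval x| ≤ a * a ^ k := fun c => by
    have h1 : pairing k a (pjet (c • P)) (pjet (c • P)) ≤ 0 := by
      rw [pairing_smul_left (pjet_smul c P), pairing_comm, pairing_smul_left (pjet_smul c P), h]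
      simp
    simpa [pjet] using jet_bound ha (isJet_pjet a (c • P)) h1 0 hk x hx
  by_contra hne
  have hne' : P.eval x ≠ 0 := hne
  have := key ((a * a ^ k + 1) / P.eval x)
  rw [div_mul_cancel₀ _ hne'] at this
  linarith [le_abs_self (a * a ^ k + 1)]

section
variable {V : Type*} [NormedAddCommGroup V] [InnerProductSpace ℝ V] [FiniteDimensional ℝ V]

lemma linear_bound (l : V →ₗ[ℝ] ℝ) : ∃ C, 0 ≤ C ∧ ∀ v, |l v| ≤ C * ‖v‖ :=
  ⟨‖LinearMap.toContinuousLinearMap l‖, norm_nonneg _,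
    fun v => (LinearMap.toContinuousLinearMap l).le_opNorm v⟩

lemma pjet_le_norm {a : ℝ} {N : ℕ} (ι : V →ₗ[ℝ] Polynomial ℝ) (hι : ∀ v, (ι v).natDegree < N)
    (j : ℕ) : ∃ C, 0 ≤ C ∧ ∀ v, ∀ x ∈ Icc 1 a, |pjet (ι v) j x| ≤ C * ‖v‖ := by
  choose C hC hb using fun i =>
    linear_bound (Polynomial.lcoeff ℝ i ∘ₗ (Polynomial.derivative ^ j) ∘ₗ ι)
  rcases le_or_gt 1 a with ha | ha
  swap
  · exact ⟨0, le_rfl, fun v x hx => absurd (hx.1.trans hx.2) (not_le.2 ha)⟩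
  refine ⟨∑ i ∈ Finset.range N, C i * a ^ i,
    Finset.sum_nonneg fun i _ => mul_nonneg (hC i) (by positivity), fun v x hx => ?_⟩
  have hd : (Polynomial.derivative^[j] (ι v)).natDegree < N :=
    ((Polynomial.natDegree_iterate_derivative (ι v) j).trans (Nat.sub_le _ _)).trans_lt (hι v)
  rw [pjet, Polynomial.eval_eq_sum_range' hd, Finset.sum_mul]
  refine (Finset.abs_sum_le_sum_abs _ _).trans (Finset.sum_le_sum fun i _ => ?_)
  have h1 := hb i v
  simp only [LinearMap.comp_apply, Module.End.pow_apply, Polynomial.lcoeff_apply] at h1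
  have hx0 : 0 ≤ x := by linarith [hx.1]
  rw [abs_mul, abs_of_nonneg (pow_nonneg hx0 i), mul_right_comm]
  exact mul_le_mul h1 (pow_le_pow_left₀ hx0 hx.2 i) (pow_nonneg hx0 i) ((abs_nonneg _).trans h1)

lemma pjet_le_norm_uniform {a : ℝ} {N : ℕ} (ι : V →ₗ[ℝ] Polynomial ℝ)
    (hι : ∀ v, (ι v).natDegree < N) (m : ℕ) :
    ∃ C, 0 ≤ C ∧ ∀ j ≤ m, ∀ v, ∀ x ∈ Icc 1 a, |pjet (ι v) j x| ≤ C * ‖v‖ := by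
  choose C hC hb using pjet_le_norm (a := a) ι hι
  refine ⟨∑ i ∈ Finset.range (m + 1), C i, Finset.sum_nonneg fun i _ => hC i,
    fun j hj v x hx => (hb j v x hx).trans ?_⟩
  have := Finset.single_le_sum (f := C) (fun i _ => hC i) (Finset.mem_range.2 (Nat.lt_succ_of_le hj))
  gcongr

/-- A vector field representing the flow is Lipschitz on bounded sets. -/
lemma pairing_FJ_lipschitz {a ν : ℝ} {s : ℕ → ℝ → ℝ} (hc : Coef a ν s) {N k : ℕ}
    (ι : V →ₗ[ℝ] Polynomial ℝ) (hι : ∀ v, (ι v).natDegree < N) {X : V → V}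
    (hX : ∀ v w, inner ℝ (X v) w = pairing k a (FJ s ν (pjet (ι v))) (pjet (ι w))) (ρ : ℝ) :
    ∃ L, 0 ≤ L ∧ ∀ v w, ‖v‖ ≤ ρ → ‖w‖ ≤ ρ → ‖X v - X w‖ ≤ L * ‖v - w‖ := by
  have ha := hc.one_lt
  obtain ⟨C, hC, hb⟩ := pjet_le_norm_uniform (a := a) ι hι (k + 2)
  choose K hK hL using fun j => jev_lipschitz hc (jDF_mem ν j) (C * ρ)
  have hFJ : ∀ v w, ‖v‖ ≤ ρ → ‖w‖ ≤ ρ → ∀ j ≤ k, ∀ x ∈ Icc 1 a,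
      |FJ s ν (pjet (ι v)) j x - FJ s ν (pjet (ι w)) j x| ≤ K j * (C * ‖v - w‖) := by
    intro v w hv hw j hj x hx
    refine hL j x hx _ _ (fun i hi => (hb i (by omega) v x hx).trans (by gcongr))
      (fun i hi => (hb i (by omega) w x hx).trans (by gcongr)) _ fun i hi => ?_
    have := hb i (by omega) (v - w) x hx
    rwa [map_sub, pjet_sub] at this
  refine ⟨∑ j ∈ Finset.range k, K j * C * C + K k * C * C * (a - 1), ?_, fun v w hv hw => ?_⟩
  · have : 0 ≤ a - 1 := by linarith
    have h1 := hK k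
    have h2 := Finset.sum_nonneg fun j (_ : j ∈ Finset.range k) =>
      mul_nonneg (mul_nonneg (hK j) hC) hC
    positivity
  set y := X v - X w with hy
  have e : ‖y‖ * ‖y‖ = pairing k a (fun j x => FJ s ν (pjet (ι v)) j x - FJ s ν (pjet (ι w)) j x)
      (pjet (ι y)) := by
    rw [← real_inner_self_eq_norm_mul_norm]
    nth_rw 1 [hy]
    rw [inner_sub_left, hX, hX, sub_eq_iff_eq_add, ← pairing_add_left ha _ _ _ fun j x => ?_]
    · exact (((isJet_FJ hc (isJet_pjet a _)).cont k).sub ((isJet_FJ hc (isJet_pjet a _)).cont k))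
    · exact (isJet_FJ hc (isJet_pjet a _)).cont k
    · exact (isJet_pjet a _).cont k
    · ring
  have hle : ‖y‖ * ‖y‖ ≤ ((∑ j ∈ Finset.range k, K j * C * C + K k * C * C * (a - 1)) *
      ‖v - w‖) * ‖y‖ := by
    rw [e, pairing]
    have h1 : ∀ j ≤ k, ∀ x ∈ Icc 1 a,
        |(FJ s ν (pjet (ι v)) j x - FJ s ν (pjet (ι w)) j x) * pjet (ι y) j x| ≤
          K j * C * C * ‖v - w‖ * ‖y‖ := fun j hj x hx => by
      rw [abs_mul]
      calc _ ≤ K j * (C * ‖v - w‖) * (C * ‖y‖) :=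
            mul_le_mul (hFJ v w hv hw j hj x hx) (hb j (by omega) y x hx) (abs_nonneg _)
              (mul_nonneg (hK j) (by positivity))
        _ = _ := by ring
    have h2 := (le_abs_self _).trans (abs_integral_le ha.le (h1 k le_rfl))
    have h3 := Finset.sum_le_sum fun j (hj : j ∈ Finset.range k) =>
      (le_abs_self _).trans (h1 j (Finset.mem_range.1 hj).le 1 hc.left_mem)
    rw [← Finset.sum_mul, ← Finset.sum_mul] at h3
    linarith
  rcases eq_or_lt_of_le (norm_nonneg y) with h0 | h0
  · rw [← h0]
    have : 0 ≤ a - 1 := by linarith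
    have h1 := hK k
    have h2 := Finset.sum_nonneg fun j (_ : j ∈ Finset.range k) =>
      mul_nonneg (mul_nonneg (hK j) hC) hC
    positivity
  · exact le_of_mul_le_mul_right hle h0

end

/-! ### Galerkin approximations -/

section
variable {V : Type*} [NormedAddCommGroup V]

/-- A cutoff function. -/
noncomputable def cutoff (R : ℝ) (v : V) : ℝ := max 0 (min 1 (R + 1 - ‖v‖ ^ 2))

lemma cutoff_nonneg (R : ℝ) (v : V) : 0 ≤ cutoff R v := le_max_left _ _

lemma cutoff_le_one (R : ℝ) (v : V) : cutoff R v ≤ 1 := max_le zero_le_one (min_le_left _ _)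

lemma cutoff_eq_one {R : ℝ} {v : V} (h : ‖v‖ ^ 2 ≤ R) : cutoff R v = 1 := by
  rw [cutoff, min_eq_left (by linarith), max_eq_right zero_le_one]

lemma cutoff_eq_zero {R : ℝ} {v : V} (h : R + 1 ≤ ‖v‖ ^ 2) : cutoff R v = 0 :=
  max_eq_left ((min_le_right _ _).trans (by linarith))

lemma cutoff_sub_le {R ρ : ℝ} {v w : V} (hv : ‖v‖ ≤ ρ) (hw : ‖w‖ ≤ ρ) :
    |cutoff R v - cutoff R w| ≤ 2 * ρ * ‖v - w‖ := by
  have h1 : |cutoff R v - cutoff R w| ≤ |(R + 1 - ‖v‖ ^ 2) - (R + 1 - ‖w‖ ^ 2)| := by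
    simp only [cutoff]
    refine (abs_max_sub_max_le_max _ _ _ _).trans ?_
    rw [sub_self, abs_zero]
    refine max_le (abs_nonneg _) ((abs_min_sub_min_le_max _ _ _ _).trans ?_)
    rw [sub_self, abs_zero]
    exact max_le (abs_nonneg _) le_rfl
  have h2 : (R + 1 - ‖v‖ ^ 2) - (R + 1 - ‖w‖ ^ 2) = (‖v‖ + ‖w‖) * (‖w‖ - ‖v‖) := by ring
  rw [h2, abs_mul, abs_of_nonneg (add_nonneg (norm_nonneg v) (norm_nonneg w))] at h1
  have h3 := abs_norm_sub_norm_le w v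
  rw [norm_sub_rev] at h3
  refine h1.trans (mul_le_mul (by linarith) h3 (abs_nonneg _) ?_)
  linarith [norm_nonneg v]

variable [InnerProductSpace ℝ V]

lemma norm_cutoff_smul_sq_le {R : ℝ} (hR : 0 ≤ R) (v : V) : ‖cutoff R v • v‖ ^ 2 ≤ R + 1 := by
  rcases le_or_gt (R + 1) (‖v‖ ^ 2) with h | h
  · rw [cutoff_eq_zero h]; simp; linarith
  · rw [norm_smul, Real.norm_eq_abs, abs_of_nonneg (cutoff_nonneg R v), mul_pow]
    have : cutoff R v ^ 2 ≤ 1 := pow_le_one₀ (cutoff_nonneg R v) (cutoff_le_one R v)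
    nlinarith [sq_nonneg ‖v‖]

/-- Global solvability of a differential equation with a cutoff. -/
lemma exists_cutoff_flow [CompleteSpace V] {X : V → V}
    (hX : ∀ ρ : ℝ, ∃ L, 0 ≤ L ∧ ∀ v w, ‖v‖ ≤ ρ → ‖w‖ ≤ ρ → ‖X v - X w‖ ≤ L * ‖v - w‖)
    {R T : ℝ} (hR : 0 ≤ R) (hT : 0 ≤ T) (v₀ : V) :
    ∃ α : ℝ → V, α 0 = v₀ ∧ ∀ t ∈ Icc 0 T, HasDerivWithinAt α
      (cutoff R (α t) • X (cutoff R (α t) • α t)) (Icc 0 T) t := by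
  have hsm : ∀ v : V, ‖cutoff R v • v‖ ≤ R + 1 := fun v => by
    have := norm_cutoff_smul_sq_le hR v
    exact (abs_le_of_sq_le_sq' (by nlinarith) (by linarith)).2
  obtain ⟨L, hL, hXL⟩ := hX (R + 1)
  set B := ‖X 0‖ + L * (R + 1) with hB
  have hXB : ∀ v, ‖X (cutoff R v • v)‖ ≤ B := fun v => by
    have h1 := hXL (cutoff R v • v) 0 (hsm v) (by simpa using by linarith)
    rw [sub_zero] at h1
    have h2 := norm_le_norm_sub_add (X (cutoff R v • v)) (X 0)
    have h3 : L * ‖cutoff R v • v‖ ≤ L * (R + 1) := mul_le_mul_of_nonneg_left (hsm v) hL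
    linarith
  have hB0 : 0 ≤ B := (norm_nonneg _).trans (hXB 0)
  set ρ := ‖v₀‖ + B * T with hρ
  have hρ0 : 0 ≤ ρ := by positivity
  have hlip : ∀ v w : V, ‖v‖ ≤ ρ → ‖w‖ ≤ ρ →
      ‖cutoff R v • X (cutoff R v • v) - cutoff R w • X (cutoff R w • w)‖ ≤
        (2 * ρ * B + L * (1 + 2 * ρ * ρ)) * ‖v - w‖ := by
    intro v w hv hw
    have h1 := cutoff_sub_le (R := R) hv hw
    have e : cutoff R v • v - cutoff R w • w =
        cutoff R v • (v - w) + (cutoff R v - cutoff R w) • w := by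
      rw [smul_sub, sub_smul]; abel
    have h2 : ‖cutoff R v • v - cutoff R w • w‖ ≤ (1 + 2 * ρ * ρ) * ‖v - w‖ := by
      rw [e]
      refine (norm_add_le _ _).trans ?_
      rw [norm_smul, norm_smul, Real.norm_eq_abs, Real.norm_eq_abs,
        abs_of_nonneg (cutoff_nonneg R v)]
      have h3 : cutoff R v * ‖v - w‖ ≤ 1 * ‖v - w‖ := by gcongr; exact cutoff_le_one R v
      have h4 : |cutoff R v - cutoff R w| * ‖w‖ ≤ 2 * ρ * ‖v - w‖ * ρ := by gcongr
      linarith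
    have h3 := hXL _ _ (hsm v) (hsm w)
    have e2 : cutoff R v • X (cutoff R v • v) - cutoff R w • X (cutoff R w • w) =
        (cutoff R v - cutoff R w) • X (cutoff R v • v) +
          cutoff R w • (X (cutoff R v • v) - X (cutoff R w • w)) := by
      rw [smul_sub, sub_smul]; abel
    rw [e2]
    refine (norm_add_le _ _).trans ?_
    rw [norm_smul, norm_smul, Real.norm_eq_abs, Real.norm_eq_abs,
      abs_of_nonneg (cutoff_nonneg R w)]
    have h4 : |cutoff R v - cutoff R w| * ‖X (cutoff R v • v)‖ ≤ 2 * ρ * ‖v - w‖ * B :=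
      mul_le_mul h1 (hXB v) (norm_nonneg _) (by positivity)
    have h5 : cutoff R w * ‖X (cutoff R v • v) - X (cutoff R w • w)‖ ≤
        1 * (L * ((1 + 2 * ρ * ρ) * ‖v - w‖)) :=
      mul_le_mul (cutoff_le_one R w) (h3.trans (by gcongr)) (norm_nonneg _) zero_le_one
    linarith
  have hball : ∀ v ∈ Metric.closedBall v₀ (B * T), ‖v‖ ≤ ρ := fun v hv => by
    rw [mem_closedBall_iff_norm] at hv
    linarith [norm_le_norm_sub_add v v₀]
  have hK : 0 ≤ 2 * ρ * B + L * (1 + 2 * ρ * ρ) := by positivity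
  have pl : IsPicardLindelof (fun _ v => cutoff R v • X (cutoff R v • v))
      (⟨0, le_rfl, hT⟩ : Icc 0 T) v₀ ⟨B * T, by positivity⟩ 0 ⟨B, hB0⟩ ⟨_, hK⟩ := by
    refine ⟨fun t _ => LipschitzOnWith.of_dist_le_mul fun v hv w hw => ?_,
      fun v _ => continuousOn_const, fun t _ v _ => ?_, ?_⟩
    · rw [dist_eq_norm, dist_eq_norm]
      exact hlip v w (hball v hv) (hball w hw)
    · rw [norm_smul, Real.norm_eq_abs, abs_of_nonneg (cutoff_nonneg R v)]
      exact (mul_le_of_le_one_left (norm_nonneg _) (cutoff_le_one R v)).trans (hXB v)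
    · simp only [sub_zero, max_eq_left hT, NNReal.coe_zero]
      exact le_rfl
  obtain ⟨α, h0, hα⟩ := pl.exists_eq_forall_mem_Icc_hasDerivWithinAt₀
  exact ⟨α, h0, hα⟩

end

/-- A Galerkin approximation of the flow with values in the polynomials of degree less than `N`. -/
structure GalSol (s : ℕ → ℝ → ℝ) (ν a : ℝ) (k N : ℕ) (T R K : ℝ) (u u' : ℝ → Polynomial ℝ) :
    Prop where
  mem : ∀ t, u t ∈ Polynomial.degreeLT ℝ N
  mem' : ∀ t, u' t ∈ Polynomial.degreeLT ℝ N
  lin : ∀ l : Polynomial ℝ →ₗ[ℝ] ℝ, ∀ t ∈ Icc 0 T,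
    HasDerivWithinAt (fun t => l (u t)) (l (u' t)) (Icc 0 T) t
  energy : ∀ t ∈ Icc 0 T, HasDerivWithinAt (fun t => pairing k a (pjet (u t)) (pjet (u t)))
    (2 * pairing k a (pjet (u' t)) (pjet (u t))) (Icc 0 T) t
  energy_le : ∀ t ∈ Icc 0 T, pairing k a (pjet (u' t)) (pjet (u t)) ≤ K
  proj : ∀ t ∈ Icc 0 T, pairing k a (pjet (u t)) (pjet (u t)) ≤ R →
    ∀ φ ∈ Polynomial.degreeLT ℝ N,
      pairing k a (pjet (u' t)) (pjet φ) = pairing k a (FJ s ν (pjet (u t))) (pjet φ)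

lemma galSol_of_inner {V : Type*} [NormedAddCommGroup V] [InnerProductSpace ℝ V]
    [FiniteDimensional ℝ V] {a ν : ℝ} {s : ℕ → ℝ → ℝ} (hc : Coef a ν s) {N k : ℕ}
    (ι : V →ₗ[ℝ] Polynomial ℝ) (hι : ∀ v, ι v ∈ Polynomial.degreeLT ℝ N)
    (hι' : ∀ φ ∈ Polynomial.degreeLT ℝ N, ∃ v, ι v = φ) (hN : 0 < N)
    (hin : ∀ v w, inner ℝ v w = pairing k a (pjet (ι v)) (pjet (ι w))) {T R K : ℝ} (hT : 0 ≤ T)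
    (hR : 0 ≤ R)
    (hE : ∀ U : ℕ → ℝ → ℝ, IsJet a U → pairing k a U U ≤ R + 1 → pairing k a (FJ s ν U) U ≤ K)
    {P : Polynomial ℝ} (hP : P ∈ Polynomial.degreeLT ℝ N) :
    ∃ u u' : ℝ → Polynomial ℝ, u 0 = P ∧ GalSol s ν a k N T R K u u' := by
  have : CompleteSpace V := FiniteDimensional.complete ℝ V
  set X : V → V := fun v => (InnerProductSpace.toDual ℝ V).symm (LinearMap.toContinuousLinearMap
    (pairingL (k := k) hc.one_lt (isJet_FJ hc (isJet_pjet a (ι v))) ∘ₗ ι)) with hXdef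
  have hX : ∀ v w, inner ℝ (X v) w = pairing k a (FJ s ν (pjet (ι v))) (pjet (ι w)) := fun v w => by
    simp only [hXdef, InnerProductSpace.toDual_symm_apply]
    rfl
  have hdeg : ∀ v, (ι v).natDegree < N := fun v => by
    have := Polynomial.mem_degreeLT.1 (hι v)
    rcases eq_or_ne (ι v) 0 with h | h
    · simpa [h] using hN
    · exact (Polynomial.natDegree_lt_iff_degree_lt h).2 this
  obtain ⟨v₀, hv₀⟩ := hι' P hP
  obtain ⟨α, h0, hα⟩ := exists_cutoff_flow (fun ρ => pairing_FJ_lipschitz hc ι hdeg hX ρ) hR hT v₀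
  refine ⟨fun t => ι (α t), fun t => ι (cutoff R (α t) • X (cutoff R (α t) • α t)),
    by simp only [h0, hv₀], fun t => hι _, fun t => hι _, fun l t ht => ?_, fun t ht => ?_,
    fun t ht => ?_, fun t ht hle φ hφ => ?_⟩
  · exact (LinearMap.toContinuousLinearMap (l ∘ₗ ι)).hasFDerivAt.comp_hasDerivWithinAt t (hα t ht)
  · have := (hα t ht).inner ℝ (hα t ht)
    refine (this.congr_deriv ?_).congr (fun r _ => (hin _ _).symm) (hin _ _).symm
    rw [← hin, real_inner_comm, two_mul]
  · rw [← hin, real_inner_smul_left, ← real_inner_smul_right, hX]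
    refine hE _ (isJet_pjet a _) ?_
    rw [← hin, real_inner_self_eq_norm_sq]
    exact norm_cutoff_smul_sq_le hR _
  · obtain ⟨w, rfl⟩ := hι' φ hφ
    rw [← hin, real_inner_self_eq_norm_sq] at hle
    rw [cutoff_eq_one hle, one_smul, one_smul, ← hin, hX]

/-- Galerkin approximations exist on any time interval. -/
theorem exists_galSol {a ν : ℝ} {s : ℕ → ℝ → ℝ} (hc : Coef a ν s) {N k : ℕ} (hk : 0 < k)
    (hN : 0 < N) {T R K : ℝ} (hT : 0 ≤ T) (hR : 0 ≤ R)
    (hE : ∀ U : ℕ → ℝ → ℝ, IsJet a U → pairing k a U U ≤ R + 1 → pairing k a (FJ s ν U) U ≤ K)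
    {P : Polynomial ℝ} (hP : P ∈ Polynomial.degreeLT ℝ N) :
    ∃ u u' : ℝ → Polynomial ℝ, u 0 = P ∧ GalSol s ν a k N T R K u u' := by
  have ha := hc.one_lt
  let core : InnerProductSpace.Core ℝ (Polynomial.degreeLT ℝ N) :=
    { inner := fun v w => pairing k a (pjet v) (pjet w)
      conj_inner_symm := fun v w => pairing_comm _ _ _ _
      re_inner_nonneg := fun v => pairing_self_nonneg k _ ha
      add_left := fun v w z => pairing_add_left ha ((isJet_pjet a _).cont k)
        ((isJet_pjet a _).cont k) ((isJet_pjet a _).cont k) (pjet_add v w)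
      smul_left := fun v w r => pairing_smul_left (pjet_smul r v)
      definite := fun v hv => Subtype.ext (polynomial_eq_zero_of_pairing ha hk hv) }
  let : NormedAddCommGroup (Polynomial.degreeLT ℝ N) := core.toNormedAddCommGroup
  let : InnerProductSpace ℝ (Polynomial.degreeLT ℝ N) := InnerProductSpace.ofCore core.toCore
  have : FiniteDimensional ℝ (Polynomial.degreeLT ℝ N) :=
    Module.Finite.of_basis (Polynomial.degreeLT.basis ℝ N)
  exact galSol_of_inner hc (Polynomial.degreeLT ℝ N).subtype (fun v => v.2)
    (fun φ hφ => ⟨⟨φ, hφ⟩, rfl⟩) hN (fun v w => rfl) hT hR hE hP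

/-! ### The Galerkin residual -/

lemma exists_iterate_antideriv (k : ℕ) (G : Polynomial ℝ) :
    ∃ φ : Polynomial ℝ, Polynomial.derivative^[k] φ = G ∧ φ.natDegree ≤ G.natDegree + k := by
  induction k generalizing G with
  | zero => exact ⟨G, rfl, le_rfl⟩
  | succ k ih =>
    have hQ : Polynomial.derivative (∑ i ∈ Finset.range (G.natDegree + 1),
        Polynomial.C (G.coeff i / ((i : ℝ) + 1)) * Polynomial.X ^ (i + 1)) = G := by
      conv_rhs => rw [G.as_sum_range_C_mul_X_pow]
      rw [Polynomial.derivative_sum]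
      refine Finset.sum_congr rfl fun i _ => ?_
      have : (i : ℝ) + 1 ≠ 0 := by positivity
      rw [Polynomial.derivative_C_mul_X_pow, Nat.add_sub_cancel]
      congr 2
      push_cast
      field_simp
    obtain ⟨φ, h1, h2⟩ := ih (∑ i ∈ Finset.range (G.natDegree + 1),
        Polynomial.C (G.coeff i / ((i : ℝ) + 1)) * Polynomial.X ^ (i + 1))
    refine ⟨φ, by rw [Function.iterate_succ_apply', h1, hQ], h2.trans ?_⟩
    have : (∑ i ∈ Finset.range (G.natDegree + 1),
        Polynomial.C (G.coeff i / ((i : ℝ) + 1)) * Polynomial.X ^ (i + 1)).natDegree ≤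
          G.natDegree + 1 := by
      refine Polynomial.natDegree_sum_le_of_forall_le _ _ fun i hi => ?_
      refine (Polynomial.natDegree_C_mul_X_pow_le _ _).trans ?_
      have := Finset.mem_range.1 hi
      omega
    omega

lemma mem_degreeLT_of_natDegree_lt {N : ℕ} {P : Polynomial ℝ} (h : P.natDegree < N) :
    P ∈ Polynomial.degreeLT ℝ N := by
  rw [Polynomial.mem_degreeLT]
  exact Polynomial.degree_le_natDegree.trans_lt (by exact_mod_cast h)

section
variable {a : ℝ} {e : ℕ → ℝ → ℝ} {k N : ℕ}

lemma residual_left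
    (h : ∀ φ ∈ Polynomial.degreeLT ℝ N, pairing k a e (pjet φ) = 0) (hN : k ≤ N) {i : ℕ}
    (hi : i < k) : e i 1 = 0 := by
  set φ : Polynomial ℝ := (Polynomial.X - Polynomial.C 1) ^ i with hφ
  have hpj : ∀ j x, pjet φ j x = i.descFactorial j * (x - 1) ^ (i - j) := fun j x => by
    rw [pjet, hφ, Polynomial.iterate_derivative_X_sub_pow]
    simp
  have hd : φ.natDegree < N := by
    rw [hφ, Polynomial.natDegree_pow, Polynomial.natDegree_X_sub_C]
    omega
  have key := h φ (mem_degreeLT_of_natDegree_lt hd)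
  rw [pairing, Finset.sum_eq_single i] at key
  · have h0 : ∀ x, pjet φ k x = 0 := fun x => by
      rw [hpj, Nat.descFactorial_of_lt hi]; simp
    simp only [h0, hpj, Nat.descFactorial_self] at key
    have : (i.factorial : ℝ) ≠ 0 := by exact_mod_cast i.factorial_ne_zero
    simpa [this] using key
  · intro j _ hji
    rw [hpj]
    rcases lt_or_gt_of_ne hji with hlt | hlt
    · rw [sub_self, zero_pow (by omega)]; simp
    · rw [Nat.descFactorial_of_lt hlt]; simp
  · intro hi'
    exact absurd (Finset.mem_range.2 hi) hi'

lemma integral_mul_residual_top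
    (h : ∀ φ ∈ Polynomial.degreeLT ℝ N, pairing k a e (pjet φ) = 0) {G : Polynomial ℝ}
    (hG : G.natDegree + k < N) : ∫ y in (1 : ℝ)..a, e k y * G.eval y = 0 := by
  obtain ⟨φ, h1, h2⟩ := exists_iterate_antideriv k G
  have key := h φ (mem_degreeLT_of_natDegree_lt (by omega))
  rw [pairing, Finset.sum_eq_zero, zero_add] at key
  · simpa only [pjet, h1] using key
  · intro j hj
    rw [residual_left h (by omega) (Finset.mem_range.1 hj), zero_mul]

lemma integral_mul_residual (ha : 1 < a) (he : IsJet a e)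
    (h : ∀ φ ∈ Polynomial.degreeLT ℝ N, pairing k a e (pjet φ) = 0) (hk : 0 < k)
    {Q : Polynomial ℝ} (hQ : Q.natDegree + 1 + k < N) :
    ∫ y in (1 : ℝ)..a, Q.eval y * e (k - 1) y = 0 := by
  obtain ⟨m, rfl⟩ : ∃ m, k = m + 1 := ⟨k - 1, by omega⟩
  rw [Nat.add_sub_cancel]
  obtain ⟨G₀, h1, h2⟩ := exists_iterate_antideriv 1 Q
  rw [Function.iterate_one] at h1
  set G := G₀ - Polynomial.C (G₀.eval a) with hG
  have hG' : Polynomial.derivative G = Q := by rw [hG, map_sub, h1, Polynomial.derivative_C, sub_zero]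
  have hGa : G.eval a = 0 := by simp [hG]
  have hdeg : G.natDegree ≤ Q.natDegree + 1 := by
    rw [hG, Polynomial.natDegree_sub_C]; exact h2
  have e1 := integral_mul_residual_top h (G := G) (by omega)
  have hm : e m 1 = 0 := residual_left h (by omega) (by omega)
  have hder : ∀ x ∈ Icc 1 a, HasDerivWithinAt (fun y => e m y * G.eval y)
      (e (m + 1) x * G.eval x + Q.eval x * e m x) (Icc 1 a) x := fun x hx =>
    ((he m x hx).fun_mul (G.hasDerivAt x).hasDerivWithinAt).congr_deriv (by rw [hG']; ring)
  have c1 : ContinuousOn (fun x => e (m + 1) x * G.eval x) (Icc 1 a) :=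
    (he.cont _).fun_mul G.continuous.continuousOn
  have c2 : ContinuousOn (fun x => Q.eval x * e m x) (Icc 1 a) :=
    Q.continuous.continuousOn.fun_mul (he.cont _)
  have key := integral_eq_sub_of_within hder (c1.add c2) (left_mem_Icc.2 ha.le)
    (right_mem_Icc.2 ha.le) ha.le
  rw [intervalIntegral.integral_add (c1.intervalIntegrable_of_Icc ha.le)
    (c2.intervalIntegrable_of_Icc ha.le), e1, hm, hGa] at key
  linarith

lemma taylor_of_left_zero (he : IsJet a e) {x : ℝ} (hx : x ∈ Icc 1 a) (m : ℕ)
    (h0 : ∀ i ≤ m, e i 1 = 0) :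
    e 0 x = ∫ y in (1 : ℝ)..x, (x - y) ^ m / m.factorial * e (m + 1) y := by
  have hss : Icc 1 x ⊆ Icc 1 a := Icc_subset_Icc_right hx.2
  induction m with
  | zero =>
    have := integral_eq_sub_of_within (he 0) (he.cont 1) ⟨le_rfl, hx.1.trans hx.2⟩ hx hx.1
    simp [this, h0 0 le_rfl]
  | succ m ih =>
    rw [ih fun i hi => h0 i (by omega)]
    have hder : ∀ y ∈ Icc 1 x,
        HasDerivWithinAt (fun y => (x - y) ^ (m + 1) / (m + 1).factorial * e (m + 1) y)
        ((x - y) ^ (m + 1) / (m + 1).factorial * e (m + 1 + 1) y -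
          (x - y) ^ m / m.factorial * e (m + 1) y) (Icc 1 x) y := fun y hy => by
      have h1 : HasDerivWithinAt (fun y : ℝ => x - y) (-1) (Icc 1 x) y := by
        simpa using (hasDerivWithinAt_id y (Icc 1 x)).const_sub x
      refine (((h1.fun_pow (m + 1)).div_const _).fun_mul
        ((he (m + 1) y (hss hy)).mono hss)).congr_deriv ?_
      have h2 : (m.factorial : ℝ) ≠ 0 := by exact_mod_cast m.factorial_ne_zero
      rw [Nat.factorial_succ]
      push_cast
      have h3 : (m : ℝ) + 1 ≠ 0 := by positivity
      field_simp
      ring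
    have c0 : ∀ m : ℕ, ContinuousOn (fun y : ℝ => (x - y) ^ m / m.factorial * e (m + 1) y)
        (Icc 1 x) := fun m =>
      (((continuous_const.sub continuous_id).pow m).div_const _).continuousOn.fun_mul
        ((he.cont _).mono hss)
    have key := integral_eq_sub_of_within hder ((c0 (m + 1)).sub (c0 m)) (left_mem_Icc.2 hx.1)
      (right_mem_Icc.2 hx.1) hx.1
    rw [intervalIntegral.integral_sub ((c0 (m + 1)).intervalIntegrable_of_Icc hx.1)
      ((c0 m).intervalIntegrable_of_Icc hx.1), h0 (m + 1) le_rfl] at key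
    simp only [sub_self, mul_zero, zero_pow (Nat.succ_ne_zero m), zero_div, zero_mul] at key
    linarith

/-- A residual orthogonal to many polynomials is given by a small kernel applied to a
derivative of lower order. -/
lemma exists_small_kernel (ha : 1 < a) (hk : 3 ≤ k) {ε : ℝ} (hε : 0 < ε) :
    ∃ N₀, ∃ ψ : ℝ → ℝ → ℝ, (∀ x, Continuous (ψ x)) ∧
      (∀ x ∈ Icc 1 a, ∀ y ∈ Icc 1 a, |ψ x y| ≤ ε) ∧
      ∀ N, N₀ ≤ N → ∀ e : ℕ → ℝ → ℝ, IsJet a e →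
        (∀ φ ∈ Polynomial.degreeLT ℝ N, pairing k a e (pjet φ) = 0) →
        ∀ x ∈ Icc 1 a, e 0 x = ∫ y in (1 : ℝ)..a, ψ x y * e (k - 1) y := by
  obtain ⟨m, rfl⟩ : ∃ m, k = m + 3 := ⟨k - 3, by omega⟩
  set h : ℝ → ℝ := fun r => max r 0 ^ (m + 1) / (m + 1).factorial with hh
  have hcont : Continuous h := ((continuous_id.max continuous_const).pow _).div_const _
  obtain ⟨q, hq⟩ := exists_polynomial_near_of_continuousOn (-(a - 1)) (a - 1) h hcont.continuousOn
    ε hε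
  refine ⟨q.natDegree + 1 + (m + 3) + 1, fun x y => h (x - y) - q.eval (x - y), fun x => ?_,
    fun x hx y hy => ?_, fun N hN e he hproj x hx => ?_⟩
  · exact (hcont.comp (continuous_const.sub continuous_id)).sub
      (q.continuous.comp (continuous_const.sub continuous_id))
  · rw [abs_sub_comm]
    exact (hq (x - y) ⟨by linarith [hx.1, hy.2], by linarith [hx.2, hy.1]⟩).le
  · have hk1 : m + 3 - 1 = m + 2 := by omega
    have hQ : (q.comp (Polynomial.C x - Polynomial.X)).natDegree ≤ q.natDegree := by
      refine Polynomial.natDegree_comp_le.trans ?_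
      have : (Polynomial.C x - Polynomial.X : Polynomial ℝ).natDegree ≤ 1 :=
        (Polynomial.natDegree_sub_le _ _).trans (by simp)
      nlinarith
    have hzero := integral_mul_residual ha he hproj (by omega)
      (Q := q.comp (Polynomial.C x - Polynomial.X)) (by omega)
    simp only [Polynomial.eval_comp, Polynomial.eval_sub, Polynomial.eval_C, Polynomial.eval_X,
      hk1] at hzero
    rw [hk1]
    have cH : Continuous fun y => h (x - y) := hcont.comp (continuous_const.sub continuous_id)
    have cQ : Continuous fun y => q.eval (x - y) :=
      q.continuous.comp (continuous_const.sub continuous_id)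
    have c1 : ContinuousOn (fun y => h (x - y) * e (m + 2) y) (Icc 1 a) :=
      cH.continuousOn.fun_mul (he.cont _)
    have c2 : ContinuousOn (fun y => q.eval (x - y) * e (m + 2) y) (Icc 1 a) :=
      cQ.continuousOn.fun_mul (he.cont _)
    simp only [sub_mul]
    rw [intervalIntegral.integral_sub (c1.intervalIntegrable_of_Icc ha.le)
      (c2.intervalIntegrable_of_Icc ha.le), hzero, sub_zero,
      ← intervalIntegral.integral_add_adjacent_intervals
        ((c1.mono (Icc_subset_Icc_right hx.2)).intervalIntegrable_of_Icc hx.1)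
        ((c1.mono (Icc_subset_Icc_left hx.1)).intervalIntegrable_of_Icc hx.2),
      taylor_of_left_zero he hx (m + 1) fun i hi => residual_left hproj (by omega) (by omega)]
    have z : ∫ y in x..a, h (x - y) * e (m + 2) y = 0 := by
      rw [intervalIntegral.integral_congr (g := fun _ => (0 : ℝ)), intervalIntegral.integral_zero]
      intro y hy
      rw [uIcc_of_le hx.2] at hy
      simp [hh, max_eq_right (sub_nonpos.2 hy.1)]
    rw [z, add_zero]
    refine intervalIntegral.integral_congr fun y hy => ?_
    rw [uIcc_of_le hx.1] at hy
    simp [hh, max_eq_left (sub_nonneg.2 hy.2)]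
end

lemma GalSol.mono {s : ℕ → ℝ → ℝ} {ν a T T' R K : ℝ} {k N : ℕ} {u u' : ℝ → Polynomial ℝ}
    (h : GalSol s ν a k N T R K u u') (hT : T' ≤ T) : GalSol s ν a k N T' R K u u' where
  mem := h.mem
  mem' := h.mem'
  lin l t ht := (h.lin l t ⟨ht.1, ht.2.trans hT⟩).mono (Icc_subset_Icc_right hT)
  energy t ht := (h.energy t ⟨ht.1, ht.2.trans hT⟩).mono (Icc_subset_Icc_right hT)
  energy_le t ht := h.energy_le t ⟨ht.1, ht.2.trans hT⟩
  proj t ht := h.proj t ⟨ht.1, ht.2.trans hT⟩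

lemma continuousOn_pjet_time {s : ℕ → ℝ → ℝ} {ν a T R K : ℝ} {k N : ℕ} {u u' : ℝ → Polynomial ℝ}
    (h : GalSol s ν a k N T R K u u') (j : ℕ) (x : ℝ) :
    ContinuousOn (fun t => pjet (u t) j x) (Icc 0 T) := fun t ht => by
  have := (h.lin (pjetL j x) t ht).continuousWithinAt
  simpa only [pjetL_apply] using this

/-- Integration against a continuous kernel as a linear map on polynomials. -/
noncomputable def kernelL (a : ℝ) {ψ : ℝ → ℝ} (hψ : Continuous ψ) (j : ℕ) :
    Polynomial ℝ →ₗ[ℝ] ℝ where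
  toFun P := ∫ y in (1 : ℝ)..a, ψ y * pjet P j y
  map_add' P Q := by
    simp only [pjet_add, mul_add]
    exact intervalIntegral.integral_add ((hψ.mul (pjet_continuous P j)).intervalIntegrable _ _)
      ((hψ.mul (pjet_continuous Q j)).intervalIntegrable _ _)
  map_smul' c P := by
    simp only [pjet_smul, mul_left_comm _ c, intervalIntegral.integral_const_mul]
    rfl

/-- Galerkin solutions of bounded energy solve the flow up to a small error. -/
theorem galerkin_residual {a ν : ℝ} {s : ℕ → ℝ → ℝ} (hc : Coef a ν s) {k : ℕ} (hk : 6 ≤ k)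
    {T R K : ℝ} (hT : 0 ≤ T) (hR : 0 ≤ R) :
    ∃ C, 0 ≤ C ∧ ∀ ε > 0, ∃ N₀, ∀ N, N₀ ≤ N → ∀ T' ≤ T, ∀ u u' : ℝ → Polynomial ℝ,
      GalSol s ν a k N T' R K u u' →
      (∀ t ∈ Icc 0 T', pairing k a (pjet (u t)) (pjet (u t)) ≤ R) →
      ∀ t ∈ Icc 0 T', ∀ x ∈ Icc 1 a,
        |pjet (u t) 0 x - pjet (u 0) 0 x - ∫ r in (0 : ℝ)..t, FJ s ν (pjet (u r)) 0 x| ≤ C * ε := by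
  have ha := hc.one_lt
  obtain ⟨K₁, hK₁, h₁⟩ := pairing_FJ_le_of_energy hc hk R hR
  obtain ⟨K₂, hK₂, h₂⟩ := integral_abs_FJ_le hc hk R
  set B := (2 * R + a) * a ^ k with hB
  have hB0 : 0 ≤ B := by positivity
  have ha1 : 0 ≤ a - 1 := by linarith
  refine ⟨(K₁ + K₂) * T + R + 2 * (B * (a - 1)), by positivity, fun ε hε => ?_⟩
  obtain ⟨N₀, ψ, hψ, hψε, hrep⟩ := exists_small_kernel ha (k := k) (by omega) hε
  refine ⟨N₀, fun N hN T' hT' u u' hu hE t ht x hx => ?_⟩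
  have hJ := fun t => isJet_pjet a (u t)
  have hFJ := fun t => isJet_FJ hc (hJ t)
  have hFc : ContinuousOn (fun r => FJ s ν (pjet (u r)) 0 x) (Icc 0 T') :=
    jev_continuousOn hc (jDF_mem ν 0) (Z := fun j r => pjet (u r) j x) continuousOn_const
      (fun _ _ => hx) fun j _ => continuousOn_pjet_time hu j x
  have hY : ∀ t ∈ Icc 0 T', HasDerivWithinAt (fun t => pjet (u t) 0 x -
      (∫ y in (1 : ℝ)..a, ψ x y * pjet (u t) (k - 1) y) -
        ∫ r in (0 : ℝ)..t, FJ s ν (pjet (u r)) 0 x)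
      (-∫ y in (1 : ℝ)..a, ψ x y * FJ s ν (pjet (u t)) (k - 1) y) (Icc 0 T') t := fun t ht => by
    have d1 := hu.lin (pjetL 0 x) t ht
    simp only [pjetL_apply] at d1
    have d2 := hu.lin (kernelL a (hψ x) (k - 1)) t ht
    refine ((d1.fun_sub d2).fun_sub (hasDerivWithinAt_integral hFc ht)).congr_deriv ?_
    have hres := hrep N hN (fun j y => pjet (u' t) j y - FJ s ν (pjet (u t)) j y)
      (fun j y hy => (isJet_pjet a (u' t) j y hy).fun_sub (hFJ t j y hy)) (fun φ hφ => by
        have p := hu.proj t ht (hE t ht) φ hφ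
        have p2 := pairing_add_left ha (k := k) (a := a)
          (U := fun j y => pjet (u' t) j y - FJ s ν (pjet (u t)) j y)
          (V := FJ s ν (pjet (u t))) (W := pjet φ) (Z := pjet (u' t))
          (((isJet_pjet a (u' t)).cont k).fun_sub ((hFJ t).cont k)) ((hFJ t).cont k)
          ((isJet_pjet a φ).cont k) fun j x => by ring
        linarith) x hx
    simp only [mul_sub] at hres
    rw [intervalIntegral.integral_sub
      (((hψ x).continuousOn.fun_mul ((isJet_pjet a (u' t)).cont _)).intervalIntegrable_of_Icc ha.le)
      (((hψ x).continuousOn.fun_mul ((hFJ t).cont _)).intervalIntegrable_of_Icc ha.le)] at hres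
    change pjet (u' t) 0 x - (∫ y in (1 : ℝ)..a, ψ x y * pjet (u' t) (k - 1) y) - _ = _
    linarith
  have hg : ∀ t ∈ Icc 0 T', HasDerivWithinAt
      (fun t => ε * ((K₁ + K₂) * t - 1 / 2 * pairing k a (pjet (u t)) (pjet (u t))))
      (ε * ((K₁ + K₂) - pairing k a (pjet (u' t)) (pjet (u t)))) (Icc 0 T') t := fun t ht => by
    refine ((((hasDerivWithinAt_id t _).const_mul (K₁ + K₂)).fun_sub
      ((hu.energy t ht).const_mul (1 / 2))).const_mul ε).congr_deriv (by ring)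
  have hle : ∀ t ∈ Icc 0 T', |-∫ y in (1 : ℝ)..a, ψ x y * FJ s ν (pjet (u t)) (k - 1) y| ≤
      ε * ((K₁ + K₂) - pairing k a (pjet (u' t)) (pjet (u t))) := fun t ht => by
    have i1 := h₁ _ (hJ t) (hE t ht)
    have i2 := h₂ _ (hJ t) (hE t ht)
    rw [← hu.proj t ht (hE t ht) _ (hu.mem t)] at i1
    have i3 : |∫ y in (1 : ℝ)..a, ψ x y * FJ s ν (pjet (u t)) (k - 1) y| ≤
        ∫ y in (1 : ℝ)..a, ε * |FJ s ν (pjet (u t)) (k - 1) y| := by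
      refine (intervalIntegral.abs_integral_le_integral_abs ha.le).trans
        (integral_mono_Icc ha.le ((hψ x).continuousOn.fun_mul ((hFJ t).cont _)).abs
          (continuousOn_const.fun_mul ((hFJ t).cont _).abs) fun y hy => ?_)
      rw [abs_mul]
      exact mul_le_mul_of_nonneg_right (hψε x hx y hy) (abs_nonneg _)
    rw [intervalIntegral.integral_const_mul] at i3
    rw [abs_neg]
    exact i3.trans (mul_le_mul_of_nonneg_left (by linarith) hε.le)
  have key := abs_sub_le_of_abs_deriv_le hY hg hle ht
  have h0 : (0 : ℝ) ∈ Icc 0 T' := ⟨le_rfl, ht.1.trans ht.2⟩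
  have hsm : ∀ t ∈ Icc 0 T', |∫ y in (1 : ℝ)..a, ψ x y * pjet (u t) (k - 1) y| ≤
      ε * B * (a - 1) := fun t ht => abs_integral_le ha.le fun y hy => by
    rw [abs_mul]
    exact mul_le_mul (hψε x hx y hy) (jet_bound ha (hJ t) (hE t ht) _ (by omega) y hy)
      (abs_nonneg _) hε.le
  have s1 := hsm t ht
  have s2 := hsm 0 h0
  have e1 := hE 0 h0
  have e2 := pairing_self_nonneg k (pjet (u t)) ha
  have tT : (K₁ + K₂) * t ≤ (K₁ + K₂) * T :=
    mul_le_mul_of_nonneg_left (ht.2.trans hT') (by positivity)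
  have fin : ε * ((K₁ + K₂) * t - 1 / 2 * pairing k a (pjet (u t)) (pjet (u t))) -
      ε * ((K₁ + K₂) * 0 - 1 / 2 * pairing k a (pjet (u 0)) (pjet (u 0))) ≤
        ((K₁ + K₂) * T + R) * ε := by
    rw [← mul_sub, mul_comm ε]
    exact mul_le_mul_of_nonneg_right (by linarith) hε.le
  simp only [intervalIntegral.integral_same, sub_zero] at key
  rw [abs_le] at key s1 s2 ⊢
  constructor <;> linarith

/-! ### Limits of Galerkin solutions -/

lemma exists_uniform_limit {X : Type*} [PseudoMetricSpace X] {S : Set X} (hS : IsCompact S)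
    {𝓤 : Ultrafilter ℕ} {w : ℕ → X → ℝ} {B : ℝ} (hb : ∀ᶠ l in (𝓤 : Filter ℕ), ∀ p ∈ S, |w l p| ≤ B)
    (heq : ∀ η > 0, ∃ ρ > 0, ∀ᶠ l in (𝓤 : Filter ℕ), ∀ p ∈ S, ∀ p' ∈ S, dist p p' ≤ ρ →
      |w l p - w l p'| ≤ η) :
    ∃ W : X → ℝ, ContinuousOn W S ∧
      ∀ η > 0, ∀ᶠ l in (𝓤 : Filter ℕ), ∀ p ∈ S, |w l p - W p| ≤ η := by
  have hex : ∀ p, ∃ y, p ∈ S → Filter.Tendsto (fun l => w l p) 𝓤 (nhds y) := fun p => by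
    by_cases hp : p ∈ S
    · have h1 : ∀ᶠ l in (𝓤 : Filter ℕ), w l p ∈ Icc (-B) B :=
        hb.mono fun l hl => abs_le.1 (hl p hp)
      obtain ⟨y, -, hy⟩ := isCompact_Icc.ultrafilter_le_nhds' (𝓤.map fun l => w l p) h1
      exact ⟨y, fun _ => hy⟩
    · exact ⟨0, fun h => absurd h hp⟩
  choose W hW using hex
  have hWe : ∀ η > 0, ∃ ρ > 0, ∀ p ∈ S, ∀ p' ∈ S, dist p p' ≤ ρ → |W p - W p'| ≤ η := fun η hη => by
    obtain ⟨ρ, hρ, h⟩ := heq η hη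
    refine ⟨ρ, hρ, fun p hp p' hp' hd => le_of_tendsto ((hW p hp).sub (hW p' hp')).abs ?_⟩
    exact Filter.mem_of_superset h fun l hl => hl p hp p' hp' hd
  refine ⟨W, ?_, fun η hη => ?_⟩
  · rw [Metric.continuousOn_iff]
    intro p hp ε hε
    obtain ⟨ρ, hρ, h⟩ := hWe (ε / 2) (by linarith)
    refine ⟨ρ, hρ, fun p' hp' hd => ?_⟩
    rw [Real.dist_eq]
    linarith [h p' hp' p hp hd.le]
  · by_contra hne
    rcases S.eq_empty_or_nonempty with rfl | hne0
    · exact hne (Filter.Eventually.of_forall fun l p hp => absurd hp (notMem_empty p))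
    rw [← Ultrafilter.eventually_not] at hne
    have hch : ∀ l, ∃ p, (¬ ∀ p ∈ S, |w l p - W p| ≤ η) → p ∈ S ∧ η < |w l p - W p| := fun l => by
      by_cases h : ∀ p ∈ S, |w l p - W p| ≤ η
      · obtain ⟨p, -⟩ := hne0
        exact ⟨p, fun h' => absurd h h'⟩
      · push Not at h
        obtain ⟨p, hp⟩ := h
        exact ⟨p, fun _ => hp⟩
    choose p hp using hch
    have hmem : ∀ᶠ l in (𝓤 : Filter ℕ), p l ∈ S := hne.mono fun l hl => (hp l hl).1
    obtain ⟨q, hq, hlim⟩ := hS.ultrafilter_le_nhds' (𝓤.map p) hmem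
    obtain ⟨ρ₁, hρ₁, h₁⟩ := heq (η / 4) (by linarith)
    obtain ⟨ρ₂, hρ₂, h₂⟩ := hWe (η / 4) (by linarith)
    have hclose : ∀ᶠ l in (𝓤 : Filter ℕ), dist (p l) q < min ρ₁ ρ₂ :=
      hlim (Metric.ball_mem_nhds q (lt_min hρ₁ hρ₂))
    have hpt : ∀ᶠ l in (𝓤 : Filter ℕ), dist (w l q) (W q) < η / 4 :=
      hW q hq (Metric.ball_mem_nhds _ (by linarith))
    obtain ⟨l, hl⟩ := (((hne.and hclose).and hpt).and h₁).exists
    obtain ⟨⟨⟨a1, a2⟩, a3⟩, a4⟩ := hl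
    obtain ⟨b1, b2⟩ := hp l a1
    have c1 := a4 (p l) b1 q hq (a2.le.trans (min_le_left _ _))
    have c2 := h₂ (p l) b1 q hq (a2.le.trans (min_le_right _ _))
    rw [Real.dist_eq] at a3
    have : |w l (p l) - W (p l)| ≤ |w l (p l) - w l q| + |w l q - W q| + |W (p l) - W q| := by
      have e : w l (p l) - W (p l) = (w l (p l) - w l q) + (w l q - W q) - (W (p l) - W q) := by
        ring
      rw [e]
      exact (abs_sub _ _).trans (add_le_add_left (abs_add_le _ _) _)
    linarith

/-- A sequence of Galerkin solutions with growing dimension and bounded energy. -/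
structure GalSeq (s : ℕ → ℝ → ℝ) (ν a : ℝ) (k : ℕ) (T R K : ℝ) (f : ℕ → ℝ → ℝ) (𝓤 : Ultrafilter ℕ)
    (N : ℕ → ℕ) (u u' : ℕ → ℝ → Polynomial ℝ) : Prop where
  sol : ∀ l, GalSol s ν a k (N l) T R K (u l) (u' l)
  energy : ∀ᶠ l in (𝓤 : Filter ℕ), ∀ t ∈ Icc 0 T, pairing k a (pjet (u l t)) (pjet (u l t)) ≤ R
  top : Filter.Tendsto N 𝓤 Filter.atTop
  init : ∀ j < k, ∀ x ∈ Icc 1 a,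
    Filter.Tendsto (fun l => pjet (u l 0) j x) 𝓤 (nhds (f j x))

section
variable {s : ℕ → ℝ → ℝ} {ν a T R K : ℝ} {k : ℕ} {f : ℕ → ℝ → ℝ} {𝓤 : Ultrafilter ℕ}
  {N : ℕ → ℕ} {u u' : ℕ → ℝ → Polynomial ℝ}

lemma GalSeq.residual (hc : Coef a ν s) (hk : 6 ≤ k) (hT : 0 ≤ T) (hR : 0 ≤ R)
    (h : GalSeq s ν a k T R K f 𝓤 N u u') {η : ℝ} (hη : 0 < η) :
    ∀ᶠ l in (𝓤 : Filter ℕ), ∀ t ∈ Icc 0 T, ∀ x ∈ Icc 1 a,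
      |pjet (u l t) 0 x - pjet (u l 0) 0 x - ∫ r in (0 : ℝ)..t, FJ s ν (pjet (u l r)) 0 x| ≤ η := by
  obtain ⟨C, hC, hres⟩ := galerkin_residual hc hk (K := K) hT hR
  obtain ⟨N₀, hN₀⟩ := hres (η / (C + 1)) (by positivity)
  filter_upwards [h.energy, h.top (Filter.Ici_mem_atTop N₀)] with l hl hN t ht x hx
  refine (hN₀ (N l) hN T le_rfl (u l) (u' l) (h.sol l) hl t ht x hx).trans ?_
  rw [mul_div_assoc', div_le_iff₀ (by positivity)]
  nlinarith

lemma GalSeq.bound (hc : Coef a ν s) (h : GalSeq s ν a k T R K f 𝓤 N u u') :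
    ∀ᶠ l in (𝓤 : Filter ℕ), ∀ j < k, ∀ t ∈ Icc 0 T, ∀ x ∈ Icc 1 a,
      |pjet (u l t) j x| ≤ (2 * R + a) * a ^ k := by
  filter_upwards [h.energy] with l hl j hj t ht x hx
  exact jet_bound hc.one_lt (isJet_pjet a _) (hl t ht) j hj x hx

lemma GalSeq.modulus_time (hc : Coef a ν s) (hk : 6 ≤ k) (hT : 0 ≤ T) (hR : 0 ≤ R)
    (h : GalSeq s ν a k T R K f 𝓤 N u u') (j : ℕ) (hj : j < k) : ∀ η > 0, ∃ ρ > 0,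
      ∀ᶠ l in (𝓤 : Filter ℕ), ∀ t ∈ Icc 0 T, ∀ t' ∈ Icc 0 T, |t - t'| ≤ ρ → ∀ x ∈ Icc 1 a,
        |pjet (u l t) j x - pjet (u l t') j x| ≤ η := by
  have ha := hc.one_lt
  induction j with
  | zero =>
    intro η hη
    obtain ⟨B, hB, hFB⟩ := jev_bound hc (jDF_mem ν 0) ((2 * R + a) * a ^ k)
    refine ⟨η / (2 * (B + 1)), by positivity, ?_⟩
    filter_upwards [h.residual hc hk hT hR (η := η / 4) (by linarith), h.bound hc]
      with l hl hb t ht t' ht' hd x hx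
    have hcF : ContinuousOn (fun r => FJ s ν (pjet (u l r)) 0 x) (Icc 0 T) :=
      jev_continuousOn hc (jDF_mem ν 0) (Z := fun j r => pjet (u l r) j x) continuousOn_const
        (fun _ _ => hx) fun j _ => continuousOn_pjet_time (h.sol l) j x
    have hlip : ∀ t ∈ Icc 0 T, ∀ t' ∈ Icc 0 T, t ≤ t' →
        |(∫ r in (0 : ℝ)..t', FJ s ν (pjet (u l r)) 0 x) -
          ∫ r in (0 : ℝ)..t, FJ s ν (pjet (u l r)) 0 x| ≤ B * (t' - t) := fun t ht t' ht' htt => by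
      rw [intervalIntegral.integral_interval_sub_left
        ((hcF.mono (Icc_subset_Icc_right ht'.2)).intervalIntegrable_of_Icc ht'.1)
        ((hcF.mono (Icc_subset_Icc_right ht.2)).intervalIntegrable_of_Icc ht.1)]
      exact abs_integral_le htt fun r hr => hFB x hx _ fun i hi =>
        hb i (by omega) r ⟨ht.1.trans hr.1, hr.2.trans ht'.2⟩ x hx
    have hI : |(∫ r in (0 : ℝ)..t', FJ s ν (pjet (u l r)) 0 x) -
          ∫ r in (0 : ℝ)..t, FJ s ν (pjet (u l r)) 0 x| ≤ B * |t - t'| := by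
      rcases le_total t t' with htt | htt
      · rw [abs_sub_comm t t', abs_of_nonneg (sub_nonneg.2 htt)]
        exact hlip t ht t' ht' htt
      · rw [abs_of_nonneg (sub_nonneg.2 htt), abs_sub_comm]
        exact hlip t' ht' t ht htt
    have hBd : B * |t - t'| ≤ η / 2 := by
      have : B * |t - t'| ≤ B * (η / (2 * (B + 1))) := mul_le_mul_of_nonneg_left hd hB
      refine this.trans ?_
      rw [mul_div_assoc', div_le_div_iff₀ (by positivity) (by norm_num)]
      nlinarith
    have e1 := hl t ht x hx
    have e2 := hl t' ht' x hx
    rw [abs_le] at e1 e2 hI ⊢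
    constructor <;> linarith
  | succ j ih =>
    intro η hη
    obtain ⟨ρ₀, hρ₀, hmod⟩ := jet_modulus (k := k) ha hR (η := η / 4) (by linarith)
    set ρ₁ := min ρ₀ ((a - 1) / 2) with hρ₁
    have hρ₁0 : 0 < ρ₁ := lt_min hρ₀ (by linarith)
    obtain ⟨ρ, hρ, hi⟩ := ih (by omega) (η * ρ₁ / 4) (by positivity)
    refine ⟨ρ, hρ, ?_⟩
    filter_upwards [hi, h.energy] with l hl hE t ht t' ht' hd
    intro x hx
    have key := abs_deriv_le_of_small (c := 1) (d := a) (δ := η * ρ₁ / 4) (η := η / 2) (ρ := ρ₁)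
      (w := fun x => pjet (u l t) j x - pjet (u l t') j x)
      (fun x hx => (isJet_pjet a (u l t) j x hx).fun_sub (isJet_pjet a (u l t') j x hx)) hρ₁0
      (by have := min_le_right ρ₀ ((a - 1) / 2); linarith) (hl t ht t' ht' hd)
      (fun x hx y hy hxy => by
        have m1 := hmod _ (isJet_pjet a (u l t)) (hE t ht) (j + 1) hj x hx y hy
          (hxy.trans (min_le_left _ _))
        have m2 := hmod _ (isJet_pjet a (u l t')) (hE t' ht') (j + 1) hj x hx y hy
          (hxy.trans (min_le_left _ _))
        rw [abs_le] at m1 m2 ⊢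
        constructor <;> linarith) x hx
    refine key.trans (le_of_eq ?_)
    field_simp
    ring

lemma GalSeq.exists_limit (hc : Coef a ν s) (hk : 6 ≤ k) (hT : 0 ≤ T) (hR : 0 ≤ R)
    (h : GalSeq s ν a k T R K f 𝓤 N u u') : ∃ U : ℕ → ℝ → ℝ → ℝ, ∀ j < k,
      ContinuousOn (fun y : ℝ × ℝ => U j y.1 y.2) (Icc 0 T ×ˢ Icc 1 a) ∧
      ∀ η > 0, ∀ᶠ l in (𝓤 : Filter ℕ), ∀ t ∈ Icc 0 T, ∀ x ∈ Icc 1 a,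
        |pjet (u l t) j x - U j t x| ≤ η := by
  have ha := hc.one_lt
  have hex : ∀ j, ∃ W : ℝ × ℝ → ℝ, j < k → ContinuousOn W (Icc 0 T ×ˢ Icc 1 a) ∧
      ∀ η > 0, ∀ᶠ l in (𝓤 : Filter ℕ), ∀ p ∈ Icc 0 T ×ˢ Icc 1 a,
        |pjet (u l p.1) j p.2 - W p| ≤ η := fun j => by
    by_cases hj : j < k
    · obtain ⟨W, hW⟩ := exists_uniform_limit (𝓤 := 𝓤)
        (S := (Icc 0 T ×ˢ Icc 1 a : Set (ℝ × ℝ))) (isCompact_Icc.prod isCompact_Icc)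
        (w := fun l p => pjet (u l p.1) j p.2)
        ((h.bound hc).mono fun l hl p hp => hl j hj p.1 hp.1 p.2 hp.2) fun η hη => by
          obtain ⟨ρ₁, hρ₁, h₁⟩ := h.modulus_time hc hk hT hR j hj (η / 2) (by linarith)
          obtain ⟨ρ₂, hρ₂, h₂⟩ := jet_modulus (k := k) ha hR (η := η / 2) (by linarith)
          refine ⟨min ρ₁ ρ₂, lt_min hρ₁ hρ₂, ?_⟩
          filter_upwards [h₁, h.energy] with l hl hE p hp p' hp' hd
          rw [Prod.dist_eq, Real.dist_eq, Real.dist_eq] at hd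
          have i1 := hl p.1 hp.1 p'.1 hp'.1 (((le_max_left _ _).trans hd).trans (min_le_left _ _))
            p.2 hp.2
          have i2 := h₂ _ (isJet_pjet a (u l p'.1)) (hE p'.1 hp'.1) j hj p.2 hp.2 p'.2 hp'.2
            (((le_max_right _ _).trans hd).trans (min_le_right _ _))
          rw [abs_le] at i1 i2 ⊢
          constructor <;> linarith
      exact ⟨W, fun _ => hW⟩
    · exact ⟨0, fun h => absurd h hj⟩
  choose W hW using hex
  exact ⟨fun j t x => W j (t, x), fun j hj => ⟨(hW j hj).1, fun η hη =>
    ((hW j hj).2 η hη).mono fun l hl t ht x hx => hl (t, x) ⟨ht, hx⟩⟩⟩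
end

lemma abs_le_of_forall_pos_eventually {𝓤 : Ultrafilter ℕ} {A : ℝ}
    (h : ∀ η > 0, ∀ᶠ _l in (𝓤 : Filter ℕ), |A| ≤ η) : A = 0 := by
  by_contra hne
  obtain ⟨_, hl⟩ := (h (|A| / 2) (by have := abs_pos.2 hne; linarith)).exists
  have := abs_pos.2 hne
  linarith

section
variable {s : ℕ → ℝ → ℝ} {ν a T R K : ℝ} {k : ℕ} {f : ℕ → ℝ → ℝ} {𝓤 : Ultrafilter ℕ}
  {N : ℕ → ℕ} {u u' : ℕ → ℝ → Polynomial ℝ}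

lemma continuousOn_slice_left {S S' : Set ℝ} {G : ℝ → ℝ → ℝ}
    (hG : ContinuousOn (fun y : ℝ × ℝ => G y.1 y.2) (S ×ˢ S')) {t : ℝ} (ht : t ∈ S) :
    ContinuousOn (G t) S' :=
  hG.comp (f := fun x => (t, x)) (by fun_prop) fun _ hx => ⟨ht, hx⟩

lemma continuousOn_slice_right {S S' : Set ℝ} {G : ℝ → ℝ → ℝ}
    (hG : ContinuousOn (fun y : ℝ × ℝ => G y.1 y.2) (S ×ˢ S')) {x : ℝ} (hx : x ∈ S') :
    ContinuousOn (fun t => G t x) S :=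
  hG.comp (f := fun t => (t, x)) (by fun_prop) fun _ ht => ⟨ht, hx⟩

lemma hasDerivWithinAt_of_uniform_limit (ha : 1 < a) {j : ℕ} {u : ℕ → ℝ → Polynomial ℝ}
    {U V : ℝ → ℝ → ℝ} {t : ℝ}
    (hV : ContinuousOn (V t) (Icc 1 a))
    (hu : ∀ η > 0, ∀ᶠ l in (𝓤 : Filter ℕ), ∀ x ∈ Icc 1 a, |pjet (u l t) j x - U t x| ≤ η)
    (hv : ∀ η > 0, ∀ᶠ l in (𝓤 : Filter ℕ), ∀ x ∈ Icc 1 a, |pjet (u l t) (j + 1) x - V t x| ≤ η)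
    {x : ℝ} (hx : x ∈ Icc 1 a) : HasDerivWithinAt (U t) (V t x) (Icc 1 a) x := by
  have h1 : (1 : ℝ) ∈ Icc 1 a := left_mem_Icc.2 ha.le
  have key : ∀ x ∈ Icc 1 a, U t x - U t 1 - ∫ y in (1 : ℝ)..x, V t y = 0 := fun x hx => by
    refine abs_le_of_forall_pos_eventually (𝓤 := 𝓤) fun η hη => ?_
    have ha0 : 0 < a := by linarith
    filter_upwards [hu (η / 4) (by linarith), hv (η / (2 * a)) (by positivity)] with l h₁ h₂
    have hss : Icc 1 x ⊆ Icc 1 a := Icc_subset_Icc_right hx.2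
    have e := integral_eq_sub_of_within (isJet_pjet a (u l t) j) ((isJet_pjet a (u l t)).cont _)
      h1 hx hx.1
    have i1 := abs_integral_le (g := fun y => pjet (u l t) (j + 1) y - V t y) hx.1
      fun y hy => h₂ y (hss hy)
    rw [intervalIntegral.integral_sub
      ((((isJet_pjet a (u l t)).cont _).mono hss).intervalIntegrable_of_Icc hx.1)
      ((hV.mono hss).intervalIntegrable_of_Icc hx.1), e] at i1
    have i2 := h₁ x hx
    have i3 := h₁ 1 h1
    have i4 : η / (2 * a) * (x - 1) ≤ η / 2 := by
      rw [div_mul_eq_mul_div, div_le_div_iff₀ (by positivity) (by norm_num)]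
      nlinarith [hx.2]
    rw [abs_le] at i1 i2 i3 ⊢
    constructor <;> linarith
  refine ((hasDerivWithinAt_integral hV hx).const_add (U t 1)).congr (fun y hy => ?_) ?_
  · linarith [key y hy]
  · linarith [key x hx]

lemma GalSeq.integral_eq (hc : Coef a ν s) (hk : 6 ≤ k) (hT : 0 ≤ T) (hR : 0 ≤ R)
    (h : GalSeq s ν a k T R K f 𝓤 N u u') {U : ℕ → ℝ → ℝ → ℝ}
    (hU : ∀ j < k, ContinuousOn (fun y : ℝ × ℝ => U j y.1 y.2) (Icc 0 T ×ˢ Icc 1 a))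
    (hlim : ∀ j < k, ∀ η > 0, ∀ᶠ l in (𝓤 : Filter ℕ), ∀ t ∈ Icc 0 T, ∀ x ∈ Icc 1 a,
      |pjet (u l t) j x - U j t x| ≤ η) {t x : ℝ} (ht : t ∈ Icc 0 T) (hx : x ∈ Icc 1 a) :
    U 0 t x = U 0 0 x + ∫ r in (0 : ℝ)..t, jev s (jD^[0] (jF ν)) x fun i => U i r x := by
  have h0 : (0 : ℝ) ∈ Icc 0 T := left_mem_Icc.2 hT
  set B := (2 * R + a) * a ^ k with hB
  obtain ⟨L, hL, hlip⟩ := jev_lipschitz hc (jDF_mem ν 0) (B + 1)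
  have key : U 0 t x - U 0 0 x - ∫ r in (0 : ℝ)..t, jev s (jD^[0] (jF ν)) x (fun i => U i r x)
      = 0 := by
    refine abs_le_of_forall_pos_eventually (𝓤 := 𝓤) fun η hη => ?_
    set δ := min 1 (η / (4 * (L * T + 1))) with hδ
    have hδ0 : 0 < δ := lt_min one_pos (by positivity)
    filter_upwards [hlim 0 (by omega) (η / 4) (by linarith), hlim 0 (by omega) δ hδ0,
      hlim 1 (by omega) δ hδ0, hlim 2 (by omega) δ hδ0, h.bound hc,
      h.residual hc hk hT hR (η := η / 4) (by linarith)] with l h1 d0 d1 d2 hb hres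
    have hd : ∀ r ∈ Icc 0 T, ∀ i ≤ 2, |pjet (u l r) i x - U i r x| ≤ δ := fun r hr i hi => by
      interval_cases i
      exacts [d0 r hr x hx, d1 r hr x hx, d2 r hr x hx]
    have hss : Icc 0 t ⊆ Icc 0 T := Icc_subset_Icc_right ht.2
    have c1 : ContinuousOn (fun r => FJ s ν (pjet (u l r)) 0 x) (Icc 0 T) :=
      jev_continuousOn hc (jDF_mem ν 0) (Z := fun j r => pjet (u l r) j x) continuousOn_const
        (fun _ _ => hx) fun j _ => continuousOn_pjet_time (h.sol l) j x
    have c2 : ContinuousOn (fun r => jev s (jD^[0] (jF ν)) x fun i => U i r x) (Icc 0 T) :=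
      jev_continuousOn hc (jDF_mem ν 0) (Z := fun j r => U j r x) continuousOn_const
        (fun _ _ => hx) fun j hj => continuousOn_slice_right (hU j (by omega)) hx
    have i1 := abs_integral_le (g := fun r => FJ s ν (pjet (u l r)) 0 x -
      jev s (jD^[0] (jF ν)) x fun i => U i r x) (K := L * δ) ht.1 fun r hr => by
        have hbr : ∀ i ≤ 2, |pjet (u l r) i x| ≤ B := fun i hi => hb i (by omega) r (hss hr) x hx
        refine hlip x hx _ _ (fun i hi => (hbr i hi).trans (by linarith)) (fun i hi => ?_) δ
          (hd r (hss hr))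
        have b1 := hbr i hi
        have b2 := hd r (hss hr) i hi
        have b3 : δ ≤ 1 := min_le_left _ _
        rw [abs_le] at b1 b2 ⊢
        constructor <;> linarith
    rw [intervalIntegral.integral_sub ((c1.mono hss).intervalIntegrable_of_Icc ht.1)
      ((c2.mono hss).intervalIntegrable_of_Icc ht.1)] at i1
    have i2 := h1 t ht x hx
    have i3 := h1 0 h0 x hx
    have i4 := hres t ht x hx
    have i5 : L * δ * (t - 0) ≤ η / 4 := by
      have f1 : L * δ * (t - 0) ≤ (L * T) * δ := by
        have : δ * (t - 0) ≤ δ * T := mul_le_mul_of_nonneg_left (by linarith [ht.2]) hδ0.le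
        nlinarith
      have f2 : L * T * δ ≤ L * T * (η / (4 * (L * T + 1))) :=
        mul_le_mul_of_nonneg_left (min_le_right _ _) (by positivity)
      refine f1.trans (f2.trans ?_)
      have hLT : 0 ≤ L * T := by positivity
      rw [mul_div_assoc', div_le_div_iff₀ (by positivity) (by norm_num)]
      nlinarith
    rw [abs_le] at i1 i2 i3 i4 ⊢
    constructor <;> linarith
  linarith

/-- Galerkin solutions of bounded energy converge to a solution of the flow. -/
theorem GalSeq.exists_jetSol (hc : Coef a ν s) (hk : 6 ≤ k) (hT : 0 ≤ T) (hR : 0 ≤ R)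
    (hf : IsJet a f) (h : GalSeq s ν a k T R K f 𝓤 N u u') :
    ∃ U : ℕ → ℝ → ℝ → ℝ, JetSol s ν a k T f U ∧
      ∀ j < k, ∀ η > 0, ∀ᶠ l in (𝓤 : Filter ℕ), ∀ t ∈ Icc 0 T, ∀ x ∈ Icc 1 a,
        |pjet (u l t) j x - U j t x| ≤ η := by
  have ha := hc.one_lt
  have h0 : (0 : ℝ) ∈ Icc 0 T := left_mem_Icc.2 hT
  obtain ⟨U, hU⟩ := h.exists_limit hc hk hT hR
  have hcont := fun j hj => (hU j hj).1
  have hlim := fun j hj => (hU j hj).2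
  have hdx : ∀ j, j + 1 < k → ∀ t ∈ Icc 0 T, ∀ x ∈ Icc 1 a,
      HasDerivWithinAt (U j t) (U (j + 1) t x) (Icc 1 a) x := fun j hj t ht x hx =>
    hasDerivWithinAt_of_uniform_limit (𝓤 := 𝓤) (j := j) (u := u) (V := U (j + 1)) ha
      (continuousOn_slice_left (hcont _ hj) ht)
      (fun η hη => (hlim j (by omega) η hη).mono fun l hl => hl t ht)
      (fun η hη => (hlim (j + 1) hj η hη).mono fun l hl => hl t ht) hx
  have hinit : ∀ j < k, ∀ x ∈ Icc 1 a, U j 0 x = f j x := fun j hj x hx => by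
    have h1 : Filter.Tendsto (fun l => pjet (u l 0) j x) 𝓤 (nhds (U j 0 x)) := by
      rw [Metric.tendsto_nhds]
      intro ε hε
      filter_upwards [hlim j hj (ε / 2) (by linarith)] with l hl
      rw [Real.dist_eq]
      linarith [hl 0 h0 x hx]
    exact tendsto_nhds_unique h1 (h.init j hj x hx)
  have hFc : ∀ j, j + 2 < k → ContinuousOn (fun y : ℝ × ℝ =>
      jev s (jD^[j] (jF ν)) y.2 fun i => U i y.1 y.2) (Icc 0 T ×ˢ Icc 1 a) := fun j hj =>
    jev_continuousOn hc (jDF_mem ν j) (Z := fun i (y : ℝ × ℝ) => U i y.1 y.2)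
      continuousOn_snd (fun y hy => hy.2) fun i hi => hcont i (by omega)
  have hint : ∀ j, j + 2 < k → ∀ t ∈ Icc 0 T, ∀ x ∈ Icc 1 a, U j t x =
      f j x + ∫ r in (0 : ℝ)..t, jev s (jD^[j] (jF ν)) x fun i => U i r x := by
    intro j
    induction j with
    | zero =>
      intro hj t ht x hx
      rw [← hinit 0 (by omega) x hx]
      exact h.integral_eq hc hk hT hR hcont hlim ht hx
    | succ j ih =>
      intro hj t ht x hx
      have d1 := hasDerivWithinAt_integral_param
        (G := fun t x => jev s (jD^[j] (jF ν)) x fun i => U i t x)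
        (G' := fun t x => jev s (jD^[j + 1] (jF ν)) x fun i => U i t x) (hFc j (by omega)) (hFc _ hj)
        (fun t ht x hx => by
          have := jev_hasDerivWithinAt hc (jDF_mem ν j) hx (z := fun i => U i t)
            fun i hi => hdx i (by omega) t ht x hx
          rwa [← Function.iterate_succ_apply' jD j (jF ν)] at this) ht hx
      have d2 := ((hf j x hx).fun_add d1).congr (fun y hy => ih (by omega) t ht y hy)
        (ih (by omega) t ht x hx)
      exact (hc.uniqueDiff hx).eq_deriv _ (hdx j (by omega) t ht x hx) d2
  refine ⟨U, ⟨hcont, hdx, fun j hj t ht x hx => ?_, hinit⟩, hlim⟩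
  have d := (hasDerivWithinAt_integral (continuousOn_slice_right
    (G := fun t x => jev s (jD^[j] (jF ν)) x fun i => U i t x) (hFc j hj) hx) ht).const_add (f j x)
  exact d.congr (fun r hr => hint j hj r hr x hx) (hint j hj t ht x hx)
end

/-! ### Existence on long time intervals -/

lemma exists_pjet_near {a : ℝ} (ha : 1 < a) (k : ℕ) {f : ℕ → ℝ → ℝ} (hf : IsJet a f) {ε : ℝ}
    (hε : 0 < ε) : ∃ P : Polynomial ℝ, ∀ j ≤ k, ∀ x ∈ Icc 1 a, |pjet P j x - f j x| ≤ ε := by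
  induction k generalizing f ε with
  | zero =>
    obtain ⟨P, hP⟩ := exists_polynomial_near_of_continuousOn 1 a (f 0) (hf.cont 0) ε hε
    refine ⟨P, fun j hj x hx => ?_⟩
    obtain rfl : j = 0 := by omega
    exact (hP x hx).le
  | succ k ih =>
    have ha0 : 0 < a := by linarith
    have h1 : (1 : ℝ) ∈ Icc 1 a := left_mem_Icc.2 ha.le
    obtain ⟨Q, hQ⟩ := ih (f := fun j => f (j + 1)) (ε := ε / a) (fun j x hx => hf (j + 1) x hx)
      (by positivity)
    obtain ⟨P₀, hP₀, -⟩ := exists_iterate_antideriv 1 Q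
    have hεa : ε / a ≤ ε := div_le_self hε.le ha.le
    set P := P₀ + Polynomial.C (f 0 1 - P₀.eval 1) with hP
    have hP' : Polynomial.derivative P = Q := by
      rw [hP, map_add, Polynomial.derivative_C, add_zero]; exact hP₀
    have hs : ∀ j x, pjet P (j + 1) x = pjet Q j x := fun j x => by
      rw [pjet, Function.iterate_succ_apply, hP', pjet]
    have h01 : pjet P 0 1 = f 0 1 := by simp [pjet, hP]
    refine ⟨P, fun j hj x hx => ?_⟩
    rcases j with _ | j
    · have hss : Icc 1 x ⊆ Icc 1 a := Icc_subset_Icc_right hx.2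
      have i1 := abs_integral_le (g := fun y => pjet P 1 y - f 1 y) (K := ε / a) hx.1 fun y hy => by
        rw [hs 0 y]; exact hQ 0 (by omega) y (hss hy)
      have i2 := integral_eq_sub_of_within
        (fun y hy => (isJet_pjet a P 0 y hy).fun_sub (hf 0 y hy))
        (((isJet_pjet a P).cont 1).fun_sub (hf.cont 1)) h1 hx hx.1
      rw [i2, h01, sub_self, sub_zero] at i1
      refine i1.trans ?_
      rw [div_mul_eq_mul_div, div_le_iff₀ ha0]
      nlinarith [hx.2]
    · rw [hs]
      exact (hQ j (by omega) x hx).trans hεa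

lemma pairing_self_le {a B : ℝ} (ha : 1 < a) {k : ℕ} {U : ℕ → ℝ → ℝ}
    (hb : ∀ j ≤ k, ∀ x ∈ Icc 1 a, |U j x| ≤ B) : pairing k a U U ≤ k * B ^ 2 + B ^ 2 * (a - 1) := by
  have h1 : (1 : ℝ) ∈ Icc 1 a := left_mem_Icc.2 ha.le
  have sq : ∀ j ≤ k, ∀ x ∈ Icc 1 a, |U j x * U j x| ≤ B ^ 2 := fun j hj x hx => by
    rw [abs_mul, ← pow_two]
    exact pow_le_pow_left₀ (abs_nonneg _) (hb j hj x hx) 2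
  refine add_le_add ?_ ((le_abs_self _).trans (abs_integral_le ha.le (sq k le_rfl)))
  refine (Finset.sum_le_card_nsmul _ _ (B ^ 2) fun j hj => ?_).trans (by simp)
  exact (le_abs_self _).trans (sq j (Finset.mem_range.1 hj).le 1 h1)

lemma le_add_mul_of_deriv_le {T L : ℝ} {E E' : ℝ → ℝ}
    (hE : ∀ t ∈ Icc 0 T, HasDerivWithinAt E (E' t) (Icc 0 T) t) (hL : ∀ t ∈ Icc 0 T, E' t ≤ L)
    {r t : ℝ} (hr : r ∈ Icc 0 T) (ht : t ∈ Icc 0 T) (hrt : r ≤ t) : E t ≤ E r + L * (t - r) := by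
  have hd : ∀ t ∈ Icc 0 T, HasDerivWithinAt (fun t => E t - L * t) (E' t - L) (Icc 0 T) t :=
    fun t ht => ((hE t ht).fun_sub ((hasDerivWithinAt_id t _).const_mul L)).congr_deriv (by ring)
  have := antitoneOn_of_hasDerivWithinAt_nonpos (convex_Icc 0 T)
    (fun t ht => (hd t ht).continuousWithinAt)
    (fun t ht => (hd t (interior_subset ht)).mono interior_subset)
    (fun t ht => by linarith [hL t (interior_subset ht)]) hr ht hrt
  simp only at this
  linarith

lemma one_add_le_exp_of_deriv_le {T C : ℝ} {E E' : ℝ → ℝ}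
    (hE : ∀ t ∈ Icc 0 T, HasDerivWithinAt E (E' t) (Icc 0 T) t)
    (hC : ∀ t ∈ Icc 0 T, E' t ≤ C * (1 + E t)) {t : ℝ} (ht : t ∈ Icc 0 T) :
    1 + E t ≤ (1 + E 0) * exp (C * t) := by
  have hd : ∀ t ∈ Icc 0 T, HasDerivWithinAt (fun t => (1 + E t) * exp (-(C * t)))
      ((E' t - C * (1 + E t)) * exp (-(C * t))) (Icc 0 T) t := fun t ht => by
    have h2 : HasDerivWithinAt (fun t : ℝ => exp (-(C * t))) (exp (-(C * t)) * -C) (Icc 0 T) t := by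
      have := (((hasDerivAt_id t).const_mul C).fun_neg).exp.hasDerivWithinAt (s := Icc 0 T)
      simpa using this
    exact (((hE t ht).const_add 1).fun_mul h2).congr_deriv (by ring)
  have := antitoneOn_of_hasDerivWithinAt_nonpos (convex_Icc 0 T)
    (fun t ht => (hd t ht).continuousWithinAt)
    (fun t ht => (hd t (interior_subset ht)).mono interior_subset)
    (fun t ht => mul_nonpos_of_nonpos_of_nonneg (by linarith [hC t (interior_subset ht)])
      (exp_pos _).le) ⟨le_rfl, ht.1.trans ht.2⟩ ht ht.1
  simp only [mul_zero, neg_zero, exp_zero, mul_one, exp_neg] at this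
  rwa [← div_eq_mul_inv, div_le_iff₀ (exp_pos _)] at this

section
variable {s : ℕ → ℝ → ℝ} {ν a T R K M C S E₀ : ℝ} {k : ℕ} {f : ℕ → ℝ → ℝ} {N : ℕ → ℕ}
  {u u' : ℕ → ℝ → Polynomial ℝ}

/-- The a priori bounds for the flow improve the energy bound of Galerkin solutions. -/
lemma energy_le_of_energy_le (hc : Coef a ν s) (hk : 6 ≤ k) (hT : 0 ≤ T) (hR : 0 ≤ R)
    (hf : IsJet a f) (hsol : ∀ l, GalSol s ν a k (N l) T R K (u l) (u' l))
    (hN : Filter.Tendsto N Filter.atTop Filter.atTop)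
    (hinit : ∀ j < k, ∀ x ∈ Icc 1 a,
      Filter.Tendsto (fun l => pjet (u l 0) j x) Filter.atTop (nhds (f j x)))
    (hE₀ : ∀ l, pairing k a (pjet (u l 0)) (pjet (u l 0)) ≤ E₀)
    (hS : ∀ U, JetSol s ν a k T f U → ∀ t ∈ Icc 0 T, ∀ x ∈ Icc 1 a, ∀ j ≤ k - 2, |U j t x| ≤ S)
    (hC0 : 0 ≤ C)
    (hC : ∀ U : ℕ → ℝ → ℝ, IsJet a U → (∀ i ≤ k - 2, ∀ x ∈ Icc 1 a, |U i x| ≤ S + 1) →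
      pairing k a (FJ s ν U) U ≤ C * (1 + pairing k a U U))
    (hM : (1 + E₀) * exp (2 * C * T) ≤ M)
    (hE : ∀ᶠ l in Filter.atTop, ∀ t ∈ Icc 0 T, pairing k a (pjet (u l t)) (pjet (u l t)) ≤ R) :
    ∀ᶠ l in Filter.atTop, ∀ t ∈ Icc 0 T, pairing k a (pjet (u l t)) (pjet (u l t)) ≤ M := by
  have ha := hc.one_lt
  by_contra hbad
  have hne := Filter.frequently_iff_neBot.1 (Filter.not_eventually.1 hbad)
  set 𝓤 := Ultrafilter.of (Filter.atTop ⊓ Filter.principal {l | ¬ ∀ t ∈ Icc 0 T,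
    pairing k a (pjet (u l t)) (pjet (u l t)) ≤ M}) with h𝓤
  have hle : (𝓤 : Filter ℕ) ≤ Filter.atTop := (Ultrafilter.of_le _).trans inf_le_left
  have hbad' : ∀ᶠ l in (𝓤 : Filter ℕ), ¬ ∀ t ∈ Icc 0 T,
      pairing k a (pjet (u l t)) (pjet (u l t)) ≤ M :=
    ((Ultrafilter.of_le _).trans inf_le_right) (Filter.mem_principal_self _)
  have hseq : GalSeq s ν a k T R K f 𝓤 N u u' :=
    ⟨hsol, hE.filter_mono hle, hN.mono_left hle, fun j hj x hx => (hinit j hj x hx).mono_left hle⟩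
  obtain ⟨U, hU, hlim⟩ := hseq.exists_jetSol hc hk hT hR hf
  have hUS := hS U hU
  have hall : ∀ᶠ l in (𝓤 : Filter ℕ), ∀ j ∈ Finset.range (k - 1), ∀ t ∈ Icc 0 T, ∀ x ∈ Icc 1 a,
      |pjet (u l t) j x - U j t x| ≤ 1 :=
    (Filter.eventually_all_finset _).2 fun j hj =>
      hlim j (by have := Finset.mem_range.1 hj; omega) 1 one_pos
  obtain ⟨l, ⟨hl, hlE⟩, hlb⟩ := ((hall.and (hE.filter_mono hle)).and hbad').exists
  refine hlb fun t ht => ?_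
  have hder : ∀ t ∈ Icc 0 T, 2 * pairing k a (pjet (u' l t)) (pjet (u l t)) ≤
      2 * C * (1 + pairing k a (pjet (u l t)) (pjet (u l t))) := fun t ht => by
    rw [(hsol l).proj t ht (hlE t ht) _ ((hsol l).mem t)]
    have := hC _ (isJet_pjet a (u l t)) fun i hi x hx => by
      have b1 := hl i (Finset.mem_range.2 (by omega)) t ht x hx
      have b2 := hUS t ht x hx i hi
      rw [abs_le] at b1 b2 ⊢
      constructor <;> linarith
    linarith
  have key := one_add_le_exp_of_deriv_le (hsol l).energy hder ht
  have h1 : exp (2 * C * t) ≤ exp (2 * C * T) :=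
    exp_le_exp.2 (mul_le_mul_of_nonneg_left ht.2 (by positivity))
  have h2 := pairing_self_nonneg k (pjet (u l 0)) ha
  have h3 : (1 + pairing k a (pjet (u l 0)) (pjet (u l 0))) * exp (2 * C * t) ≤
      (1 + E₀) * exp (2 * C * T) :=
    mul_le_mul (by linarith [hE₀ l]) h1 (exp_pos _).le (by linarith [hE₀ l])
  linarith
end

/-- Solutions with finitely many derivatives exist on long time intervals. -/
theorem exists_jetSol {s f : ℕ → ℝ → ℝ} {ν a : ℝ} (hc : Coef a ν s) (hf : Init a ν f)
    (hf' : IsJet a f) {k : ℕ} (hk : 6 ≤ k) {T : ℝ} (hT : 0 ≤ T) :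
    ∃ U : ℕ → ℝ → ℝ → ℝ, JetSol s ν a k T f U := by
  have ha := hc.one_lt
  have ha1 : 0 ≤ a - 1 := by linarith
  choose w hw using fun l : ℕ => exists_pjet_near ha k hf' (ε := 1 / ((l : ℝ) + 1)) (by positivity)
  choose B hB hfB using fun j => hf.bound j
  set B₀ := ∑ j ∈ Finset.range (k + 1), B j + 1 with hB₀
  have hwb : ∀ l, ∀ j ≤ k, ∀ x ∈ Icc 1 a, |pjet (w l) j x| ≤ B₀ := fun l j hj x hx => by
    have b1 := hw l j hj x hx
    have b2 := hfB j x hx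
    have b3 : 1 / ((l : ℝ) + 1) ≤ 1 := by
      rw [div_le_one (by positivity)]; linarith [(Nat.cast_nonneg l : (0 : ℝ) ≤ l)]
    have b4 := Finset.single_le_sum (f := B) (fun i _ => hB i)
      (Finset.mem_range.2 (Nat.lt_succ_of_le hj))
    rw [abs_le] at b1 b2 ⊢
    constructor <;> linarith
  set E₀ := (k : ℝ) * B₀ ^ 2 + B₀ ^ 2 * (a - 1) with hE₀
  have hE₀0 : 0 ≤ E₀ := by positivity
  have hwE : ∀ l, pairing k a (pjet (w l)) (pjet (w l)) ≤ E₀ := fun l =>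
    pairing_self_le ha (hwb l)
  obtain ⟨S, hS0, hS⟩ := apriori hc hf (k := k) (by omega) T
  obtain ⟨C, hC0, hC⟩ := pairing_FJ_le hc hk (S + 1) (by linarith)
  have hC' : ∀ U : ℕ → ℝ → ℝ, IsJet a U → (∀ i ≤ k - 2, ∀ x ∈ Icc 1 a, |U i x| ≤ S + 1) →
      pairing k a (FJ s ν U) U ≤ C * (1 + pairing k a U U) := fun U hU hb => by
    have := hC U hU hb
    have := diss_nonneg hc k U
    linarith
  set M := (1 + E₀) * exp (2 * C * T) with hM
  have hM1 : 1 + E₀ ≤ M := by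
    have : 1 ≤ exp (2 * C * T) := one_le_exp (by positivity)
    nlinarith
  obtain ⟨K, hK0, hK⟩ := pairing_FJ_le_of_energy hc hk (M + 1 + 1) (by linarith)
  have hK' : ∀ U : ℕ → ℝ → ℝ, IsJet a U → pairing k a U U ≤ M + 1 + 1 →
      pairing k a (FJ s ν U) U ≤ K := fun U hU hE => by
    have := hK U hU hE
    have := diss_nonneg hc k U
    linarith
  set N : ℕ → ℕ := fun l => (w l).natDegree + l + 1 with hN
  have hNt : Filter.Tendsto N Filter.atTop Filter.atTop :=
    Filter.tendsto_atTop_mono (fun l => by simp only [hN, id]; omega) Filter.tendsto_id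
  choose u u' hu0 hsol using fun l => exists_galSol hc (N := N l) (k := k) (by omega)
    (by simp [hN]) hT (R := M + 1) (by linarith) hK' (P := w l)
    (mem_degreeLT_of_natDegree_lt (by simp only [hN]; omega))
  have hinit : ∀ j < k, ∀ x ∈ Icc 1 a,
      Filter.Tendsto (fun l => pjet (u l 0) j x) Filter.atTop (nhds (f j x)) := fun j hj x hx => by
    rw [tendsto_iff_dist_tendsto_zero]
    refine squeeze_zero (fun _ => dist_nonneg) (fun l => ?_) tendsto_one_div_add_atTop_nhds_zero_nat
    rw [hu0, Real.dist_eq]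
    exact hw l j hj.le x hx
  have hE0 : ∀ l, pairing k a (pjet (u l 0)) (pjet (u l 0)) ≤ E₀ := fun l => by
    rw [hu0]; exact hwE l
  set τ := 1 / (2 * K + 1) with hτ
  have hτ0 : 0 < τ := by positivity
  have hKτ : 2 * K * τ ≤ 1 := by
    rw [hτ, mul_one_div, div_le_one (by positivity)]; linarith
  have hstep : ∀ i : ℕ, ∀ᶠ l in Filter.atTop, ∀ t ∈ Icc 0 (min (i * τ) T),
      pairing k a (pjet (u l t)) (pjet (u l t)) ≤ M := by
    intro i
    induction i with
    | zero =>
      refine Filter.Eventually.of_forall fun l t ht => ?_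
      have h2 : t ≤ 0 := by simpa using ht.2.trans (min_le_left _ _)
      rw [le_antisymm h2 ht.1]
      linarith [hE0 l]
    | succ i ih =>
      have hiτ : 0 ≤ (i : ℝ) * τ := by positivity
      have hsτ : ((i + 1 : ℕ) : ℝ) * τ = i * τ + τ := by push_cast; ring
      have hT'0 : 0 ≤ min (((i + 1 : ℕ) : ℝ) * τ) T := le_min (by positivity) hT
      have hT'T : min (((i + 1 : ℕ) : ℝ) * τ) T ≤ T := min_le_right _ _
      refine energy_le_of_energy_le hc hk hT'0 (R := M + 1) (by linarith) hf'
        (fun l => (hsol l).mono hT'T) hNt hinit hE0 (fun U hU => hS _ hT'T U hU) hC0 hC'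
        (mul_le_mul_of_nonneg_left (exp_le_exp.2 (mul_le_mul_of_nonneg_left hT'T (by positivity)))
          (by linarith)) ?_
      filter_upwards [ih] with l hl t ht
      rcases le_or_gt t (min (i * τ) T) with h | h
      · linarith [hl t ⟨ht.1, h⟩]
      · have hr0 : 0 ≤ min ((i : ℝ) * τ) T := le_min hiτ hT
        have h1 := le_add_mul_of_deriv_le (L := 2 * K) (hsol l).energy
          (fun t ht => by linarith [(hsol l).energy_le t ht]) ⟨hr0, min_le_right _ _⟩
          ⟨ht.1, ht.2.trans hT'T⟩ h.le
        have h2 := hl _ ⟨hr0, le_rfl⟩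
        have h3 : t - min ((i : ℝ) * τ) T ≤ τ := by
          rcases le_total ((i : ℝ) * τ) T with hm | hm
          · rw [min_eq_left hm]
            have := ht.2.trans (min_le_left _ _)
            linarith
          · rw [min_eq_right hm]
            linarith [ht.2.trans hT'T]
        have h4 : 2 * K * (t - min ((i : ℝ) * τ) T) ≤ 2 * K * τ :=
          mul_le_mul_of_nonneg_left h3 (by positivity)
        linarith
  obtain ⟨i, hi⟩ := exists_nat_ge (T / τ)
  have hiT : min ((i : ℝ) * τ) T = T := min_eq_right ((div_le_iff₀ hτ0).1 hi)
  have hfin := hstep i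
  rw [hiT] at hfin
  have hle : (Filter.hyperfilter ℕ : Filter ℕ) ≤ Filter.atTop := Nat.hyperfilter_le_atTop
  obtain ⟨U, hU, -⟩ := GalSeq.exists_jetSol hc hk hT (R := M + 1) (by linarith) hf'
    (𝓤 := Filter.hyperfilter ℕ) (N := N) (u := u) (u' := u') ⟨hsol, (hfin.mono fun l hl t ht =>
      by linarith [hl t ht]).filter_mono hle, hNt.mono_left hle,
      fun j hj x hx => (hinit j hj x hx).mono_left hle⟩
  exact ⟨U, hU⟩

/-! ### Uniqueness and the global solution -/

section
variable {a ν T : ℝ} {s f : ℕ → ℝ → ℝ} {k : ℕ} {U V : ℕ → ℝ → ℝ → ℝ}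

lemma JetSol.mono (hU : JetSol s ν a k T f U) {k' : ℕ} {T' : ℝ} (hk : k' ≤ k) (hT : T' ≤ T) :
    JetSol s ν a k' T' f U := by
  have hss : Icc 0 T' ⊆ Icc 0 T := Icc_subset_Icc_right hT
  exact ⟨fun j hj => (hU.cont j (by omega)).mono (prod_mono hss subset_rfl),
    fun j hj t ht => hU.dx j (by omega) t (hss ht),
    fun j hj t ht x hx => (hU.dt j (by omega) t (hss ht) x hx).mono hss,
    fun j hj => hU.init j (by omega)⟩

lemma JetSol.congr (hU : JetSol s ν a k T f U) (hT : 0 ≤ T)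
    (h : ∀ j < k, ∀ t ∈ Icc 0 T, ∀ x ∈ Icc 1 a, V j t x = U j t x) : JetSol s ν a k T f V := by
  refine ⟨fun j hj => (hU.cont j hj).congr fun y hy => h j hj _ hy.1 _ hy.2, ?_, ?_,
    fun j hj x hx => (h j hj 0 ⟨le_rfl, hT⟩ x hx).trans (hU.init j hj x hx)⟩
  · intro j hj t ht x hx
    rw [h (j + 1) hj t ht x hx]
    exact (hU.dx j hj t ht x hx).congr (fun y hy => h j (by omega) t ht y hy)
      (h j (by omega) t ht x hx)
  · intro j hj t ht x hx
    rw [jev_congr (jDF_mem ν j) fun i hi => h i (by omega) t ht x hx]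
    exact (hU.dt j hj t ht x hx).congr (fun r hr => h j (by omega) r hr x hx)
      (h j (by omega) t ht x hx)

lemma zeroth_order_sub_le {x u v c M N : ℝ} (hx : 1 ≤ x) (hu : |u| ≤ M) (hv : |v| ≤ M)
    (hc : |c| ≤ N) (huv : v ≤ u) :
    (c - u) * (1 / (x ^ 2 + u ^ 2)) - (c - v) * (1 / (x ^ 2 + v ^ 2)) ≤
      (2 * N * M + M ^ 2) * (u - v) := by
  have hM : 0 ≤ M := (abs_nonneg _).trans hu
  have hN : 0 ≤ N := (abs_nonneg _).trans hc
  have h1 : 1 ≤ x ^ 2 + u ^ 2 := by nlinarith [sq_nonneg u]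
  have h2 : 1 ≤ x ^ 2 + v ^ 2 := by nlinarith [sq_nonneg v]
  have hD : 1 ≤ (x ^ 2 + u ^ 2) * (x ^ 2 + v ^ 2) := one_le_mul_of_one_le_of_one_le h1 h2
  have e : (c - u) * (1 / (x ^ 2 + u ^ 2)) - (c - v) * (1 / (x ^ 2 + v ^ 2)) =
      (-c * (u + v) + u * v - x ^ 2) * (u - v) / ((x ^ 2 + u ^ 2) * (x ^ 2 + v ^ 2)) := by
    field_simp
    ring
  have huv' : |u + v| ≤ 2 * M := (abs_add_le u v).trans (by linarith)
  have b1 : -c * (u + v) ≤ N * (2 * M) := by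
    refine (le_abs_self _).trans ?_
    rw [abs_mul, abs_neg]
    gcongr
  have b2 : u * v ≤ M * M := by
    refine (le_abs_self _).trans ?_
    rw [abs_mul]
    gcongr
  have hK : 0 ≤ 2 * N * M + M ^ 2 := by positivity
  rw [e, div_le_iff₀ (by linarith)]
  have b3 : -c * (u + v) + u * v - x ^ 2 ≤ 2 * N * M + M ^ 2 := by nlinarith
  calc _ ≤ (2 * N * M + M ^ 2) * (u - v) := mul_le_mul_of_nonneg_right b3 (by linarith)
    _ ≤ _ := le_mul_of_one_le_right (mul_nonneg hK (by linarith)) hD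

lemma JetSol.le (hc : Coef a ν s) (hk : 4 ≤ k) (hU : JetSol s ν a k T f U)
    (hV : JetSol s ν a k T f V) : ∀ t ∈ Icc 0 T, ∀ x ∈ Icc 1 a, U 0 t x ≤ V 0 t x := by
  have hcomp : IsCompact (Icc 0 T ×ˢ Icc (1 : ℝ) a) := isCompact_Icc.prod isCompact_Icc
  obtain ⟨M₁, hM₁⟩ := hcomp.exists_bound_of_continuousOn (hU.cont 0 (by omega))
  obtain ⟨M₂, hM₂⟩ := hcomp.exists_bound_of_continuousOn (hV.cont 0 (by omega))
  obtain ⟨M₃, hM₃⟩ := hcomp.exists_bound_of_continuousOn (hU.cont 1 (by omega))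
  obtain ⟨S, hS0, hS⟩ := hc.bound 0
  have ha := hc.one_lt
  have hν := hc.two_le
  set M := max M₁ M₂
  intro t ht x hx
  have hM0 : 0 ≤ M := ((norm_nonneg _).trans (hM₁ (t, x) ⟨ht, hx⟩)).trans (le_max_left _ _)
  have hN0 : 0 ≤ a * M₃ :=
    mul_nonneg (by linarith) ((norm_nonneg _).trans (hM₃ (t, x) ⟨ht, hx⟩))
  have hK : 0 ≤ 2 * (a * M₃) * M + M ^ 2 := by positivity
  refine sub_nonpos.1 (max_principle (T := T) (C := S * (ν * (2 * (a * M₃) * M + M ^ 2)))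
    (isCompact_Icc (a := (1 : ℝ)) (b := a)) (φ := fun t x => U 0 t x - V 0 t x)
    ((hU.cont 0 (by omega)).sub (hV.cont 0 (by omega))) ?_ ?_ t ht x hx)
  · intro x hx
    simp only [hU.init 0 (by omega) x hx, hV.init 0 (by omega) x hx, sub_self, le_refl]
  · intro t ht _ x hx hpos hmax
    refine ⟨_, (hU.dt 0 (by omega) t ht x hx).fun_sub (hV.dt 0 (by omega) t ht x hx), ?_⟩
    simp only [Function.iterate_zero, id, jF_eq, jH, jev_mul, jev_add, jev_sub, jev_p, jev_q,
      jev_u, jev_C, jev_x, jev_sg]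
    have hdx := fun y hy => (hU.dx 0 (by omega) t ht y hy).fun_sub (hV.dx 0 (by omega) t ht y hy)
    have hdx1 := (hU.dx 1 (by omega) t ht x hx).fun_sub (hV.dx 1 (by omega) t ht x hx)
    have hL : 0 ≤ S * (ν * (2 * (a * M₃) * M + M ^ 2)) * (U 0 t x - V 0 t x) := by positivity
    rcases hx.1.eq_or_lt with e | h1
    · rw [← e] at hL ⊢
      simpa [hc.left] using hL
    rcases hx.2.eq_or_lt with e | h2
    · rw [e] at hL ⊢
      simpa [hc.right] using hL
    have hl := deriv_mul_sub_nonpos_of_max hx hmax (hdx x hx) hc.left_mem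
    have hr := deriv_mul_sub_nonpos_of_max hx hmax (hdx x hx) hc.right_mem
    have h10 : U 1 t x - V 1 t x = 0 := le_antisymm (by simp only [zero_add] at hr; nlinarith)
      (by simp only [zero_add] at hl; nlinarith)
    have h20 := second_deriv_nonpos_of_max hx h2 hmax hdx hdx1 h10
    have hV1 : V 1 t x = U 1 t x := by linarith
    rw [hV1]
    have hz := zeroth_order_sub_le (x := x) (u := U 0 t x) (v := V 0 t x) (c := x * U 1 t x)
      (M := M) (N := a * M₃) hx.1 ((hM₁ (t, x) ⟨ht, hx⟩).trans (le_max_left _ _))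
      ((hM₂ (t, x) ⟨ht, hx⟩).trans (le_max_right _ _)) (by
        rw [abs_mul, abs_of_nonneg (by linarith : (0 : ℝ) ≤ x)]
        exact mul_le_mul hx.2 (hM₃ (t, x) ⟨ht, hx⟩) (abs_nonneg _) (by linarith)) (by linarith)
    have hp : (0 : ℝ) ≤ 1 / (1 + U 1 t x ^ 2) := by positivity
    have hs0 := hc.nonneg x hx
    have hsS := (le_abs_self _).trans (hS x hx)
    have e1 := mul_nonneg hs0 (mul_nonneg hp (neg_nonneg.2 h20))
    have e2 := mul_le_mul_of_nonneg_left hz (mul_nonneg hs0 (by linarith : 0 ≤ ν))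
    have e3 := mul_le_mul_of_nonneg_right hsS
      (by positivity : 0 ≤ (ν * (2 * (a * M₃) * M + M ^ 2)) * (U 0 t x - V 0 t x))
    norm_num only at e1
    generalize 1 / (1 + U 1 t x ^ 2) = p at *
    generalize 1 / (x ^ 2 + U 0 t x ^ 2) = q at *
    generalize 1 / (x ^ 2 + V 0 t x ^ 2) = q' at *
    linarith

/-- Solutions of the flow are unique. -/
theorem JetSol.unique (hc : Coef a ν s) (hk : 4 ≤ k) (hU : JetSol s ν a k T f U)
    (hV : JetSol s ν a k T f V) {j : ℕ} (hj : j < k) :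
    ∀ t ∈ Icc 0 T, ∀ x ∈ Icc 1 a, U j t x = V j t x := by
  induction j with
  | zero => exact fun t ht x hx => le_antisymm (hU.le hc hk hV t ht x hx) (hV.le hc hk hU t ht x hx)
  | succ j ih =>
    intro t ht x hx
    have h := (hV.dx j hj t ht x hx).congr (fun y hy => ih (by omega) t ht y hy)
      (ih (by omega) t ht x hx)
    exact (hc.uniqueDiff hx).eq_deriv _ (hU.dx j hj t ht x hx) h

theorem exists_global_jetSol (hc : Coef a ν s) (hf : Init a ν f) (hf' : IsJet a f) :
    ∃ U : ℕ → ℝ → ℝ → ℝ, ∀ m : ℕ, JetSol s ν a (m + 6) m f U := by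
  choose Z hZ using fun m : ℕ => exists_jetSol hc hf hf' (k := m + 6) (by omega)
    (T := m) (Nat.cast_nonneg m)
  refine ⟨fun j t x => Z (j + ⌈t⌉₊) j t x, fun m => (hZ m).congr (Nat.cast_nonneg m)
    fun j hj t ht x hx => ?_⟩
  have hT : t ≤ ((j + ⌈t⌉₊ : ℕ) : ℝ) := by
    push_cast
    have := Nat.le_ceil t
    have : (0 : ℝ) ≤ j := Nat.cast_nonneg j
    linarith
  have h1 := (hZ (j + ⌈t⌉₊)).mono (k' := min (j + ⌈t⌉₊) m + 6) (T' := t) (by omega) hT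
  have h2 := (hZ m).mono (k' := min (j + ⌈t⌉₊) m + 6) (T' := t) (by omega) ht.2
  exact h1.unique hc (by omega) h2 (by omega) t ⟨ht.1, le_rfl⟩ x hx

end

/-! ### Smoothness -/

lemma hasFDerivWithinAt_of_partial {S S' : Set ℝ} (hS : Convex ℝ S) {G Gt Gx : ℝ → ℝ → ℝ}
    (ht : ∀ t ∈ S, ∀ x ∈ S', HasDerivWithinAt (fun t => G t x) (Gt t x) S t)
    (hx : ∀ t ∈ S, ∀ x ∈ S', HasDerivWithinAt (G t) (Gx t x) S' x)
    (hGt : ContinuousOn (fun y : ℝ × ℝ => Gt y.1 y.2) (S ×ˢ S')) {y : ℝ × ℝ} (hy : y ∈ S ×ˢ S') :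
    HasFDerivWithinAt (fun y : ℝ × ℝ => G y.1 y.2)
      (Gt y.1 y.2 • ContinuousLinearMap.fst ℝ ℝ ℝ + Gx y.1 y.2 • ContinuousLinearMap.snd ℝ ℝ ℝ)
      (S ×ˢ S') y := by
  obtain ⟨t, x⟩ := y
  rw [hasFDerivWithinAt_iff_isLittleO, Asymptotics.isLittleO_iff]
  intro c hc
  have h1 := (hasDerivWithinAt_iff_isLittleO.1 (hx t hy.1 x hy.2)).def (half_pos hc)
  obtain ⟨δ₁, hδ₁, h1⟩ := Metric.mem_nhdsWithin_iff.1 h1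
  obtain ⟨δ₂, hδ₂, h2⟩ := Metric.continuousOn_iff.1 hGt (t, x) hy (c / 2) (half_pos hc)
  filter_upwards [self_mem_nhdsWithin, mem_nhdsWithin_of_mem_nhds
    (Metric.ball_mem_nhds (t, x) (lt_min hδ₁ hδ₂))] with z hz hzb
  obtain ⟨r, w⟩ := z
  have hzb : max |r - t| |w - x| < min δ₁ δ₂ := by
    simpa [Prod.dist_eq, Real.dist_eq] using hzb
  have e1 : |G t w - G t x - (w - x) * Gx t x| ≤ c / 2 * |w - x| := by
    have := h1 ⟨show dist w x < δ₁ from ((le_max_right _ _).trans_lt hzb).trans_le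
      (min_le_left _ _), hz.2⟩
    simpa using this
  have e2 : |G r w - r * Gt t x - (G t w - t * Gt t x)| ≤ c / 2 * |r - t| := by
    have hseg : segment ℝ t r ⊆ S := hS.segment_subset hy.1 hz.1
    refine Convex.norm_image_sub_le_of_norm_hasDerivWithin_le (s := segment ℝ t r)
      (f := fun r => G r w - r * Gt t x) (f' := fun r => Gt r w - 1 * Gt t x) (fun q hq =>
        (((ht q (hseg hq) w hz.2).mono hseg).sub ((hasDerivWithinAt_id q _).mul_const _)))
      (fun q hq => ?_) (convex_segment t r) (left_mem_segment ℝ t r) (right_mem_segment ℝ t r)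
    have hq' : |q - t| ≤ |r - t| := by
      rw [segment_eq_uIcc] at hq
      exact abs_sub_left_of_mem_uIcc hq
    have := h2 (q, w) ⟨hseg hq, hz.2⟩ (by
      rw [Prod.dist_eq, Real.dist_eq, Real.dist_eq]
      exact ((max_le_max hq' le_rfl).trans_lt hzb).trans_le (min_le_right _ _))
    rw [one_mul]
    exact this.le
  have e3 : ‖((r, w) : ℝ × ℝ) - (t, x)‖ = max |r - t| |w - x| := rfl
  rw [e3]
  simp only [_root_.add_apply, _root_.smul_apply,
    ContinuousLinearMap.coe_fst', ContinuousLinearMap.coe_snd', Prod.mk_sub_mk, smul_eq_mul,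
    Real.norm_eq_abs]
  have e4 : G r w - G t x - (Gt t x * (r - t) + Gx t x * (w - x)) =
    (G r w - r * Gt t x - (G t w - t * Gt t x)) + (G t w - G t x - (w - x) * Gx t x) := by ring
  rw [e4]
  refine (abs_add_le _ _).trans ((add_le_add e2 e1).trans ?_)
  have := le_max_left |r - t| |w - x|
  have := le_max_right |r - t| |w - x|
  nlinarith

section
variable {a ν : ℝ} {s f : ℕ → ℝ → ℝ} {U : ℕ → ℝ → ℝ → ℝ}

lemma Icc_mem_nhdsWithin_Ici {t b : ℝ} (h : t < b) : Icc 0 b ∈ nhdsWithin t (Ici 0) :=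
  mem_nhdsWithin.2 ⟨Iio b, isOpen_Iio, h, fun _ hy => ⟨hy.2, le_of_lt hy.1⟩⟩

lemma global_continuousOn (hU : ∀ m : ℕ, JetSol s ν a (m + 6) m f U) (j : ℕ) :
    ContinuousOn (fun y : ℝ × ℝ => U j y.1 y.2) (Ici 0 ×ˢ Icc 1 a) := by
  rintro ⟨t, x⟩ ⟨ht, hx⟩
  obtain ⟨m, hm⟩ := exists_nat_gt t
  have hlt : t < ((m + j : ℕ) : ℝ) := hm.trans_le (by exact_mod_cast Nat.le_add_right m j)
  refine ((hU (m + j)).cont j (by omega) (t, x) ⟨⟨ht, hlt.le⟩, hx⟩).mono_of_mem_nhdsWithin ?_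
  rw [nhdsWithin_prod_eq]
  exact Filter.prod_mem_prod (Icc_mem_nhdsWithin_Ici hlt) self_mem_nhdsWithin

lemma global_dx (hU : ∀ m : ℕ, JetSol s ν a (m + 6) m f U) (j : ℕ) {t : ℝ} (ht : t ∈ Ici 0)
    {x : ℝ} (hx : x ∈ Icc 1 a) : HasDerivWithinAt (U j t) (U (j + 1) t x) (Icc 1 a) x := by
  obtain ⟨m, hm⟩ := exists_nat_gt t
  have hlt : t < ((m + j : ℕ) : ℝ) := hm.trans_le (by exact_mod_cast Nat.le_add_right m j)
  exact (hU (m + j)).dx j (by omega) t ⟨ht, hlt.le⟩ x hx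

lemma global_dt (hU : ∀ m : ℕ, JetSol s ν a (m + 6) m f U) (j : ℕ) {t : ℝ} (ht : t ∈ Ici 0)
    {x : ℝ} (hx : x ∈ Icc 1 a) : HasDerivWithinAt (fun t => U j t x)
      (jev s (jD^[j] (jF ν)) x fun i => U i t x) (Ici 0) t := by
  obtain ⟨m, hm⟩ := exists_nat_gt t
  have hlt : t < ((m + j : ℕ) : ℝ) := hm.trans_le (by exact_mod_cast Nat.le_add_right m j)
  exact ((hU (m + j)).dt j (by omega) t ⟨ht, hlt.le⟩ x hx).mono_of_mem_nhdsWithin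
    (Icc_mem_nhdsWithin_Ici hlt)

lemma global_contDiffOn (hs : ∀ i, ContDiffOn ℝ (⊤ : ℕ∞) (s i) (Icc 1 a))
    (hU : ∀ m : ℕ, JetSol s ν a (m + 6) m f U) (j : ℕ) :
    ContDiffOn ℝ (⊤ : ℕ∞) (fun y : ℝ × ℝ => U j y.1 y.2) (Ici 0 ×ˢ Icc 1 a) := by
  refine contDiffOn_infty.2 fun n => ?_
  induction n generalizing j with
  | zero => exact contDiffOn_zero.2 (global_continuousOn hU j)
  | succ n ih =>
    have hdt : ContDiffOn ℝ n (fun y : ℝ × ℝ => jev s (jD^[j] (jF ν)) y.2 fun i => U i y.1 y.2)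
        (Ici 0 ×ˢ Icc 1 a) :=
      jev_contDiffOn (fun i => (hs i).of_le (by exact_mod_cast le_top)) (jDF_mem ν j)
        contDiff_snd.contDiffOn (fun y hy => hy.2) fun i _ => ih i
    rw [Nat.cast_add, Nat.cast_one, contDiffOn_succ_iff_hasFDerivWithinAt (by simp)]
    intro y hy
    rw [insert_eq_of_mem hy]
    exact ⟨_, self_mem_nhdsWithin, by simp, _, fun z hz => hasFDerivWithinAt_of_partial
      (Gt := fun t x => jev s (jD^[j] (jF ν)) x fun i => U i t x) (Gx := U (j + 1))
      (convex_Ici 0) (fun t ht x hx => global_dt hU j ht hx) (fun t ht x hx => global_dx hU j ht hx)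
      hdt.continuousOn hz, (hdt.smul contDiffOn_const).add ((ih (j + 1)).smul contDiffOn_const)⟩

end

lemma hasDerivWithinAt_iteratedDerivWithin {a : ℝ} (ha : 1 < a) {g : ℝ → ℝ}
    (hg : ContDiffOn ℝ (⊤ : ℕ∞) g (Icc 1 a)) (j : ℕ) {x : ℝ} (hx : x ∈ Icc 1 a) :
    HasDerivWithinAt (iteratedDerivWithin j g (Icc 1 a))
      (iteratedDerivWithin (j + 1) g (Icc 1 a) x) (Icc 1 a) x := by
  rw [iteratedDerivWithin_succ]
  exact (hg.differentiableOn_iteratedDerivWithin (by exact_mod_cast ENat.natCast_lt_top j)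
    (uniqueDiffOn_Icc ha) x hx).hasDerivWithinAt

lemma contDiffOn_iteratedDerivWithin {a : ℝ} (ha : 1 < a) {g : ℝ → ℝ}
    (hg : ContDiffOn ℝ (⊤ : ℕ∞) g (Icc 1 a)) (j : ℕ) :
    ContDiffOn ℝ (⊤ : ℕ∞) (iteratedDerivWithin j g (Icc 1 a)) (Icc 1 a) := by
  induction j with
  | zero => simpa using hg
  | succ j ih =>
    rw [iteratedDerivWithin_succ]
    exact ih.derivWithin (uniqueDiffOn_Icc ha) (by exact_mod_cast le_top)

/-- **Long-time existence under supercritical phase** (Theorem 1.2, reduced form).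
If `n ≥ 3`, `σ > 0` on `(1,a)` with `σ(1) = σ(a) = 0`, and the smooth initial data `f₀`
has supercritical phase, then the reduced line bundle mean curvature flow starting at `f₀`
has a smooth solution for all time `t ≥ 0`. -/
theorem long_time_existence (n : ℕ) (hn : 3 ≤ n) (a : ℝ) (ha : 1 < a)
    (σ : ℝ → ℝ) (hσ : ContDiffOn ℝ (⊤ : ℕ∞) σ (Icc 1 a))
    (hσpos : ∀ x ∈ Ioo 1 a, 0 < σ x) (hσ1 : σ 1 = 0) (hσa : σ a = 0)
    (f₀ : ℝ → ℝ) (hf₀ : ContDiffOn ℝ (⊤ : ℕ∞) f₀ (Icc 1 a))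
    (hphase : ∀ x ∈ Icc 1 a,
      ((n : ℝ) - 1) * arctan (f₀ x / x) + arctan (derivWithin f₀ (Icc 1 a) x) >
        ((n : ℝ) - 2) * π / 2) :
    ∃ f : ℝ → ℝ → ℝ,
      ContDiffOn ℝ (⊤ : ℕ∞) (fun pt : ℝ × ℝ => f pt.1 pt.2) (Ici 0 ×ˢ Icc 1 a) ∧
      (∀ x ∈ Icc 1 a, f 0 x = f₀ x) ∧
      (∀ t ∈ Ici (0 : ℝ), ∀ x ∈ Icc 1 a,
        derivWithin (fun s => f s x) (Ici 0) t = flowRHS n a σ f t x) := by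
  have hcoef : Coef a ((n : ℝ) - 1) fun i => iteratedDerivWithin i σ (Icc 1 a) := by
    refine ⟨ha, ?_, fun i x hx => hasDerivWithinAt_iteratedDerivWithin ha hσ i hx, ?_, ?_, ?_⟩
    · have : (3 : ℝ) ≤ n := by exact_mod_cast hn
      linarith
    · intro x hx
      rw [iteratedDerivWithin_zero]
      rcases hx.1.eq_or_lt with e | h1
      · rw [← e, hσ1]
      rcases hx.2.eq_or_lt with e | h2
      · rw [e, hσa]
      exact (hσpos x ⟨h1, h2⟩).le
    · simpa using hσ1
    · simpa using hσa
  have hinit : Init a ((n : ℝ) - 1) fun j => iteratedDerivWithin j f₀ (Icc 1 a) := by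
    refine ⟨fun j => (contDiffOn_iteratedDerivWithin ha hf₀ j).continuousOn, fun x hx => ?_⟩
    have := hphase x hx
    simp only [angle, iteratedDerivWithin_zero, iteratedDerivWithin_one]
    linarith
  obtain ⟨U, hU⟩ := exists_global_jetSol hcoef hinit
    fun j x hx => hasDerivWithinAt_iteratedDerivWithin ha hf₀ j hx
  refine ⟨U 0, global_contDiffOn (fun i => contDiffOn_iteratedDerivWithin ha hσ i) hU 0,
    fun x hx => by simpa using (hU 0).init 0 (by omega) x hx, fun t ht x hx => ?_⟩
  have hud := uniqueDiffOn_Icc ha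
  have h1 : ∀ y ∈ Icc 1 a, derivWithin (U 0 t) (Icc 1 a) y = U 1 t y := fun y hy =>
    (global_dx hU 0 ht hy).derivWithin (hud y hy)
  have h2 : derivWithin (derivWithin (U 0 t) (Icc 1 a)) (Icc 1 a) x = U 2 t x := by
    rw [derivWithin_congr h1 (h1 x hx)]
    exact (global_dx hU 1 ht hx).derivWithin (hud x hx)
  rw [(global_dt hU 0 ht hx).derivWithin (uniqueDiffOn_Ici 0 t ht), flowRHS, h2, h1 x hx]
  simp only [Function.iterate_zero, id, jF_eq, jH, jev_mul, jev_add, jev_sub, jev_p, jev_q, jev_u,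
    jev_C, jev_x, jev_sg, iteratedDerivWithin_zero]
  ring
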